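/- Let π/2 < w < π and let U_{π−w} ⊂ S² denote a Reuleaux triangle of width π−w. There exists a constant c_w > 0 depending only on w such that for every ε > 0 and every convex body K ⊂ S² with w(K) = w and area(K) ≤ area(U°_{π−w}) + ε, there exists a Reuleaux triangle U of width π−w with δ(K,U°) ≤ c_w·√ε. -/

import Mathlib

open scoped RealInnerProductSpace
open Real MeasureTheory

noncomputable section

namespace SphericalPal

/-- Ambient Euclidean space of the sphere `Sⁿ`. -/
abbrev E (n : ℕ) := EuclideanSpace ℝ (Fin (n + 1))

/-- The unit sphere `Sⁿ ⊂ ℝⁿ⁺¹`. -/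
def unitSphere (n : ℕ) : Set (E n) := Metric.sphere 0 1

variable {n : ℕ}

/-- Geodesic (angular) distance on the unit sphere. -/
def gdist (x y : E n) : ℝ := Real.arccos ⟪x, y⟫

/-- The geodesic segment joining `x` and `y` on the sphere. -/
def seg (x y : E n) : Set (E n) :=
  {z ∈ unitSphere n | gdist x z + gdist z y = gdist x y}

/-- A subset of the sphere is spherically convex if it lies on the sphere, is contained
in an open hemisphere and contains the geodesic segment joining any two of its points. -/
def SConvex (X : Set (E n)) : Prop :=
  X ⊆ unitSphere n ∧
  (∃ u ∈ unitSphere n, ∀ x ∈ X, 0 < ⟪u, x⟫) ∧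
  ∀ x ∈ X, ∀ y ∈ X, seg x y ⊆ X

/-- Spherical convex hull. -/
def sconv (X : Set (E n)) : Set (E n) := ⋂₀ {C | SConvex C ∧ X ⊆ C}

/-- Relative (spherical) interior of a subset of the sphere. -/
def sInterior (X : Set (E n)) : Set (E n) :=
  {x ∈ X | ∃ ε > 0, ∀ y ∈ unitSphere n, gdist x y < ε → y ∈ X}

/-- A spherical convex body: compact, spherically convex, with nonempty relative interior. -/
def IsConvexBody (K : Set (E n)) : Prop :=
  SConvex K ∧ IsCompact K ∧ (sInterior K).Nonempty

/-- The lune determined by `u` and `v` (intersection of the closed hemispheres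
opposite to `u` and to `v`). -/
def lune (u v : E n) : Set (E n) := {x ∈ unitSphere n | ⟪x, u⟫ ≤ 0 ∧ ⟪x, v⟫ ≤ 0}

/-- The bounding hemisphere of `lune u v` contained in the great sphere orthogonal to `u`. -/
def luneFace (u v : E n) : Set (E n) := {x ∈ unitSphere n | ⟪x, u⟫ = 0 ∧ ⟪x, v⟫ ≤ 0}

/-- The center (midpoint) of the bounding hemisphere `luneFace u v`. -/
def luneFaceCenter (u v : E n) : E n :=
  ‖(⟪u, v⟫ • u - v : E n)‖⁻¹ • (⟪u, v⟫ • u - v)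

/-- The breadth of the lune `lune u v`: the geodesic distance of the centers of the
two bounding hemispheres. -/
def breadth (u v : E n) : ℝ := gdist (luneFaceCenter u v) (luneFaceCenter v u)

/-- `lune u v` is a supporting lune of `K`. -/
def IsSupportingLune (K : Set (E n)) (u v : E n) : Prop :=
  u ∈ unitSphere n ∧ v ∈ unitSphere n ∧ u ≠ v ∧ u ≠ -v ∧
  K ⊆ lune u v ∧ (K ∩ luneFace u v).Nonempty ∧ (K ∩ luneFace v u).Nonempty

/-- The (minimal) width of a spherical convex body. -/
def width (K : Set (E n)) : ℝ :=
  sInf {b | ∃ u v : E n, IsSupportingLune K u v ∧ b = breadth u v}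

/-- The width of `K` with respect to the supporting great hypersphere orthogonal to `u`:
the minimal breadth among supporting lunes of `K` having one bounding hemisphere
contained in that great hypersphere. -/
def widthAt (K : Set (E n)) (u : E n) : ℝ :=
  sInf {b | ∃ v : E n, IsSupportingLune K u v ∧ b = breadth u v}

/-- The great hypersphere orthogonal to `u` supports `K`. -/
def IsSupportingSphere (K : Set (E n)) (u : E n) : Prop :=
  u ∈ unitSphere n ∧ (∀ x ∈ K, ⟪x, u⟫ ≤ 0) ∧ ∃ x ∈ K, ⟪x, u⟫ = 0

/-- `K` is of constant width `w`. -/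
def HasConstantWidth (K : Set (E n)) (w : ℝ) : Prop :=
  ∀ u : E n, IsSupportingSphere K u → widthAt K u = w

/-- `K` is a reduced convex body. -/
def IsReduced (K : Set (E n)) : Prop :=
  IsConvexBody K ∧ ∀ L : Set (E n), IsConvexBody L → L ⊆ K → L ≠ K → width L < width K

/-- The spherical polar set. -/
def polar (A : Set (E n)) : Set (E n) := {u ∈ unitSphere n | ∀ a ∈ A, ⟪a, u⟫ ≤ 0}

/-- Closed geodesic ball on the sphere. -/
def gball (p : E n) (r : ℝ) : Set (E n) := {x ∈ unitSphere n | gdist p x ≤ r}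

/-- The inradius of `K`: the largest `r` such that some geodesic ball of radius `r`
is contained in `K`. -/
def inradius (K : Set (E n)) : ℝ :=
  sSup {r | 0 ≤ r ∧ ∃ p ∈ unitSphere n, gball p r ⊆ K}

/-- Geodesic distance from a point to a set. -/
def sdist (x : E n) (A : Set (E n)) : ℝ := sInf (gdist x '' A)

/-- Hausdorff distance with respect to the geodesic metric. -/
def hausdorffG (A B : Set (E n)) : ℝ :=
  max (sSup ((fun x => sdist x B) '' A)) (sSup ((fun y => sdist y A) '' B))

/-- Two subsets of the sphere are congruent, i.e., isometric by an orthogonal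
transformation of the ambient Euclidean space. -/
def Congruent (A B : Set (E n)) : Prop :=
  ∃ f : E n ≃ₗᵢ[ℝ] E n, f '' A = B

/-- Spherical surface measure on `S²` (2-dimensional Hausdorff measure). -/
def area (X : Set (E 2)) : ℝ := (μH[2] X).toReal

/-- The spherical angle `∠(x, p, y)` at `p` between the geodesic segments `[p,x]`, `[p,y]`. -/
def sangle (x p y : E 2) : ℝ :=
  InnerProductGeometry.angle (x - ⟪p, x⟫ • p) (y - ⟪p, y⟫ • p)

/-- `T` is a regular spherical triangle: the spherical convex hull of three points
with equal pairwise geodesic distances, not lying on a common great circle. -/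
def IsRegularTriangle (T : Set (E 2)) : Prop :=
  ∃ v₁ v₂ v₃ : E 2, v₁ ∈ unitSphere 2 ∧ v₂ ∈ unitSphere 2 ∧ v₃ ∈ unitSphere 2 ∧
    LinearIndependent ℝ ![v₁, v₂, v₃] ∧
    gdist v₁ v₂ = gdist v₂ v₃ ∧ gdist v₂ v₃ = gdist v₁ v₃ ∧
    T = sconv {v₁, v₂, v₃}

/-- Three points on the sphere with equal pairwise geodesic distance `a`
(the vertices of a regular spherical triangle of side length `a`). -/
def IsRegularCenters (x₁ x₂ x₃ : E 2) (a : ℝ) : Prop :=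
  x₁ ∈ unitSphere 2 ∧ x₂ ∈ unitSphere 2 ∧ x₃ ∈ unitSphere 2 ∧
  gdist x₁ x₂ = a ∧ gdist x₂ x₃ = a ∧ gdist x₁ x₃ = a

/-- `U` is a spherical Reuleaux triangle: intersection of three geodesic balls of radius `r`
whose centers have pairwise geodesic distance `r`. -/
def IsReuleaux (U : Set (E 2)) (r : ℝ) : Prop :=
  ∃ x₁ x₂ x₃ : E 2, IsRegularCenters x₁ x₂ x₃ r ∧
    U = gball x₁ r ∩ gball x₂ r ∩ gball x₃ r

/-- The body `U°_{π-w}` for `w > π/2`: the spherical convex hull of three geodesic balls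
of radius `w - π/2` (whose centers are meant to form a regular triangle of side `π - w`). -/
def polarReuleaux (x₁ x₂ x₃ : E 2) (w : ℝ) : Set (E 2) :=
  sconv (gball x₁ (w - π / 2) ∪ gball x₂ (w - π / 2) ∪ gball x₃ (w - π / 2))

end SphericalPal

open SphericalPal

/-! Part P1a -/

namespace PalAux

/-- radial projection -/
def nrm (x : E 2) : E 2 := ‖x‖⁻¹ • x

/-- normalised rotation invariant measure on the sphere (total mass `4π`) -/
def sg : Measure (E 2) := (3 : ENNReal) • ((volume.restrict (Metric.ball 0 1)).map nrm)

lemma measurable_nrm : Measurable nrm := by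
  unfold nrm; fun_prop

def mk3 (q : ℝ × (ℝ × ℝ)) : E 2 := !₂[q.1, q.2.1, q.2.2]

lemma mp_mk3 : MeasurePreserving mk3 (volume : Measure (ℝ × (ℝ × ℝ))) volume := by
  have h1 : MeasurePreserving (MeasurableEquiv.toLp 2 (Fin 3 → ℝ)) volume volume :=
    (EuclideanSpace.volume_preserving_symm_measurableEquiv_toLp (Fin 3)).symm
  have h2 := (volume_preserving_piFinSuccAbove (fun _ : Fin 3 => ℝ) 0).symm
  have h3 : MeasurePreserving (Prod.map (id : ℝ → ℝ) (MeasurableEquiv.finTwoArrow (α := ℝ)).symm)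
      (volume.prod volume) (volume.prod volume) :=
    (MeasurePreserving.id volume).prod (volume_preserving_finTwoArrow ℝ).symm
  have h4 := h1.comp (h2.comp h3)
  have he : mk3 = (MeasurableEquiv.toLp 2 (Fin 3 → ℝ)) ∘
      (MeasurableEquiv.piFinSuccAbove (fun _ : Fin 3 => ℝ) 0).symm ∘
      Prod.map (id : ℝ → ℝ) (MeasurableEquiv.finTwoArrow (α := ℝ)).symm := by
    funext q
    ext i
    fin_cases i <;> rfl
  rw [he]
  exact h4

lemma measurable_mk3 : Measurable mk3 := mp_mk3.measurable

lemma isFinite_sg : IsFiniteMeasure sg := by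
  constructor
  unfold sg
  rw [Measure.smul_apply, Measure.map_apply measurable_nrm MeasurableSet.univ]
  simp only [Set.preimage_univ, Measure.restrict_apply MeasurableSet.univ, Set.univ_inter, smul_eq_mul]
  exact ENNReal.mul_lt_top (by norm_num) measure_ball_lt_top

instance : IsFiniteMeasure sg := isFinite_sg

lemma sg_apply {X : Set (E 2)} (hX : MeasurableSet X) :
    sg X = 3 * volume (nrm ⁻¹' X ∩ Metric.ball 0 1) := by
  unfold sg
  rw [Measure.smul_apply, Measure.map_apply measurable_nrm hX,
    Measure.restrict_apply (measurable_nrm hX), smul_eq_mul]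

lemma sg_univ : sg.real Set.univ = 4 * π := by
  rw [measureReal_def, sg_apply MeasurableSet.univ, Set.preimage_univ, Set.univ_inter]
  have := EuclideanSpace.volume_ball_fin_three (0 : E 2) 1
  rw [show volume (Metric.ball (0 : E 2) 1) = _ from this]
  simp only [ENNReal.toReal_mul]
  norm_num
  rw [ENNReal.toReal_ofReal (by positivity)]; ring

lemma sg_sphere : sg (unitSphere 2)ᶜ = 0 := by
  rw [sg_apply (X := (unitSphere 2)ᶜ) (Metric.isClosed_sphere.measurableSet.compl)]
  have : nrm ⁻¹' (unitSphere 2)ᶜ ⊆ {0} := by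
    intro x hx
    by_contra h
    apply hx
    simp only [Set.mem_singleton_iff] at h
    simp [unitSphere, nrm, norm_smul, h]
  rw [measure_mono_null (Set.inter_subset_left.trans this) (by simp)]
  simp

lemma mp_isom (f : E 2 ≃ₗᵢ[ℝ] E 2) : MeasurePreserving f sg sg := by
  refine ⟨f.continuous.measurable, ?_⟩
  ext X hX
  rw [Measure.map_apply f.continuous.measurable hX, sg_apply hX,
    sg_apply (f.continuous.measurable hX)]
  congr 1
  have h := f.measurePreserving
  rw [← h.measure_preimage ((measurable_nrm hX).inter Metric.isOpen_ball.measurableSet).nullMeasurableSet]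
  congr 1
  ext x
  simp [nrm]

lemma sg_plane {a : E 2} (ha : a ≠ 0) : sg {u | ⟪u, a⟫ = 0} = 0 := by
  have hm : MeasurableSet {u : E 2 | ⟪u, a⟫ = 0} := by
    apply IsClosed.measurableSet
    exact isClosed_eq (by fun_prop) (by fun_prop)
  rw [sg_apply hm]
  have : volume {u : E 2 | ⟪u, a⟫ = 0} = 0 := by
    have := Measure.addHaar_submodule (volume : Measure (E 2)) (ℝ ∙ a)ᗮ (by
      intro h
      have : a ∈ (ℝ ∙ a)ᗮ := by rw [h]; trivial
      rw [Submodule.mem_orthogonal_singleton_iff_inner_right] at this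
      simp at this; exact ha this)
    convert this using 2
    ext u
    simp [Submodule.mem_orthogonal_singleton_iff_inner_left]
  rw [measure_mono_null _ this]
  · simp
  · rintro x ⟨hx, -⟩
    by_cases h0 : x = 0
    · simp [h0]
    · simp only [Set.mem_preimage, nrm, Set.mem_ofPred_eq, inner_smul_left] at hx
      simpa [h0] using hx

end PalAux

/-! Part P1b -/

namespace PalAux
open scoped Pointwise

def N2 (y : ℝ × ℝ) : ℝ := y.1 ^ 2 + y.2 ^ 2

lemma measurable_N2 : Measurable N2 := by unfold N2; fun_prop

/-- planar homogeneous set -/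
def Hom2 (B : Set (ℝ × ℝ)) : Prop := ∀ y, ∀ α : ℝ, 0 < α → (α • y ∈ B ↔ y ∈ B)

def pA (B : Set (ℝ × ℝ)) : ℝ := (volume (B ∩ {y | N2 y < 1})).toReal

lemma vol_disc_lt (s : ℝ) (B : Set (ℝ × ℝ)) : volume (B ∩ {y | N2 y < s}) < ⊤ := by
  have : B ∩ {y | N2 y < s} ⊆ Metric.closedBall (0 : ℝ × ℝ) (1 + |s|) := by
    rintro y ⟨-, hy⟩
    simp only [Set.mem_ofPred_eq, N2] at hy
    have hs := le_abs_self s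
    have h0 := abs_nonneg s
    rw [mem_closedBall_zero_iff, Prod.norm_def, max_le_iff, Real.norm_eq_abs, Real.norm_eq_abs]
    constructor
    · apply abs_le_of_sq_le_sq _ (by positivity); nlinarith [sq_nonneg y.2]
    · apply abs_le_of_sq_le_sq _ (by positivity); nlinarith [sq_nonneg y.1]
  exact (measure_mono this).trans_lt measure_closedBall_lt_top

lemma vol_disc {B : Set (ℝ × ℝ)} (hB : Hom2 B) {s : ℝ} (hs : 0 ≤ s) :
    volume (B ∩ {y | N2 y < s}) = ENNReal.ofReal (s * pA B) := by
  rcases hs.eq_or_lt with rfl | hs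
  · have : B ∩ {y | N2 y < 0} = ∅ := by
      ext y; simp [N2]; intro _; positivity
    simp [this]
  · have h1 : B ∩ {y | N2 y < s} = (Real.sqrt s) • (B ∩ {y | N2 y < 1}) := by
      have hq : 0 < Real.sqrt s := Real.sqrt_pos.2 hs
      ext y
      rw [Set.mem_smul_set_iff_inv_smul_mem₀ hq.ne']
      simp only [Set.mem_inter_iff, Set.mem_ofPred_eq]
      rw [hB y _ (inv_pos.2 hq)]
      have : N2 ((Real.sqrt s)⁻¹ • y) = N2 y / s := by
        simp only [N2, Prod.smul_fst, Prod.smul_snd, smul_eq_mul, mul_pow, inv_pow, Real.sq_sqrt hs.le]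
        field_simp
      rw [this, div_lt_one hs]
    rw [h1, Measure.addHaar_smul]
    simp only [Module.finrank_prod, Module.finrank_self]
    have h2 : Real.sqrt s ^ (1 + 1) = s := by norm_num; exact Real.sq_sqrt hs.le
    rw [h2, abs_of_pos hs, ENNReal.ofReal_mul hs.le, pA,
      ENNReal.ofReal_toReal (vol_disc_lt 1 B).ne]

lemma vol_ann {B : Set (ℝ × ℝ)} (hB : Hom2 B) (hm : MeasurableSet B) {s t : ℝ} (hs : 0 ≤ s) (hst : s ≤ t) :
    volume (B ∩ {y | s ≤ N2 y ∧ N2 y < t}) = ENNReal.ofReal ((t - s) * pA B) := by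
  have h : B ∩ {y | s ≤ N2 y ∧ N2 y < t} = (B ∩ {y | N2 y < t}) \ (B ∩ {y | N2 y < s}) := by
    ext y; simp only [Set.mem_inter_iff, Set.mem_ofPred_eq, Set.mem_sdiff]
    constructor
    · rintro ⟨a, b, c⟩; exact ⟨⟨a, c⟩, fun h => absurd h.2 (not_lt.2 b)⟩
    · rintro ⟨⟨a, b⟩, c⟩; exact ⟨a, not_lt.1 fun h => c ⟨a, h⟩, b⟩
  have hA : 0 ≤ pA B := ENNReal.toReal_nonneg
  rw [h, measure_sdiff, vol_disc hB (hs.trans hst), vol_disc hB hs, ← ENNReal.ofReal_sub _ (by positivity)]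
  · congr 1; ring
  · rintro y ⟨a, b⟩; exact ⟨a, lt_of_lt_of_le b hst⟩
  · exact (hm.inter (measurableSet_lt measurable_N2 measurable_const)).nullMeasurableSet
  · exact (vol_disc_lt s B).ne

def slabSet (B : Set (ℝ × ℝ)) (t : ℝ) : Set (ℝ × (ℝ × ℝ)) :=
  {q | q.2 ∈ B ∧ 0 < q.1 ∧ q.1 ^ 2 * (1 - t ^ 2) ≤ t ^ 2 * N2 q.2 ∧ q.1 ^ 2 + N2 q.2 < 1}

lemma vol_slab {B : Set (ℝ × ℝ)} (hB : Hom2 B) (hm : MeasurableSet B) {t : ℝ} (ht : 0 < t) (ht1 : t ≤ 1) :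
    volume (slabSet B t) = ENNReal.ofReal (2 * t / 3 * pA B) := by
  have hms : MeasurableSet (slabSet B t) := by
    unfold slabSet
    have := measurable_N2
    have h1 : MeasurableSet {q : ℝ × (ℝ × ℝ) | q.2 ∈ B} := measurable_snd hm
    have h2 : MeasurableSet {q : ℝ × (ℝ × ℝ) | 0 < q.1} := measurableSet_lt measurable_const measurable_fst
    have h3 : MeasurableSet {q : ℝ × (ℝ × ℝ) | q.1 ^ 2 * (1 - t ^ 2) ≤ t ^ 2 * N2 q.2} :=
      measurableSet_le (by fun_prop) (by fun_prop)
    have h4 : MeasurableSet {q : ℝ × (ℝ × ℝ) | q.1 ^ 2 + N2 q.2 < 1} :=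
      measurableSet_lt (by fun_prop) (by fun_prop)
    exact h1.inter (h2.inter (h3.inter h4))
  have hA : 0 ≤ pA B := ENNReal.toReal_nonneg
  rw [Measure.volume_eq_prod, Measure.prod_apply hms]
  have hsl : ∀ z : ℝ, volume (Prod.mk z ⁻¹' slabSet B t) =
      (Set.Ioo 0 t).indicator (fun z => ENNReal.ofReal ((1 - z ^ 2 / t ^ 2) * pA B)) z := by
    intro z
    by_cases hz : z ∈ Set.Ioo 0 t
    · rw [Set.indicator_of_mem hz]
      have e : Prod.mk z ⁻¹' slabSet B t = B ∩ {y | z ^ 2 * (1 - t ^ 2) / t ^ 2 ≤ N2 y ∧ N2 y < 1 - z ^ 2} := by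
        ext y
        simp only [slabSet, Set.mem_preimage, Set.mem_ofPred_eq, Set.mem_inter_iff, hz.1, true_and]
        rw [div_le_iff₀ (by positivity), mul_comm (N2 y), lt_sub_iff_add_lt, add_comm (N2 y)]
      have hzt : z ^ 2 < t ^ 2 := by nlinarith [hz.1, hz.2]
      rw [e, vol_ann hB hm]
      · congr 2; field_simp; ring
      · have : 0 ≤ 1 - t ^ 2 := by nlinarith
        positivity
      · rw [div_le_iff₀ (by positivity)]; nlinarith
    · rw [Set.indicator_of_notMem hz]
      have e : Prod.mk z ⁻¹' slabSet B t = ∅ := by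
        ext y
        simp only [slabSet, Set.mem_preimage, Set.mem_ofPred_eq, Set.mem_empty_iff_false, iff_false]
        rintro ⟨-, h0, h1, h2⟩
        apply hz
        refine ⟨h0, ?_⟩
        have h5 := mul_lt_mul_of_pos_left h2 (by positivity : 0 < t ^ 2)
        have : z ^ 2 < t ^ 2 := by nlinarith
        exact lt_of_pow_lt_pow_left₀ 2 ht.le this
      rw [e]; simp
  simp_rw [hsl]
  rw [lintegral_indicator measurableSet_Ioo, ← ofReal_integral_eq_lintegral_ofReal]
  · congr 1
    rw [integral_mul_const, ← integral_Ioc_eq_integral_Ioo, ← intervalIntegral.integral_of_le ht.le]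
    rw [intervalIntegral.integral_sub (by simp) (by apply Continuous.intervalIntegrable; fun_prop)]
    simp
    left; field_simp; ring
  · apply IntegrableOn.mono_set _ Set.Ioo_subset_Icc_self
    apply Continuous.integrableOn_Icc; fun_prop
  · refine (ae_restrict_mem measurableSet_Ioo).mono fun z hz => ?_
    have hzt : z ^ 2 ≤ t ^ 2 := by nlinarith [hz.1, hz.2]
    have : z ^ 2 / t ^ 2 ≤ 1 := by rw [div_le_one (by positivity)]; exact hzt
    exact mul_nonneg (by linarith) hA

end PalAux

/-! Part P1c -/

namespace PalAux

def e0 : E 2 := mk3 (1, 0, 0)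

lemma inner_mk3 (p q : ℝ × (ℝ × ℝ)) : ⟪mk3 p, mk3 q⟫ = p.1 * q.1 + p.2.1 * q.2.1 + p.2.2 * q.2.2 := by
  rw [PiLp.inner_apply]
  simp [mk3, Fin.sum_univ_three]
  ring

lemma norm_sq_mk3 (q : ℝ × (ℝ × ℝ)) : ‖mk3 q‖ ^ 2 = q.1 ^ 2 + N2 q.2 := by
  rw [← real_inner_self_eq_norm_sq, inner_mk3, N2]; ring

lemma smul_add_mk3 (α s : ℝ) (q : ℝ × (ℝ × ℝ)) :
    α • mk3 q + s • e0 = mk3 (α * q.1 + s, α • q.2) := by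
  ext i; fin_cases i <;> simp [mk3, e0]

/-- invariance under positive dilation and shifts along `n` -/
def CylInv (n : E 2) (B : Set (E 2)) : Prop := ∀ u : E 2, ∀ α s : ℝ, 0 < α → (α • u + s • n ∈ B ↔ u ∈ B)

lemma ms_slab (n : E 2) (t : ℝ) : MeasurableSet {u : E 2 | 0 < ⟪u, n⟫ ∧ ⟪u, n⟫ ≤ t} := by
  have h1 : MeasurableSet {u : E 2 | 0 < ⟪u, n⟫} := measurableSet_lt (by fun_prop) (by fun_prop)
  have h2 : MeasurableSet {u : E 2 | ⟪u, n⟫ ≤ t} := measurableSet_le (by fun_prop) (by fun_prop)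
  exact h1.inter h2

lemma sg_slab_e0 {B : Set (E 2)} (hB : CylInv e0 B) (hm : MeasurableSet B) {t : ℝ} (ht : 0 < t) (ht1 : t ≤ 1) :
    sg (B ∩ {u | 0 < ⟪u, e0⟫ ∧ ⟪u, e0⟫ ≤ t}) =
      ENNReal.ofReal (2 * t * pA {y | mk3 (0, y) ∈ B}) := by
  have hmm := ms_slab e0 t
  have hms : MeasurableSet (nrm ⁻¹' (B ∩ {u | 0 < ⟪u, e0⟫ ∧ ⟪u, e0⟫ ≤ t}) ∩ Metric.ball 0 1) :=
    (measurable_nrm (hm.inter hmm)).inter Metric.isOpen_ball.measurableSet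
  rw [sg_apply (hm.inter hmm), ← mp_mk3.measure_preimage hms.nullMeasurableSet]
  have hH : Hom2 {y | mk3 (0, y) ∈ B} := by
    intro y α hα
    have := hB (mk3 (0, y)) α 0 hα
    rw [smul_add_mk3] at this
    simpa using this
  have h0m : MeasurableSet {y | mk3 (0, y) ∈ B} := by
    apply (measurable_mk3.comp (g := mk3) (f := fun y : ℝ × ℝ => ((0 : ℝ), y)) (by fun_prop)) hm
  have he : mk3 ⁻¹' (nrm ⁻¹' (B ∩ {u | 0 < ⟪u, e0⟫ ∧ ⟪u, e0⟫ ≤ t}) ∩ Metric.ball 0 1) =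
      slabSet {y | mk3 (0, y) ∈ B} t := by
    ext q
    have hin : ⟪nrm (mk3 q), e0⟫ = ‖mk3 q‖⁻¹ * q.1 := by
      rw [nrm, real_inner_smul_left, e0, inner_mk3]; simp
    simp only [Set.mem_preimage, Set.mem_inter_iff, slabSet, Set.mem_ofPred_eq, hin, mem_ball_zero_iff]
    have hns := norm_sq_mk3 q
    have hN : 0 ≤ N2 q.2 := by unfold N2; positivity
    have hball : ‖mk3 q‖ < 1 ↔ q.1 ^ 2 + N2 q.2 < 1 := by
      rw [← hns]; exact (sq_lt_one_iff₀ (norm_nonneg _)).symm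
    rw [hball]
    by_cases hq : 0 < q.1
    · have hpos : 0 < ‖mk3 q‖ := by
        have : 0 < ‖mk3 q‖ ^ 2 := by rw [hns]; positivity
        exact (sq_pos_iff.1 this).lt_of_le' (norm_nonneg _)
      have h1 : nrm (mk3 q) ∈ B ↔ mk3 (0, q.2) ∈ B := by
        have a1 := hB (mk3 q) (‖mk3 q‖⁻¹) 0 (inv_pos.2 hpos)
        have a2 := hB (mk3 q) 1 (-q.1) one_pos
        rw [zero_smul, add_zero] at a1
        rw [smul_add_mk3] at a2
        simp only [one_mul, add_neg_cancel, one_smul] at a2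
        rw [nrm, a1, a2]
      have h2 : ‖mk3 q‖⁻¹ * q.1 ≤ t ↔ q.1 ^ 2 * (1 - t ^ 2) ≤ t ^ 2 * N2 q.2 := by
        rw [inv_mul_le_iff₀ hpos, ← pow_le_pow_iff_left₀ hq.le (by positivity) two_ne_zero, mul_pow, hns]
        constructor <;> intro h <;> nlinarith
      have h3 : 0 < ‖mk3 q‖⁻¹ * q.1 := by positivity
      rw [h1, h2]
      tauto
    · have : ¬ 0 < ‖mk3 q‖⁻¹ * q.1 := by
        intro h; apply hq
        by_contra h'
        have := mul_nonpos_of_nonneg_of_nonpos (inv_nonneg.2 (norm_nonneg (mk3 q))) (not_lt.1 h')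
        linarith
      tauto
  rw [he, vol_slab hH h0m ht ht1]
  rw [show (3 : ENNReal) = ENNReal.ofReal 3 by simp, ← ENNReal.ofReal_mul (by norm_num)]
  congr 1; ring

lemma norm_e0 : ‖e0‖ = 1 := by
  have := norm_sq_mk3 (1, 0, 0)
  have h : ‖e0‖ ^ 2 = 1 := by rw [e0, this]; simp [N2]
  exact (pow_eq_one_iff_of_nonneg (norm_nonneg _) two_ne_zero).1 h

lemma exists_isom {n : E 2} (hn : ‖n‖ = 1) : ∃ f : E 2 ≃ₗᵢ[ℝ] E 2, f e0 = n :=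
  ⟨_, Submodule.reflection_sub (by rw [norm_e0, hn])⟩

lemma sg_slab {n : E 2} (hn : ‖n‖ = 1) {B : Set (E 2)} (hB : CylInv n B) (hm : MeasurableSet B) :
    ∃ p : ℝ, 0 ≤ p ∧ ∀ t : ℝ, 0 < t → t ≤ 1 →
    sg (B ∩ {u | 0 < ⟪u, n⟫ ∧ ⟪u, n⟫ ≤ t}) = ENNReal.ofReal (2 * t * p) := by
  obtain ⟨f, rfl⟩ := exists_isom hn
  refine ⟨pA {y | mk3 (0, y) ∈ f ⁻¹' B}, ENNReal.toReal_nonneg, fun t ht ht1 => ?_⟩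
  rw [← sg_slab_e0 _ (f.continuous.measurable hm) ht ht1]
  · rw [← (mp_isom f).measure_preimage (hm.inter (ms_slab _ t)).nullMeasurableSet]
    congr 1
    ext u
    simp
  · intro u α s hα
    have := hB (f u) α s hα
    simpa using this

lemma nrm_sphere_ae : ∀ᵐ u ∂sg, ‖u‖ = 1 := by
  have := sg_sphere
  rw [ae_iff]
  convert this using 2
  ext u; simp [unitSphere]

lemma plane_ae {a : E 2} (ha : a ≠ 0) : ∀ᵐ u ∂sg, ⟪u, a⟫ ≠ 0 := by
  rw [ae_iff]; simpa using sg_plane ha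

/-- half-space part of a cylindrical set has half of the area -/
lemma sg_half {n : E 2} (hn : ‖n‖ = 1) {B : Set (E 2)} (hB : CylInv n B) (hm : MeasurableSet B) :
    sg B = 2 * sg (B ∩ {u | 0 < ⟪u, n⟫ ∧ ⟪u, n⟫ ≤ 1}) := by
  have hn0 : n ≠ 0 := by rintro rfl; simp at hn
  have hneg : sg (B ∩ {u | 0 < ⟪u, -n⟫ ∧ ⟪u, -n⟫ ≤ 1}) = sg (B ∩ {u | 0 < ⟪u, n⟫ ∧ ⟪u, n⟫ ≤ 1}) := by
    set f := (ℝ ∙ n)ᗮ.reflection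
    have hf : ∀ u, f u = u - (2 * ⟪u, n⟫) • n := by
      intro u
      have := Submodule.reflection_orthogonal_apply (K := ℝ ∙ n) u
      rw [this, Submodule.reflection_singleton_apply, real_inner_comm]
      simp [hn, two_smul, two_mul, add_smul]
    rw [← (mp_isom f).measure_preimage (hm.inter (ms_slab n 1)).nullMeasurableSet]
    congr 1
    ext u
    have h1 : f u ∈ B ↔ u ∈ B := by
      have := hB u 1 (-(2 * ⟪u, n⟫)) one_pos
      rw [hf, ← this, one_smul, neg_smul, sub_eq_add_neg]
    have h2 : ⟪f u, n⟫ = ⟪u, -n⟫ := by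
      rw [hf, inner_sub_left, real_inner_smul_left, real_inner_self_eq_norm_sq, hn, inner_neg_right]; ring
    simp only [Set.mem_inter_iff, Set.mem_preimage, Set.mem_ofPred_eq, h1, h2]
  have : sg B = sg ((B ∩ {u | 0 < ⟪u, n⟫ ∧ ⟪u, n⟫ ≤ 1}) ∪ (B ∩ {u | 0 < ⟪u, -n⟫ ∧ ⟪u, -n⟫ ≤ 1})) := by
    apply measure_congr
    rw [Filter.eventuallyEq_set]
    filter_upwards [nrm_sphere_ae, plane_ae hn0] with u hu hp
    have h1 : |⟪u, n⟫| ≤ 1 := by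
      have := abs_real_inner_le_norm u n
      rwa [hu, hn, one_mul] at this
    rw [abs_le] at h1
    simp only [Set.mem_union, Set.mem_inter_iff, Set.mem_ofPred_eq, inner_neg_right]
    rcases lt_or_gt_of_ne hp with h | h
    · have a1 : ¬ 0 < ⟪u, n⟫ := by linarith
      have a2 : 0 < -⟪u, n⟫ := by linarith
      have a3 : -⟪u, n⟫ ≤ 1 := by linarith
      tauto
    · tauto
  rw [this, measure_union _ (hm.inter (ms_slab _ 1)), hneg, two_mul]
  rw [Set.disjoint_left]
  rintro u ⟨-, h, -⟩ ⟨-, h', -⟩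
  rw [inner_neg_right] at h'
  linarith

lemma height {n : E 2} (hn : ‖n‖ = 1) {B : Set (E 2)} (hB : CylInv n B) (hm : MeasurableSet B)
    {t : ℝ} (ht : 0 < t) (ht1 : t ≤ 1) :
    sg.real (B ∩ {u | 0 < ⟪u, n⟫ ∧ ⟪u, n⟫ ≤ t}) = t / 2 * sg.real B := by
  obtain ⟨p, hp, h⟩ := sg_slab hn hB hm
  rw [measureReal_def, measureReal_def, sg_half hn hB hm, h t ht ht1, h 1 one_pos le_rfl,
    ENNReal.toReal_ofReal (by positivity), ENNReal.toReal_mul, ENNReal.toReal_ofReal (by positivity)]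
  simp; ring

/-- upper part -/
lemma height_ge {n : E 2} (hn : ‖n‖ = 1) {B : Set (E 2)} (hB : CylInv n B) (hm : MeasurableSet B)
    {t : ℝ} (ht : 0 < t) (ht1 : t ≤ 1) :
    sg.real (B ∩ {u | t < ⟪u, n⟫}) = (1 - t) / 2 * sg.real B := by
  have h1 := height hn hB hm ht ht1
  have h2 := height hn hB hm one_pos le_rfl
  have h3 : sg.real (B ∩ {u | 0 < ⟪u, n⟫ ∧ ⟪u, n⟫ ≤ 1}) =
      sg.real (B ∩ {u | 0 < ⟪u, n⟫ ∧ ⟪u, n⟫ ≤ t}) + sg.real (B ∩ {u | t < ⟪u, n⟫}) := by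
    rw [← measureReal_union]
    · apply measureReal_congr
      rw [Filter.eventuallyEq_set]
      filter_upwards [nrm_sphere_ae] with u hu
      have h1 : ⟪u, n⟫ ≤ 1 := by
        have := real_inner_le_norm u n
        rwa [hu, hn, one_mul] at this
      simp only [Set.mem_union, Set.mem_inter_iff, Set.mem_ofPred_eq]
      constructor
      · rintro ⟨a, b, c⟩
        rcases le_or_gt ⟪u, n⟫ t with h | h <;> tauto
      · rintro (h | h)
        · exact ⟨h.1, h.2.1, h1⟩
        · exact ⟨h.1, ht.trans h.2, h1⟩
    · rw [Set.disjoint_left]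
      rintro u ⟨-, -, h⟩ ⟨-, h'⟩
      exact absurd h (not_le.2 h')
    · exact hm.inter (measurableSet_lt (by fun_prop) (by fun_prop))
  linarith

lemma cap_area {n : E 2} (hn : ‖n‖ = 1) {t : ℝ} (ht : 0 < t) (ht1 : t ≤ 1) :
    sg.real {u | t < ⟪u, n⟫} = 2 * π * (1 - t) := by
  have := height_ge hn (B := Set.univ) (fun u α s _ => by simp) MeasurableSet.univ ht ht1
  rw [sg_univ, Set.univ_inter] at this
  rw [this]; ring
end PalAux

/-! Part P1d -/

namespace PalAux

def Sec (θ : ℝ) : Set (ℝ × ℝ) := {y | 0 < y.2 ∧ y.2 * Real.cos θ < y.1 * Real.sin θ}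

lemma measurableSet_Sec (θ : ℝ) : MeasurableSet (Sec θ) := by
  have h1 : MeasurableSet {y : ℝ × ℝ | 0 < y.2} := measurableSet_lt (by fun_prop) (by fun_prop)
  have h2 : MeasurableSet {y : ℝ × ℝ | y.2 * Real.cos θ < y.1 * Real.sin θ} :=
    measurableSet_lt (by fun_prop) (by fun_prop)
  exact h1.inter h2

lemma pA_Sec {θ : ℝ} (h0 : 0 < θ) (h1 : θ < π) : pA (Sec θ) = θ / 2 := by
  have hmS : MeasurableSet (Sec θ ∩ {y | N2 y < 1}) :=
    (measurableSet_Sec θ).inter (measurableSet_lt measurable_N2 measurable_const)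
  have key : volume (Sec θ ∩ {y | N2 y < 1}) = ENNReal.ofReal (θ / 2) := by
    rw [← lintegral_indicator_one hmS, ← lintegral_comp_polarCoord_symm]
    have : ∀ q ∈ polarCoord.target, ENNReal.ofReal q.1 • (Sec θ ∩ {y | N2 y < 1}).indicator (1 : ℝ × ℝ → ENNReal) (polarCoord.symm q)
        = (Set.Ioo (0 : ℝ) 1 ×ˢ Set.Ioo 0 θ).indicator (fun q => ENNReal.ofReal q.1) q := by
      rintro ⟨r, φ⟩ hq
      simp only [polarCoord_target, Set.mem_prod, Set.mem_Ioi, Set.mem_Ioo] at hq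
      obtain ⟨hr, hφ1, hφ2⟩ := hq
      have hiff : polarCoord.symm (r, φ) ∈ Sec θ ∩ {y | N2 y < 1} ↔ (r, φ) ∈ Set.Ioo (0 : ℝ) 1 ×ˢ Set.Ioo 0 θ := by
        simp only [polarCoord_symm_apply, Sec, N2, Set.mem_inter_iff, Set.mem_ofPred_eq, Set.mem_prod, Set.mem_Ioo, hr, true_and]
        have e1 : 0 < r * Real.sin φ ↔ 0 < φ := by
          rw [mul_pos_iff_of_pos_left hr]
          constructor
          · intro h; by_contra h'
            have := Real.sin_nonpos_of_nonpos_of_neg_pi_le (not_lt.1 h') hφ1.le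
            linarith
          · intro h; exact Real.sin_pos_of_pos_of_lt_pi h hφ2
        have e3 : (r * Real.cos φ) ^ 2 + (r * Real.sin φ) ^ 2 < 1 ↔ r < 1 := by
          rw [show (r * Real.cos φ) ^ 2 + (r * Real.sin φ) ^ 2 = r ^ 2 by
            rw [mul_pow, mul_pow, ← mul_add, Real.cos_sq_add_sin_sq, mul_one]]
          exact sq_lt_one_iff₀ hr.le
        rw [e1, e3]
        have e2 : 0 < φ → (r * Real.sin φ * Real.cos θ < r * Real.cos φ * Real.sin θ ↔ φ < θ) := by
          intro hφ
          have : r * Real.cos φ * Real.sin θ - r * Real.sin φ * Real.cos θ = r * Real.sin (θ - φ) := by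
            rw [Real.sin_sub]; ring
          rw [← sub_pos, this, mul_pos_iff_of_pos_left hr]
          constructor
          · intro h; by_contra h'
            have := Real.sin_nonpos_of_nonpos_of_neg_pi_le (x := θ - φ) (by linarith) (by linarith)
            linarith
          · intro h; exact Real.sin_pos_of_pos_of_lt_pi (by linarith) (by linarith)
        tauto
      by_cases hm : (r, φ) ∈ Set.Ioo (0 : ℝ) 1 ×ˢ Set.Ioo 0 θ
      · rw [Set.indicator_of_mem (hiff.2 hm), Set.indicator_of_mem hm]; simp
      · rw [Set.indicator_of_notMem (fun h => hm (hiff.1 h)), Set.indicator_of_notMem hm]; simp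
    rw [setLIntegral_congr_fun polarCoord.open_target.measurableSet this]
    rw [setLIntegral_indicator (measurableSet_Ioo.prod measurableSet_Ioo)]
    have hs : (Set.Ioo (0 : ℝ) 1 ×ˢ Set.Ioo 0 θ) ∩ polarCoord.target = Set.Ioo (0 : ℝ) 1 ×ˢ Set.Ioo 0 θ := by
      rw [Set.inter_eq_left]
      rintro ⟨r, φ⟩ ⟨hr, hφ⟩
      exact ⟨hr.1, by constructor <;> linarith [hφ.1, hφ.2, Real.pi_pos]⟩
    rw [hs, Measure.volume_eq_prod, ← Measure.prod_restrict, lintegral_prod _ (by fun_prop)]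
    simp only [lintegral_const, Measure.restrict_apply MeasurableSet.univ, Set.univ_inter, Real.volume_Ioo, sub_zero]
    rw [lintegral_mul_const _ (by fun_prop), ← ofReal_integral_eq_lintegral_ofReal]
    · rw [← integral_Ioc_eq_integral_Ioo, ← intervalIntegral.integral_of_le zero_le_one,
        ← ENNReal.ofReal_mul]
      · congr 1; rw [integral_id]; ring
      · rw [integral_id]; norm_num
    · apply IntegrableOn.mono_set _ Set.Ioo_subset_Icc_self
      apply Continuous.integrableOn_Icc; fun_prop
    · exact (ae_restrict_mem measurableSet_Ioo).mono fun z hz => hz.1.le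
  rw [pA, key, ENNReal.toReal_ofReal (by linarith)]

def e1' : E 2 := mk3 (0, 1, 0)
def e2' : E 2 := mk3 (0, 0, 1)

def LuneE (θ : ℝ) : Set (E 2) := {u | (u 1, u 2) ∈ Sec θ}

lemma measurableSet_LuneE (θ : ℝ) : MeasurableSet (LuneE θ) := by
  have : Measurable (fun u : E 2 => (u 1, u 2)) := by fun_prop
  exact this (measurableSet_Sec θ)

lemma cyl_LuneE (θ : ℝ) : CylInv e0 (LuneE θ) := by
  intro u α s hα
  simp [LuneE, Sec, e0, mk3]
  rw [mul_pos_iff_of_pos_left hα, mul_assoc, mul_assoc, mul_lt_mul_iff_right₀ hα]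

lemma sg_LuneE {θ : ℝ} (h0 : 0 < θ) (h1 : θ < π) : sg.real (LuneE θ) = 2 * θ := by
  rw [measureReal_def, sg_half norm_e0 (cyl_LuneE θ) (measurableSet_LuneE θ),
    sg_slab_e0 (cyl_LuneE θ) (measurableSet_LuneE θ) one_pos le_rfl]
  have : {y | mk3 (0, y) ∈ LuneE θ} = Sec θ := by
    ext y; simp [LuneE, mk3]
  rw [this, pA_Sec h0 h1, ENNReal.toReal_mul, ENNReal.toReal_ofReal (by positivity)]
  simp; ring

/-- open lune with edge `±n` through `a` and `b` -/
def Lune (n a b : E 2) : Set (E 2) :=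
  {u | ∃ α β γ : ℝ, 0 < α ∧ 0 < β ∧ u = α • a + β • b + γ • n}

lemma lune_shift (n a b : E 2) (s t : ℝ) : Lune n (a + s • n) (b + t • n) = Lune n a b := by
  ext u
  constructor
  · rintro ⟨α, β, γ, hα, hβ, rfl⟩
    exact ⟨α, β, γ + α * s + β * t, hα, hβ, by module⟩
  · rintro ⟨α, β, γ, hα, hβ, rfl⟩
    exact ⟨α, β, γ - α * s - β * t, hα, hβ, by module⟩

lemma frame {n a b : E 2} (hn : ‖n‖ = 1) (ha : ‖a‖ = 1) (hb : ‖b‖ = 1) (hna : ⟪n, a⟫ = 0) (hnb : ⟪n, b⟫ = 0)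
    (hab : ⟪a, b⟫ = 0) : ∃ f : E 2 ≃ₗᵢ[ℝ] E 2, ∀ u, f u = mk3 (⟪n, u⟫, ⟪a, u⟫, ⟪b, u⟫) := by
  have hon : Orthonormal ℝ ![n, a, b] := by
    rw [orthonormal_iff_ite]
    intro i j
    fin_cases i <;> fin_cases j <;>
      simp [hn, ha, hb, hna, hnb, hab, real_inner_comm n a, real_inner_comm n b, real_inner_comm a b]
  obtain ⟨B, hB⟩ := Orthonormal.exists_orthonormalBasis_extension_of_card_eq (𝕜 := ℝ) (E := E 2)
    (ι := Fin 3) (by simp) (v := ![n, a, b]) (s := Set.univ)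
    (by
      have := hon.comp (fun x : (Set.univ : Set (Fin 3)) => x.1) Subtype.val_injective
      exact this)
  refine ⟨B.repr, fun u => ?_⟩
  ext i
  rw [OrthonormalBasis.repr_apply_apply, hB i trivial]
  fin_cases i <;> simp [mk3]

lemma ext_frame {n a b : E 2} (hn : ‖n‖ = 1) (ha : ‖a‖ = 1) (hb : ‖b‖ = 1) (hna : ⟪n, a⟫ = 0) (hnb : ⟪n, b⟫ = 0)
    (hab : ⟪a, b⟫ = 0) (u : E 2) : u = ⟪a, u⟫ • a + ⟪b, u⟫ • b + ⟪n, u⟫ • n := by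
  obtain ⟨f, hf⟩ := frame hn ha hb hna hnb hab
  apply f.injective
  rw [hf, hf]
  have e1 : ⟪a, n⟫ = 0 := by rw [real_inner_comm]; exact hna
  have e2 : ⟪b, n⟫ = 0 := by rw [real_inner_comm]; exact hnb
  have e3 : ⟪b, a⟫ = 0 := by rw [real_inner_comm]; exact hab
  simp [inner_add_right, real_inner_smul_right, hna, hnb, hab, e1, e2, e3, hn, ha, hb]

lemma lune_perp {n a b : E 2} (hn : ‖n‖ = 1) (ha : ⟪n, a⟫ = 0) (hb : ⟪n, b⟫ = 0) (ha0 : a ≠ 0) (hb0 : b ≠ 0)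
    (h0 : 0 < InnerProductGeometry.angle a b) (h1 : InnerProductGeometry.angle a b < π) :
    ∃ f : E 2 ≃ₗᵢ[ℝ] E 2, Lune n a b = f ⁻¹' LuneE (InnerProductGeometry.angle a b) := by
  set θ := InnerProductGeometry.angle a b with hθ
  have hs : 0 < Real.sin θ := Real.sin_pos_of_pos_of_lt_pi h0 h1
  have hA : 0 < ‖a‖ := norm_pos_iff.2 ha0
  have hB : 0 < ‖b‖ := norm_pos_iff.2 hb0
  have hc : Real.cos θ * (‖a‖ * ‖b‖) = ⟪a, b⟫ := InnerProductGeometry.cos_angle_mul_norm_mul_norm a b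
  set a' := ‖a‖⁻¹ • a with ha'
  have ea : a = ‖a‖ • a' := by rw [ha', smul_smul, mul_inv_cancel₀ hA.ne', one_smul]
  have na' : ‖a'‖ = 1 := by rw [ha', norm_smul, norm_inv, norm_norm, inv_mul_cancel₀ hA.ne']
  have hab : ⟪a', b⟫ = ‖b‖ * Real.cos θ := by
    rw [ha', real_inner_smul_left, ← hc]; field_simp
  have haa : ⟪a', a'⟫ = 1 := by rw [real_inner_self_eq_norm_sq, na']; norm_num
  set b' := (‖b‖ * Real.sin θ)⁻¹ • (b - (‖b‖ * Real.cos θ) • a') with hb'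
  have hBs : 0 < ‖b‖ * Real.sin θ := by positivity
  have eb : b = (‖b‖ * Real.cos θ) • a' + (‖b‖ * Real.sin θ) • b' := by
    rw [hb', smul_inv_smul₀ hBs.ne']; abel
  have hna' : ⟪n, a'⟫ = 0 := by rw [ha', real_inner_smul_right, ha, mul_zero]
  have hnb' : ⟪n, b'⟫ = 0 := by
    rw [hb', real_inner_smul_right, inner_sub_right, real_inner_smul_right, hna', hb]; simp
  have hab' : ⟪a', b'⟫ = 0 := by
    rw [hb', real_inner_smul_right, inner_sub_right, real_inner_smul_right, haa, hab]; simp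
  have nb' : ‖b'‖ = 1 := by
    have h2 : ‖b‖ ^ 2 = (‖b‖ * Real.cos θ) ^ 2 + (‖b‖ * Real.sin θ) ^ 2 * ‖b'‖ ^ 2 := by
      rw [← real_inner_self_eq_norm_sq]
      conv_lhs => rw [eb]
      rw [inner_add_left, inner_add_right, inner_add_right]
      simp only [real_inner_smul_left, real_inner_smul_right, haa, hab', real_inner_comm a' b']
      rw [real_inner_self_eq_norm_sq]; ring
    have h3 : (‖b‖ * Real.sin θ) ^ 2 * ‖b'‖ ^ 2 = (‖b‖ * Real.sin θ) ^ 2 := by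
      have := Real.sin_sq_add_cos_sq θ
      rw [mul_pow, mul_pow] at *
      have e : Real.sin θ ^ 2 = 1 - Real.cos θ ^ 2 := by linarith
      nlinarith
    have h4 : ‖b'‖ ^ 2 = 1 := by
      have : (‖b‖ * Real.sin θ) ^ 2 ≠ 0 := by positivity
      exact mul_left_cancel₀ this (by rw [h3, mul_one])
    exact (pow_eq_one_iff_of_nonneg (norm_nonneg _) two_ne_zero).1 h4
  obtain ⟨f, hf⟩ := frame hn na' nb' hna' hnb' hab'
  refine ⟨f, ?_⟩
  have han : ⟪a', n⟫ = 0 := by rw [real_inner_comm]; exact hna'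
  have hbn : ⟪b', n⟫ = 0 := by rw [real_inner_comm]; exact hnb'
  have hba : ⟪b', a'⟫ = 0 := by rw [real_inner_comm]; exact hab'
  have hbb : ⟪b', b'⟫ = 1 := by rw [real_inner_self_eq_norm_sq, nb']; norm_num
  ext u
  have hiff : u ∈ f ⁻¹' LuneE θ ↔ 0 < ⟪b', u⟫ ∧ ⟪b', u⟫ * Real.cos θ < ⟪a', u⟫ * Real.sin θ := by
    simp only [Set.mem_preimage, LuneE, Set.mem_ofPred_eq, hf, Sec, mk3]
    simp
  rw [hiff]
  constructor
  · rintro ⟨α, β, γ, hα, hβ, rfl⟩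
    have k3 : ⟪b', a⟫ = 0 := by rw [ea, real_inner_smul_right, hba, mul_zero]
    have k4 : ⟪b', b⟫ = ‖b‖ * Real.sin θ := by
      conv_lhs => rw [eb]
      rw [inner_add_right, real_inner_smul_right (F := E 2) b' b' (‖b‖ * Real.sin θ), real_inner_smul_right (F := E 2) b' a' (‖b‖ * Real.cos θ), hba, hbb]; ring
    have k1 : ⟪b', α • a + β • b + γ • n⟫ = β * (‖b‖ * Real.sin θ) := by
      rw [inner_add_right, inner_add_right, real_inner_smul_right, real_inner_smul_right, real_inner_smul_right,
        k3, k4, hbn]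
      ring
    have k5 : ⟪a', a⟫ = ‖a‖ := by
      conv_lhs => rw [ea]
      rw [real_inner_smul_right, haa, mul_one]
    have k2 : ⟪a', α • a + β • b + γ • n⟫ = α * ‖a‖ + β * (‖b‖ * Real.cos θ) := by
      rw [inner_add_right, inner_add_right, real_inner_smul_right, real_inner_smul_right, real_inner_smul_right,
        hab, han, k5]
      ring
    rw [k1, k2]
    refine ⟨by positivity, ?_⟩
    have : 0 < α * ‖a‖ * Real.sin θ := by positivity
    nlinarith
  · rintro ⟨h2, h3⟩
    refine ⟨(⟪a', u⟫ * Real.sin θ - ⟪b', u⟫ * Real.cos θ) / (‖a‖ * Real.sin θ), ⟪b', u⟫ / (‖b‖ * Real.sin θ), ⟪n, u⟫,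
      by apply div_pos <;> [linarith; positivity], by positivity, ?_⟩
    have := ext_frame hn na' nb' hna' hnb' hab' u
    generalize ⟪a', u⟫ = x at *
    generalize ⟪b', u⟫ = y at *
    generalize ⟪n, u⟫ = z at *
    generalize ‖b‖ = B at *
    rw [eb, this, ha', smul_smul]
    match_scalars <;> field_simp <;> ring

def LI3 (a b c : E 2) : Prop := ∀ α β γ : ℝ, α • a + β • b + γ • c = 0 → α = 0 ∧ β = 0 ∧ γ = 0

lemma LI3.li {a b c : E 2} (h : LI3 a b c) : LinearIndependent ℝ ![a, b, c] := by
  rw [Fintype.linearIndependent_iff]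
  intro g hg
  rw [Fin.sum_univ_three] at hg
  obtain ⟨h1, h2, h3⟩ := h (g 0) (g 1) (g 2) hg
  intro i; fin_cases i <;> assumption

lemma LI3.span {a b c : E 2} (h : LI3 a b c) (u : E 2) : ∃ α β γ : ℝ, u = α • a + β • b + γ • c := by
  let B := basisOfLinearIndependentOfCardEqFinrank h.li (by simp)
  have := B.sum_repr u
  rw [Fin.sum_univ_three] at this
  refine ⟨B.repr u 0, B.repr u 1, B.repr u 2, ?_⟩
  conv_lhs => rw [← this]
  simp [B]

lemma cyl_lune (n a b : E 2) : CylInv n (Lune n a b) := by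
  intro u τ s hτ
  constructor
  · rintro ⟨α, β, γ, hα, hβ, h⟩
    refine ⟨τ⁻¹ * α, τ⁻¹ * β, τ⁻¹ * (γ - s), by positivity, by positivity, ?_⟩
    have : τ • u = α • a + β • b + (γ - s) • n := by rw [← sub_eq_iff_eq_add] at h; rw [← h]; module
    rw [← inv_smul_smul₀ hτ.ne' u, this]; module
  · rintro ⟨α, β, γ, hα, hβ, rfl⟩
    exact ⟨τ * α, τ * β, τ * γ + s, by positivity, by positivity, by module⟩

lemma lune_aux {n a b : E 2} (hn : ‖n‖ = 1) (h : LI3 n a b) :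
    0 < sangle a n b ∧ sangle a n b < π ∧
    ∃ f : E 2 ≃ₗᵢ[ℝ] E 2, Lune n a b = f ⁻¹' LuneE (sangle a n b) := by
  have hnn : ⟪n, n⟫ = 1 := by rw [real_inner_self_eq_norm_sq, hn]; norm_num
  have e : Lune n a b = Lune n (a - ⟪n, a⟫ • n) (b - ⟪n, b⟫ • n) := by
    rw [← lune_shift n a b (-⟪n, a⟫) (-⟪n, b⟫), neg_smul, neg_smul, sub_eq_add_neg, sub_eq_add_neg]
  have ha0 : a - ⟪n, a⟫ • n ≠ 0 := by
    intro h0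
    have := h (-⟪n, a⟫) 1 0 (by rw [← h0]; module)
    norm_num at this
  have hb0 : b - ⟪n, b⟫ • n ≠ 0 := by
    intro h0
    have := h (-⟪n, b⟫) 0 1 (by rw [← h0]; module)
    norm_num at this
  have hnol : ∀ r : ℝ, b - ⟪n, b⟫ • n ≠ r • (a - ⟪n, a⟫ • n) := by
    intro r h0
    have := h (-⟪n, b⟫ + r * ⟪n, a⟫) (-r) 1 (by
      rw [sub_eq_iff_eq_add] at h0
      conv_lhs => rw [h0]
      rw [inner_add_right, real_inner_smul_right, inner_sub_right, real_inner_smul_right, real_inner_smul_right, hnn]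
      module)
    norm_num at this
  have h0 : 0 < sangle a n b := by
    unfold sangle
    refine lt_of_le_of_ne (InnerProductGeometry.angle_nonneg _ _) fun h0 => ?_
    obtain ⟨-, r, -, hr⟩ := InnerProductGeometry.angle_eq_zero_iff.1 h0.symm
    exact hnol r hr
  have h1 : sangle a n b < π := by
    unfold sangle
    refine lt_of_le_of_ne (InnerProductGeometry.angle_le_pi _ _) fun h0 => ?_
    obtain ⟨-, r, -, hr⟩ := InnerProductGeometry.angle_eq_pi_iff.1 h0
    exact hnol r hr
  refine ⟨h0, h1, ?_⟩
  rw [e]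
  exact lune_perp hn (by rw [inner_sub_right, real_inner_smul_right, hnn]; ring)
    (by rw [inner_sub_right, real_inner_smul_right, hnn]; ring) ha0 hb0 h0 h1

lemma measurableSet_lune {n a b : E 2} (hn : ‖n‖ = 1) (h : LI3 n a b) : MeasurableSet (Lune n a b) := by
  obtain ⟨-, -, f, hf⟩ := lune_aux hn h
  rw [hf]; exact f.continuous.measurable (measurableSet_LuneE _)

lemma sg_lune {n a b : E 2} (hn : ‖n‖ = 1) (h : LI3 n a b) : sg.real (Lune n a b) = 2 * sangle a n b := by
  obtain ⟨h0, h1, f, hf⟩ := lune_aux hn h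
  rw [hf, measureReal_def, (mp_isom f).measure_preimage (measurableSet_LuneE _).nullMeasurableSet,
    ← measureReal_def, sg_LuneE h0 h1]

end PalAux

/-! Part P3 -/

namespace PalAux

def Oct (a b c : E 2) : Set (E 2) :=
  {u | ∃ α β γ : ℝ, 0 < α ∧ 0 < β ∧ 0 < γ ∧ u = α • a + β • b + γ • c}

lemma LI3.rot {a b c : E 2} (h : LI3 a b c) : LI3 b c a := by
  intro α β γ h0
  obtain ⟨h1, h2, h3⟩ := h γ α β (by rw [← h0]; abel)
  exact ⟨h2, h3, h1⟩

lemma LI3.swap {a b c : E 2} (h : LI3 a b c) : LI3 b a c := by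
  intro α β γ h0
  obtain ⟨h1, h2, h3⟩ := h β α γ (by rw [← h0]; abel)
  exact ⟨h2, h1, h3⟩

lemma LI3.neg1 {a b c : E 2} (h : LI3 a b c) : LI3 (-a) b c := by
  intro α β γ h0
  obtain ⟨h1, h2, h3⟩ := h (-α) β γ (by rw [← h0]; module)
  exact ⟨by linarith, h2, h3⟩

lemma LI3.uniq {a b c : E 2} (h : LI3 a b c) {α β γ α' β' γ' : ℝ}
    (e : α • a + β • b + γ • c = α' • a + β' • b + γ' • c) : α = α' ∧ β = β' ∧ γ = γ' := by
  obtain ⟨h1, h2, h3⟩ := h (α - α') (β - β') (γ - γ') (by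
    have := sub_eq_zero.2 e
    rw [← this]; module)
  exact ⟨by linarith, by linarith, by linarith⟩

lemma oct_rot (a b c : E 2) : Oct a b c = Oct b c a := by
  ext u
  constructor
  · rintro ⟨α, β, γ, h1, h2, h3, rfl⟩; exact ⟨β, γ, α, h2, h3, h1, by abel⟩
  · rintro ⟨α, β, γ, h1, h2, h3, rfl⟩; exact ⟨γ, α, β, h3, h1, h2, by abel⟩

lemma oct_swap (a b c : E 2) : Oct a b c = Oct b a c := by
  ext u
  constructor
  · rintro ⟨α, β, γ, h1, h2, h3, rfl⟩; exact ⟨β, α, γ, h2, h1, h3, by abel⟩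
  · rintro ⟨α, β, γ, h1, h2, h3, rfl⟩; exact ⟨β, α, γ, h2, h1, h3, by abel⟩

lemma oct_eq {a b c : E 2} (h : LI3 a b c) : Oct a b c = Lune a b c ∩ Lune b a c := by
  ext u
  constructor
  · rintro ⟨α, β, γ, h1, h2, h3, rfl⟩
    exact ⟨⟨β, γ, α, h2, h3, by abel⟩, ⟨α, γ, β, h1, h3, by abel⟩⟩
  · rintro ⟨⟨β, γ, α, h2, h3, rfl⟩, ⟨α', γ', β', h1', h3', e⟩⟩
    have : α • a + β • b + γ • c = α' • a + β' • b + γ' • c := by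
      rw [show α • a + β • b + γ • c = β • b + γ • c + α • a by abel, e]; abel
    obtain ⟨e1, e2, e3⟩ := h.uniq this
    exact ⟨α, β, γ, e1 ▸ h1', h2, h3, by abel⟩

lemma measurableSet_oct {a b c : E 2} (ha : ‖a‖ = 1) (hb : ‖b‖ = 1) (h : LI3 a b c) : MeasurableSet (Oct a b c) := by
  rw [oct_eq h]
  exact (measurableSet_lune ha h).inter (measurableSet_lune hb h.swap)

lemma exists_perp (b c : E 2) : ∃ w : E 2, ‖w‖ = 1 ∧ ⟪b, w⟫ = 0 ∧ ⟪c, w⟫ = 0 := by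
  let S := Submodule.span ℝ ({b, c} : Set (E 2))
  have h1 : Module.finrank ℝ S ≤ 2 := by
    have := finrank_span_finset_le_card (R := ℝ) ({b, c} : Finset (E 2))
    rw [Finset.coe_pair] at this
    exact this.trans Finset.card_le_two
  have h2 := S.finrank_add_finrank_orthogonal
  have h3 : Module.finrank ℝ (E 2) = 3 := by simp
  have h4 : 0 < Module.finrank ℝ Sᗮ := by omega
  have := Module.finrank_pos_iff.1 h4
  obtain ⟨⟨w, hw⟩, hw0⟩ := exists_ne (0 : Sᗮ)
  have hw0 : w ≠ 0 := fun h => hw0 (by ext1; exact h)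
  have hn : ‖w‖ ≠ 0 := norm_ne_zero_iff.2 hw0
  rw [Submodule.mem_orthogonal] at hw
  have k1 := hw b (Submodule.subset_span (by simp))
  have k2 := hw c (Submodule.subset_span (by simp))
  refine ⟨‖w‖⁻¹ • w, by rw [norm_smul, norm_inv, norm_norm, inv_mul_cancel₀ hn], ?_, ?_⟩ <;>
    rw [real_inner_smul_right] <;> simp [k1, k2]

lemma ae_not_span (b c : E 2) : ∀ᵐ u ∂sg, ∀ β γ : ℝ, u ≠ β • b + γ • c := by
  obtain ⟨w, hw, h1, h2⟩ := exists_perp b c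
  filter_upwards [plane_ae (a := w) (by rintro rfl; simp at hw)] with u hu β γ he
  apply hu
  rw [he, inner_add_left, real_inner_smul_left, real_inner_smul_left, h1, h2]; simp

lemma sg_lune_eq {a b c : E 2} (ha : ‖a‖ = 1) (hb : ‖b‖ = 1) (h : LI3 a b c) :
    sg.real (Oct a b c) + sg.real (Oct (-a) b c) = 2 * sangle b a c := by
  rw [← sg_lune ha h, ← measureReal_union _ (measurableSet_oct (by rwa [norm_neg]) hb h.neg1)]
  · apply measureReal_congr
    rw [Filter.eventuallyEq_set]
    filter_upwards [ae_not_span b c] with u hu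
    constructor
    · rintro (⟨α, β, γ, h1, h2, h3, rfl⟩ | ⟨α, β, γ, h1, h2, h3, rfl⟩)
      · exact ⟨β, γ, α, h2, h3, by abel⟩
      · exact ⟨β, γ, -α, h2, h3, by module⟩
    · rintro ⟨β, γ, α, h2, h3, rfl⟩
      rcases lt_trichotomy α 0 with h0 | h0 | h0
      · right; exact ⟨-α, β, γ, by linarith, h2, h3, by module⟩
      · exact absurd (by rw [h0]; simp) (hu β γ)
      · left; exact ⟨α, β, γ, h0, h2, h3, by abel⟩
  · rw [Set.disjoint_left]
    rintro u ⟨α, β, γ, h1, h2, h3, rfl⟩ ⟨α', β', γ', h1', h2', h3', e⟩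
    have := (h.uniq (α' := -α') (β' := β') (γ' := γ') (by rw [e]; module)).1
    linarith

lemma sg_neg {X : Set (E 2)} (hX : MeasurableSet X) : sg.real ((fun u => -u) ⁻¹' X) = sg.real X := by
  have := (mp_isom (LinearIsometryEquiv.neg ℝ)).measure_preimage hX.nullMeasurableSet
  rw [measureReal_def, measureReal_def, ← this]; rfl

lemma oct_neg {a b c : E 2} (ha : ‖a‖ = 1) (hb : ‖b‖ = 1) (h : LI3 a b c) :
    sg.real (Oct (-a) (-b) (-c)) = sg.real (Oct a b c) := by
  rw [← sg_neg (measurableSet_oct ha hb h)]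
  congr 1
  ext u
  constructor
  · rintro ⟨α, β, γ, h1, h2, h3, rfl⟩; exact ⟨α, β, γ, h1, h2, h3, by module⟩
  · rintro ⟨α, β, γ, h1, h2, h3, e⟩; exact ⟨α, β, γ, h1, h2, h3, by rw [← neg_neg u]; simp only at e; rw [e]; module⟩

lemma sangle_neg (a b c : E 2) : sangle (-b) a c = π - sangle b a c := by
  unfold sangle
  rw [← InnerProductGeometry.angle_neg_left]
  congr 1
  rw [inner_neg_right]; module

lemma sangle_comm (a b c : E 2) : sangle b a c = sangle c a b := InnerProductGeometry.angle_comm _ _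

/-- Girard's formula -/
lemma girard {a b c : E 2} (ha : ‖a‖ = 1) (hb : ‖b‖ = 1) (hc : ‖c‖ = 1) (h : LI3 a b c) :
    sg.real (Oct a b c) = sangle b a c + sangle c b a + sangle a c b - π := by
  have nb : ‖-b‖ = 1 := by rwa [norm_neg]
  have hbn : LI3 a (-b) c := h.swap.neg1.swap
  have h1 := sg_lune_eq ha hb h
  have h2 := sg_lune_eq hb hc h.rot
  have h3 := sg_lune_eq hc ha h.rot.rot
  have h4 := sg_lune_eq ha nb hbn
  rw [sangle_neg] at h4
  have e1 : Oct b c a = Oct a b c := (oct_rot a b c).symm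
  have e2 : Oct c a b = Oct a b c := oct_rot c a b
  have e3 : Oct (-b) c a = Oct a (-b) c := (oct_rot a (-b) c).symm
  have e4 : sg.real (Oct (-a) (-b) c) = sg.real (Oct (-c) a b) := by
    have := oct_neg (a := a) (b := b) (c := -c) ha hb (h.rot.rot.neg1.rot)
    rw [neg_neg] at this
    rw [this, oct_rot (-c) a b]
  rw [e1, e3] at h2
  rw [e2] at h3
  rw [e4] at h4
  linarith

end PalAux

/-! Part P3b -/

namespace PalAux

lemma inner_self_one {n : E 2} (hn : ‖n‖ = 1) : ⟪n, n⟫ = 1 := by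
  rw [real_inner_self_eq_norm_sq, hn]; norm_num

lemma norm_one_of_inner {n : E 2} (h : ⟪n, n⟫ = 1) : ‖n‖ = 1 := by
  rw [real_inner_self_eq_norm_sq] at h
  exact (pow_eq_one_iff_of_nonneg (norm_nonneg _) two_ne_zero).1 h

lemma le_of_sq_le {a b : ℝ} (h : a ^ 2 ≤ b ^ 2) (hb : 0 ≤ b) : a ≤ b := (abs_le_of_sq_le_sq' h hb).2

lemma sangle_eq {a n b : E 2} (ha : ‖a‖ = 1) (hn : ‖n‖ = 1) (hb : ‖b‖ = 1) :
    sangle a n b = Real.arccos ((⟪a, b⟫ - ⟪n, a⟫ * ⟪n, b⟫) / (√(1 - ⟪n, a⟫ ^ 2) * √(1 - ⟪n, b⟫ ^ 2))) := by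
  have key : ∀ a : E 2, ‖a‖ = 1 → ‖a - ⟪n, a⟫ • n‖ = √(1 - ⟪n, a⟫ ^ 2) := by
    intro a ha
    rw [← Real.sqrt_sq (norm_nonneg (a - ⟪n, a⟫ • n)), ← real_inner_self_eq_norm_sq]
    congr 1
    rw [inner_sub_left, inner_sub_right, inner_sub_right, real_inner_smul_left, real_inner_smul_left,
      real_inner_smul_right, real_inner_smul_right, inner_self_one hn, inner_self_one ha, real_inner_comm n a]
    ring
  unfold sangle InnerProductGeometry.angle
  rw [key a ha, key b hb]
  congr 2
  rw [inner_sub_left, inner_sub_right, inner_sub_right, real_inner_smul_left, real_inner_smul_left,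
    real_inner_smul_right, real_inner_smul_right, inner_self_one hn, real_inner_comm n a]
  ring

lemma level_null {n : E 2} (hn : ‖n‖ = 1) {t : ℝ} (ht : 0 < t) : ∀ᵐ u ∂sg, ⟪u, n⟫ ≠ t := by
  rw [ae_iff]
  simp only [ne_eq, not_not]
  by_cases ht1 : 1 < t
  · apply measure_mono_null _ sg_sphere
    intro u hu hus
    simp only [Set.mem_ofPred_eq] at hu
    have := real_inner_le_norm u n
    have hu1 : ‖u‖ = 1 := by simpa [unitSphere] using hus
    rw [hu1, hn] at this
    linarith
  · push Not at ht1
    rw [← measureReal_eq_zero_iff]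
    apply le_antisymm _ measureReal_nonneg
    apply le_of_forall_pos_le_add
    intro ε hε
    set t' := max (t / 2) (t - ε / (2 * π)) with ht'
    have hpi := Real.pi_pos
    have h1 : 0 < t' := lt_of_lt_of_le (by positivity) (le_max_left _ _)
    have h2 : t' < t := max_lt (by linarith) (by have : 0 < ε / (2 * π) := by positivity
                                                 linarith)
    have h3 : t - t' ≤ ε / (2 * π) := by linarith [le_max_right (t / 2) (t - ε / (2 * π))]
    have c1 := cap_area hn h1 (h2.le.trans ht1)
    have c2 := cap_area hn ht ht1
    have : sg.real {u | ⟪u, n⟫ = t} + sg.real {u | t < ⟪u, n⟫} ≤ sg.real {u | t' < ⟪u, n⟫} := by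
      rw [← measureReal_union]
      · refine measureReal_mono ?_ (measure_ne_top _ _)
        rintro u (hu | hu)
        · simp only [Set.mem_ofPred_eq] at *; linarith
        · simp only [Set.mem_ofPred_eq] at *; linarith
      · rw [Set.disjoint_left]; intro u hu hu'
        simp only [Set.mem_ofPred_eq] at *; linarith
      · exact measurableSet_lt (by fun_prop) (by fun_prop)
    rw [le_div_iff₀ (by positivity)] at h3
    nlinarith

lemma lune_gt {n a b : E 2} (hn : ‖n‖ = 1) (h : LI3 n a b) {t : ℝ} (ht : 0 < t) (ht1 : t ≤ 1) :
    sg.real (Lune n a b ∩ {u | t < ⟪u, n⟫}) = (1 - t) * sangle a n b := by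
  rw [height_ge hn (cyl_lune n a b) (measurableSet_lune hn h) ht ht1, sg_lune hn h]; ring

lemma lune_pos {n a b : E 2} (hn : ‖n‖ = 1) (h : LI3 n a b) :
    sg.real (Lune n a b ∩ {u | 0 < ⟪u, n⟫}) = sangle a n b := by
  have := height hn (cyl_lune n a b) (measurableSet_lune hn h) one_pos le_rfl
  rw [sg_lune hn h] at this
  rw [show sangle a n b = 1 / 2 * (2 * sangle a n b) by ring, ← this]
  apply measureReal_congr
  rw [Filter.eventuallyEq_set]
  filter_upwards [nrm_sphere_ae] with u hu
  have h1 : ⟪u, n⟫ ≤ 1 := by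
    have := real_inner_le_norm u n
    rwa [hu, hn, one_mul] at this
  simp only [Set.mem_inter_iff, Set.mem_ofPred_eq]
  tauto

def PolS (M : Set (E 2)) : Set (E 2) := {u | ‖u‖ = 1 ∧ ∀ m ∈ M, 0 ≤ ⟪m, u⟫}

lemma isClosed_PolS (M : Set (E 2)) : IsClosed (PolS M) := by
  have : PolS M = {u | ‖u‖ = 1} ∩ ⋂ m ∈ M, {u | 0 ≤ ⟪m, u⟫} := by
    ext u; simp [PolS]
  rw [this]
  refine (isClosed_eq (by fun_prop) (by fun_prop)).inter (isClosed_biInter fun m _ => isClosed_le (by fun_prop) (by fun_prop))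

def Reu (x1 x2 x3 : E 2) (c : ℝ) : Set (E 2) := {y | ‖y‖ = 1 ∧ c ≤ ⟪x1, y⟫ ∧ c ≤ ⟪x2, y⟫ ∧ c ≤ ⟪x3, y⟫}

structure Reg (x1 x2 x3 : E 2) (c : ℝ) : Prop where
  h1 : ‖x1‖ = 1
  h2 : ‖x2‖ = 1
  h3 : ‖x3‖ = 1
  h12 : ⟪x1, x2⟫ = c
  h13 : ⟪x1, x3⟫ = c
  h23 : ⟪x2, x3⟫ = c

lemma Reg.rot {x1 x2 x3 : E 2} {c : ℝ} (h : Reg x1 x2 x3 c) : Reg x2 x3 x1 c :=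
  ⟨h.h2, h.h3, h.h1, h.h23, by rw [real_inner_comm]; exact h.h12, by rw [real_inner_comm]; exact h.h13⟩

lemma reu_rot (x1 x2 x3 : E 2) (c : ℝ) : Reu x1 x2 x3 c = Reu x2 x3 x1 c := by
  ext y; simp only [Reu, Set.mem_ofPred_eq]; tauto

lemma Reg.LI {x1 x2 x3 : E 2} {c : ℝ} (h : Reg x1 x2 x3 c) (hc : 0 < c) (hc1 : c < 1) : LI3 x1 x2 x3 := by
  intro α β γ h0
  have e : ∀ v : E 2, α * ⟪x1, v⟫ + β * ⟪x2, v⟫ + γ * ⟪x3, v⟫ = 0 := by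
    intro v
    have := congrArg (fun z => ⟪z, v⟫) h0
    simpa only [inner_add_left, real_inner_smul_left, inner_zero_left] using this
  have e1 := e x1
  have e2 := e x2
  have e3 := e x3
  rw [inner_self_one h.h1, real_inner_comm, h.h12, real_inner_comm, h.h13] at e1
  rw [inner_self_one h.h2, h.h12, real_inner_comm, h.h23] at e2
  rw [inner_self_one h.h3, h.h13, h.h23] at e3
  have f1 : (1 - c) * (α - β) = 0 := by linarith
  have f2 : (1 - c) * (β - γ) = 0 := by linarith
  have g1 := (mul_eq_zero.1 f1).resolve_left (by linarith)
  have g2 := (mul_eq_zero.1 f2).resolve_left (by linarith)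
  have f3 : (1 + 2 * c) * α = 0 := by
    have : β = α := by linarith
    have : γ = α := by linarith
    subst_vars; linarith
  have g3 := (mul_eq_zero.1 f3).resolve_left (by linarith)
  refine ⟨g3, by linarith, by linarith⟩

lemma Reg.ang {x1 x2 x3 : E 2} {c : ℝ} (h : Reg x1 x2 x3 c) (hc : 0 < c) (hc1 : c < 1) :
    sangle x2 x1 x3 = Real.arccos (c / (1 + c)) := by
  rw [sangle_eq h.h2 h.h1 h.h3, h.h12, h.h13, h.h23, Real.mul_self_sqrt (by nlinarith)]
  congr 1
  have : 1 - c ^ 2 ≠ 0 := by nlinarith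
  have : 1 + c ≠ 0 := by linarith
  field_simp
  ring

set_option maxHeartbeats 1000000 in
/-- in the two-negative-coefficients case the point is far from the boundary -/
lemma two_neg {x1 x2 x3 u : E 2} (h1 : ‖x1‖ = 1) (h2 : ‖x2‖ = 1) (h3 : ‖x3‖ = 1) {c s : ℝ}
    (h12 : ⟪x1, x2⟫ = c) (h13 : ⟪x1, x3⟫ = c) (h23 : ⟪x2, x3⟫ = c) (hc : 0 < c) (hc1 : c < 1) (hs : 0 < s)
    (hcs : c ^ 2 + s ^ 2 = 1) (hu : ‖u‖ = 1)
    (hU : ∀ y : E 2, ‖y‖ = 1 → c ≤ ⟪x1, y⟫ → c ≤ ⟪x2, y⟫ → c ≤ ⟪x3, y⟫ → 0 ≤ ⟪y, u⟫)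
    {a1 A C : ℝ} (hA : 0 < A) (hC : 0 < C) (he : u = a1 • x1 - A • x2 - C • x3) : s ≤ ⟪u, x1⟫ := by
  have i1 := inner_self_one h1
  have i2 := inner_self_one h2
  have i3 := inner_self_one h3
  have h21 : ⟪x2, x1⟫ = c := by rw [real_inner_comm]; exact h12
  have h31 : ⟪x3, x1⟫ = c := by rw [real_inner_comm]; exact h13
  have h32 : ⟪x3, x2⟫ = c := by rw [real_inner_comm]; exact h23
  set κ := c - c ^ 2 with hκ
  have hκ0 : 0 < κ := by rw [hκ]; nlinarith
  have hκs : κ ≤ s ^ 2 := by rw [hκ]; nlinarith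
  set q := A ^ 2 * s ^ 2 + C ^ 2 * s ^ 2 + 2 * A * C * κ with hq
  have hq0 : 0 < q := by positivity
  set σ := √q with hσ
  have hσ0 : 0 < σ := Real.sqrt_pos.2 hq0
  have hσ2 : σ ^ 2 = q := Real.sq_sqrt hq0.le
  set g : E 2 := A • (x2 - c • x1) + C • (x3 - c • x1) with hg
  have g1 : ⟪x1, g⟫ = 0 := by
    simp only [hg, inner_add_right, inner_sub_right, real_inner_smul_right, i1, h12, h13]; ring
  have g2 : ⟪x2, g⟫ = A * s ^ 2 + C * κ := by
    simp only [hg, inner_add_right, inner_sub_right, real_inner_smul_right, i2, h21, h23]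
    rw [show s ^ 2 = 1 - c ^ 2 by linarith, hκ]; ring
  have g3 : ⟪x3, g⟫ = A * κ + C * s ^ 2 := by
    simp only [hg, inner_add_right, inner_sub_right, real_inner_smul_right, i3, h31, h32]
    rw [show s ^ 2 = 1 - c ^ 2 by linarith, hκ]; ring
  have gg : ⟪g, g⟫ = σ ^ 2 := by
    have gv : ∀ v : E 2, ⟪g, v⟫ = A * (⟪x2, v⟫ - c * ⟪x1, v⟫) + C * (⟪x3, v⟫ - c * ⟪x1, v⟫) := by
      intro v; rw [hg]
      simp only [inner_add_left, inner_sub_left, real_inner_smul_left]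
    rw [hσ2, gv g, g1, g2, g3, hq]; ring
  clear_value σ q κ g
  set y : E 2 := c • x1 + (s / σ) • g with hy
  have hyn : ‖y‖ = 1 := by
    apply norm_one_of_inner
    rw [hy]
    simp only [inner_add_left, inner_add_right, real_inner_smul_left, real_inner_smul_right, g1,
      real_inner_comm x1 g, gg, i1]
    have e : s / σ * (s / σ * σ ^ 2) = s ^ 2 := by field_simp
    rw [mul_zero, mul_zero, e]; linear_combination hcs
  have b2 : σ * κ ≤ s * (A * s ^ 2 + C * κ) := by
    refine le_of_sq_le ?_ (by positivity)
    have e : s ^ 2 = 1 - c ^ 2 := by linarith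
    have : 0 ≤ (s ^ 2 - κ) * (s ^ 2 + κ) * (A ^ 2 * s ^ 2 + 2 * A * C * κ) := by
      have := sub_nonneg.2 hκs
      positivity
    have e2 : (s * (A * s ^ 2 + C * κ)) ^ 2 - (σ * κ) ^ 2 = (s ^ 2 - κ) * (s ^ 2 + κ) * (A ^ 2 * s ^ 2 + 2 * A * C * κ) := by
      rw [mul_pow σ, hσ2, hq]; ring
    linarith
  have b3 : σ * κ ≤ s * (A * κ + C * s ^ 2) := by
    refine le_of_sq_le ?_ (by positivity)
    have : 0 ≤ (s ^ 2 - κ) * (s ^ 2 + κ) * (C ^ 2 * s ^ 2 + 2 * A * C * κ) := by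
      have := sub_nonneg.2 hκs
      positivity
    have e2 : (s * (A * κ + C * s ^ 2)) ^ 2 - (σ * κ) ^ 2 = (s ^ 2 - κ) * (s ^ 2 + κ) * (C ^ 2 * s ^ 2 + 2 * A * C * κ) := by
      rw [mul_pow σ, hσ2, hq]; ring
    linarith
  have hyu := hU y hyn
    (by rw [hy, inner_add_right, real_inner_smul_right, real_inner_smul_right, i1, g1]; simp)
    (by rw [hy, inner_add_right, real_inner_smul_right, real_inner_smul_right, h21, g2]
        have : κ ≤ s / σ * (A * s ^ 2 + C * κ) := by
          rw [div_mul_eq_mul_div, le_div_iff₀ hσ0]; linarith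
        linarith [hκ])
    (by rw [hy, inner_add_right, real_inner_smul_right, real_inner_smul_right, h31, g3]
        have : κ ≤ s / σ * (A * κ + C * s ^ 2) := by
          rw [div_mul_eq_mul_div, le_div_iff₀ hσ0]; linarith
        linarith [hκ])
  have hux : 0 ≤ ⟪x1, u⟫ := hU x1 h1 (by rw [i1]; exact hc1.le) h21.ge h31.ge
  set z := ⟪x1, u⟫ with hz
  have hz' : z = a1 - A * c - C * c := by
    rw [hz, he]; simp only [inner_sub_right, real_inner_smul_right, i1, h12, h13]; ring
  have hu' : u = z • x1 - g := by rw [hz', he, hg]; module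
  have hyu' : ⟪y, u⟫ = c * z - s * σ := by
    rw [hy, hu']
    simp only [inner_add_left, inner_sub_right, real_inner_smul_left, real_inner_smul_right, g1,
      real_inner_comm x1 g, gg, i1]
    field_simp; ring
  have huu : z ^ 2 + σ ^ 2 = 1 := by
    have := inner_self_one hu
    rw [hu'] at this
    simp only [inner_sub_left, inner_sub_right, real_inner_smul_left, real_inner_smul_right, g1,
      real_inner_comm x1 g, gg, i1] at this
    linarith
  rw [real_inner_comm, ← hz]
  rw [hyu'] at hyu
  refine le_of_sq_le ?_ hux
  have : (s * σ) ^ 2 ≤ (c * z) ^ 2 := by apply pow_le_pow_left₀ (by positivity); linarith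
  rw [mul_pow, mul_pow] at this
  nlinarith

/-- piece of the polar of a Reuleaux triangle -/
def Wp (x1 x2 x3 : E 2) : Set (E 2) := Lune x1 x2 x3 ∩ {u | 0 < ⟪u, x1⟫}

def Vp (x1 x2 x3 : E 2) (s : ℝ) : Set (E 2) := Lune x1 (-x2) (-x3) ∩ {u | s < ⟪u, x1⟫}

lemma Reg.Wp_area {x1 x2 x3 : E 2} {c : ℝ} (h : Reg x1 x2 x3 c) (hc : 0 < c) (hc1 : c < 1) :
    sg.real (Wp x1 x2 x3 \ Oct x1 x2 x3) = Real.arccos (c / (1 + c)) - sg.real (Oct x1 x2 x3) := by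
  rw [measureReal_sdiff _ (measurableSet_oct h.h1 h.h2 (h.LI hc hc1)), Wp, lune_pos h.h1 (h.LI hc hc1), h.ang hc hc1]
  rintro u ⟨α, β, γ, hα, hβ, hγ, rfl⟩
  refine ⟨⟨β, γ, α, hβ, hγ, by abel⟩, ?_⟩
  simp only [Set.mem_ofPred_eq, inner_add_left, real_inner_smul_left]
  rw [inner_self_one h.h1, real_inner_comm, h.h12, real_inner_comm, h.h13]
  positivity

lemma Reg.Vp_area {x1 x2 x3 : E 2} {c : ℝ} (h : Reg x1 x2 x3 c) (hc : 0 < c) (hc1 : c < 1) {s : ℝ} (hs : 0 < s) (hs1 : s ≤ 1) :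
    sg.real (Vp x1 x2 x3 s) = (1 - s) * Real.arccos (c / (1 + c)) := by
  rw [Vp, lune_gt h.h1 _ hs hs1, sangle_neg, sangle_comm, sangle_neg, sangle_comm, h.ang hc hc1]
  · ring
  · exact (((h.LI hc hc1).rot.neg1).rot.neg1).rot

lemma Reg.Oct_area {x1 x2 x3 : E 2} {c : ℝ} (h : Reg x1 x2 x3 c) (hc : 0 < c) (hc1 : c < 1) :
    sg.real (Oct x1 x2 x3) = 3 * Real.arccos (c / (1 + c)) - π := by
  rw [girard h.h1 h.h2 h.h3 (h.LI hc hc1), h.ang hc hc1, h.rot.ang hc hc1, h.rot.rot.ang hc hc1]; ring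

lemma Reg.two_neg {x1 x2 x3 : E 2} {c : ℝ} (h : Reg x1 x2 x3 c) (hc : 0 < c) (hc1 : c < 1) {s : ℝ} (hs : 0 < s)
    (hcs : c ^ 2 + s ^ 2 = 1) {u : E 2} (hu : u ∈ PolS (Reu x1 x2 x3 c)) {a1 A C : ℝ} (hA : A < 0) (hC : C < 0)
    (he : u = a1 • x1 + A • x2 + C • x3) (hl : ⟪u, x1⟫ ≠ s) : u ∈ Vp x1 x2 x3 s := by
  have := PalAux.two_neg h.h1 h.h2 h.h3 h.h12 h.h13 h.h23 hc hc1 hs hcs hu.1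
    (fun y a b c d => hu.2 y ⟨a, b, c, d⟩) (a1 := a1) (neg_pos.2 hA) (neg_pos.2 hC) (by rw [he]; module)
  refine ⟨⟨-A, -C, a1, by linarith, by linarith, by rw [he]; module⟩, lt_of_le_of_ne this hl.symm⟩

lemma Reg.mem {x1 x2 x3 : E 2} {c : ℝ} (h : Reg x1 x2 x3 c) (hc1 : c < 1) : x1 ∈ Reu x1 x2 x3 c :=
  ⟨h.h1, by rw [inner_self_one h.h1]; exact hc1.le, by rw [real_inner_comm, h.h12], by rw [real_inner_comm, h.h13]⟩

theorem Reg.pol_area {x1 x2 x3 : E 2} {c : ℝ} (h : Reg x1 x2 x3 c) (hc : 0 < c) (hc1 : c < 1) {s : ℝ} (hs : 0 < s)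
    (hcs : c ^ 2 + s ^ 2 = 1) :
    sg.real (PolS (Reu x1 x2 x3 c)) ≤ 2 * π - 3 * Real.arccos (c / (1 + c)) * s := by
  have hs1 : s ≤ 1 := by nlinarith
  have hli := h.LI hc hc1
  have h' := h.rot
  have h'' := h.rot.rot
  have key : sg.real (PolS (Reu x1 x2 x3 c)) ≤ sg.real (Oct x1 x2 x3 ∪ (Wp x1 x2 x3 \ Oct x1 x2 x3 ∪ (Wp x2 x3 x1 \ Oct x2 x3 x1 ∪
      (Wp x3 x1 x2 \ Oct x3 x1 x2 ∪ (Vp x1 x2 x3 s ∪ (Vp x2 x3 x1 s ∪ Vp x3 x1 x2 s)))))) := by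
    refine ENNReal.toReal_mono (measure_ne_top _ _) (measure_mono_ae ?_)
    filter_upwards [ae_not_span x1 x2, ae_not_span x2 x3, ae_not_span x3 x1, level_null h.h1 hs, level_null h.h2 hs,
      level_null h.h3 hs, plane_ae (a := x1) (by rintro rfl; simpa using h.h1),
      plane_ae (a := x2) (by rintro rfl; simpa using h.h2),
      plane_ae (a := x3) (by rintro rfl; simpa using h.h3)] with u n12 n23 n31 l1 l2 l3 p1 p2 p3 hu
    obtain ⟨α, β, γ, he⟩ := hli.span u
    have e2 : u = β • x2 + γ • x3 + α • x1 := by rw [he]; abel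
    have e3 : u = γ • x3 + α • x1 + β • x2 := by rw [he]; abel
    have hu2 : u ∈ PolS (Reu x2 x3 x1 c) := by rw [← reu_rot]; exact hu
    have hu3 : u ∈ PolS (Reu x3 x1 x2 c) := by rw [← reu_rot, ← reu_rot]; exact hu
    have q1 : 0 < ⟪u, x1⟫ := lt_of_le_of_ne (by rw [real_inner_comm]; exact hu.2 _ (h.mem hc1)) p1.symm
    have q2 : 0 < ⟪u, x2⟫ := lt_of_le_of_ne (by rw [real_inner_comm]; exact hu2.2 _ (h'.mem hc1)) p2.symm
    have q3 : 0 < ⟪u, x3⟫ := lt_of_le_of_ne (by rw [real_inner_comm]; exact hu3.2 _ (h''.mem hc1)) p3.symm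
    have z1 : α ≠ 0 := by rintro rfl; exact n23 β γ (by rw [he]; module)
    have z2 : β ≠ 0 := by rintro rfl; exact n31 γ α (by rw [he]; module)
    have z3 : γ ≠ 0 := by rintro rfl; exact n12 α β (by rw [he]; module)
    change u ∈ _ ∨ u ∈ _ ∨ u ∈ _ ∨ u ∈ _ ∨ u ∈ _ ∨ u ∈ _ ∨ u ∈ _
    have o2 : Oct x2 x3 x1 = Oct x1 x2 x3 := (oct_rot _ _ _).symm
    have o3 : Oct x3 x1 x2 = Oct x1 x2 x3 := oct_rot _ _ _
    rw [o2, o3]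
    by_cases hO : u ∈ Oct x1 x2 x3
    · exact Or.inl hO
    rcases lt_or_gt_of_ne z1 with s1 | s1 <;> rcases lt_or_gt_of_ne z2 with s2 | s2 <;> rcases lt_or_gt_of_ne z3 with s3 | s3
    · exfalso
      rw [he] at q1
      simp only [inner_add_left, real_inner_smul_left] at q1
      rw [inner_self_one h.h1, real_inner_comm, h.h12, real_inner_comm, h.h13] at q1
      nlinarith
    · have := h''.two_neg hc hc1 hs hcs hu3 s1 s2 e3 l3; tauto
    · have := h'.two_neg hc hc1 hs hcs hu2 s3 s1 e2 l2; tauto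
    · have : u ∈ Wp x1 x2 x3 := ⟨⟨β, γ, α, s2, s3, by rw [he]; abel⟩, q1⟩
      exact Or.inr (Or.inl ⟨this, hO⟩)
    · have := h.two_neg hc hc1 hs hcs hu s2 s3 he l1; tauto
    · have : u ∈ Wp x2 x3 x1 := ⟨⟨γ, α, β, s3, s1, by rw [he]; abel⟩, q2⟩
      exact Or.inr (Or.inr (Or.inl ⟨this, hO⟩))
    · have : u ∈ Wp x3 x1 x2 := ⟨⟨α, β, γ, s1, s2, by rw [he]⟩, q3⟩
      exact Or.inr (Or.inr (Or.inr (Or.inl ⟨this, hO⟩)))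
    · exact absurd ⟨α, β, γ, s1, s2, s3, he⟩ hO
  have u1 := measureReal_union_le (μ := sg) (Oct x1 x2 x3) (Wp x1 x2 x3 \ Oct x1 x2 x3 ∪ (Wp x2 x3 x1 \ Oct x2 x3 x1 ∪
      (Wp x3 x1 x2 \ Oct x3 x1 x2 ∪ (Vp x1 x2 x3 s ∪ (Vp x2 x3 x1 s ∪ Vp x3 x1 x2 s)))))
  have u2 := measureReal_union_le (μ := sg) (Wp x1 x2 x3 \ Oct x1 x2 x3) (Wp x2 x3 x1 \ Oct x2 x3 x1 ∪
      (Wp x3 x1 x2 \ Oct x3 x1 x2 ∪ (Vp x1 x2 x3 s ∪ (Vp x2 x3 x1 s ∪ Vp x3 x1 x2 s))))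
  have u3 := measureReal_union_le (μ := sg) (Wp x2 x3 x1 \ Oct x2 x3 x1)
      (Wp x3 x1 x2 \ Oct x3 x1 x2 ∪ (Vp x1 x2 x3 s ∪ (Vp x2 x3 x1 s ∪ Vp x3 x1 x2 s)))
  have u4 := measureReal_union_le (μ := sg) (Wp x3 x1 x2 \ Oct x3 x1 x2) (Vp x1 x2 x3 s ∪ (Vp x2 x3 x1 s ∪ Vp x3 x1 x2 s))
  have u5 := measureReal_union_le (μ := sg) (Vp x1 x2 x3 s) (Vp x2 x3 x1 s ∪ Vp x3 x1 x2 s)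
  have u6 := measureReal_union_le (μ := sg) (Vp x2 x3 x1 s) (Vp x3 x1 x2 s)
  rw [h.Wp_area hc hc1, h.Oct_area hc hc1] at u2
  rw [h'.Wp_area hc hc1, h'.Oct_area hc hc1] at u3
  rw [h''.Wp_area hc hc1, h''.Oct_area hc hc1] at u4
  rw [h.Vp_area hc hc1 hs hs1] at u5
  rw [h'.Vp_area hc hc1 hs hs1, h''.Vp_area hc hc1 hs hs1] at u6
  rw [h.Oct_area hc hc1] at u1
  linarith
end PalAux

/-! Part P2 -/

namespace PalAux

/-- rotation invariant finite measure concentrated on the sphere -/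
structure RotInv (μ : Measure (E 2)) : Prop where
  fin : IsFiniteMeasure μ
  sph : ∀ᵐ u ∂μ, ‖u‖ = 1
  inv : ∀ f : E 2 ≃ₗᵢ[ℝ] E 2, MeasurePreserving f μ μ

lemma RotInv.ball {μ : Measure (E 2)} (h : RotInv μ) {x : E 2} (hx : ‖x‖ = 1) (r : ℝ) :
    μ (Metric.ball x r) = μ (Metric.ball e0 r) := by
  obtain ⟨f, rfl⟩ := exists_isom hx
  rw [← (h.inv f).measure_preimage Metric.isOpen_ball.measurableSet.nullMeasurableSet]
  congr 1
  ext y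
  simp [dist_eq_norm, ← map_sub]

lemma RotInv.fubini {μ ν : Measure (E 2)} (h : RotInv μ) (h' : RotInv ν) {U : Set (E 2)} (hU : MeasurableSet U) (r : ℝ) :
    ∫⁻ x, ν (U ∩ Metric.ball x r) ∂μ = μ (Metric.ball e0 r) * ν U ∧
    Measurable (fun x => ν (U ∩ Metric.ball x r)) := by
  have := h.fin
  have := h'.fin
  let S : Set (E 2 × E 2) := {p | p.2 ∈ U ∧ dist p.1 p.2 < r}
  have hS : MeasurableSet S := (hU.preimage measurable_snd).inter
    (measurableSet_lt (measurable_fst.dist measurable_snd) measurable_const)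
  have e1 : ∀ x, Prod.mk x ⁻¹' S = U ∩ Metric.ball x r := by
    intro x; ext y; simp [S, dist_comm]
  have e2 : ∀ y, (fun x => (x, y)) ⁻¹' S = {x | y ∈ U ∧ x ∈ Metric.ball y r} := by
    intro y; ext x; simp [S]
  have a1 := Measure.prod_apply (μ := μ) (ν := ν) hS
  have a2 := Measure.prod_apply_symm (μ := μ) (ν := ν) hS
  constructor
  · simp only [e1] at a1
    rw [← a1, a2]
    have : ∀ᵐ y ∂ν, μ ((fun x => (x, y)) ⁻¹' S) = U.indicator (fun _ => μ (Metric.ball e0 r)) y := by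
      filter_upwards [h'.sph] with y hy
      rw [e2]
      by_cases hyU : y ∈ U
      · simp only [hyU, true_and, Set.indicator_of_mem]
        rw [← h.ball hy]; rfl
      · simp [hyU]
    rw [lintegral_congr_ae this, lintegral_indicator hU, setLIntegral_const]
  · have := measurable_measure_prodMk_left (ν := ν) hS
    simpa only [e1] using this

lemma RotInv.ratio {μ ν : Measure (E 2)} (h : RotInv μ) (h' : RotInv ν) (r : ℝ) :
    ν (Metric.ball e0 r) * μ Set.univ = μ (Metric.ball e0 r) * ν Set.univ := by
  have := (h.fubini h' MeasurableSet.univ r).1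
  rw [← this]
  simp only [Set.univ_inter]
  rw [← lintegral_const]
  apply lintegral_congr_ae
  filter_upwards [h.sph] with x hx
  rw [h'.ball hx]

lemma RotInv.open_le {μ ν : Measure (E 2)} (h : RotInv μ) (h' : RotInv ν)
    (hp : ∀ r > 0, ν (Metric.ball e0 r) ≠ 0) {U : Set (E 2)} (hU : IsOpen U) :
    ν Set.univ * μ U ≤ μ Set.univ * ν U := by
  have := h.fin
  have := h'.fin
  let Uk : ℕ → Set (E 2) := fun k => {x | Metric.ball x (1 / ((k : ℝ) + 1)) ⊆ U}
  have hmono : Monotone Uk := by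
    intro i j hij x hx
    refine (Metric.ball_subset_ball ?_).trans hx
    exact one_div_le_one_div_of_le (by positivity) (by exact_mod_cast Nat.succ_le_succ hij)
  have hun : U ⊆ ⋃ k, Uk k := by
    intro x hx
    obtain ⟨ε, hε, hb⟩ := Metric.isOpen_iff.1 hU x hx
    obtain ⟨k, hk⟩ := exists_nat_one_div_lt hε
    exact Set.mem_iUnion.2 ⟨k, (Metric.ball_subset_ball hk.le).trans hb⟩
  have hk : ∀ k, ν Set.univ * μ (Uk k) ≤ μ Set.univ * ν U := by
    intro k
    set r : ℝ := 1 / ((k : ℝ) + 1) with hr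
    have hr0 : 0 < r := by positivity
    obtain ⟨f1, f2⟩ := h.fubini h' hU.measurableSet r
    have mk := mul_meas_ge_le_lintegral (μ := μ) f2 (ν (Metric.ball e0 r))
    have : μ (Uk k) ≤ μ {x | ν (Metric.ball e0 r) ≤ ν (U ∩ Metric.ball x r)} := by
      apply measure_mono_ae
      filter_upwards [h.sph] with x hx hxk
      change Metric.ball x r ⊆ U at hxk
      change _ ≤ ν (U ∩ Metric.ball x r)
      rw [Set.inter_eq_right.2 hxk, h'.ball hx]
    have m2 : ν (Metric.ball e0 r) * μ (Uk k) ≤ μ (Metric.ball e0 r) * ν U :=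
      (mul_le_mul_right this _).trans (mk.trans f1.le)
    have m3 : ν (Metric.ball e0 r) * (ν Set.univ * μ (Uk k)) ≤ ν (Metric.ball e0 r) * (μ Set.univ * ν U) := by
      calc _ = ν Set.univ * (ν (Metric.ball e0 r) * μ (Uk k)) := by ring
        _ ≤ ν Set.univ * (μ (Metric.ball e0 r) * ν U) := mul_le_mul_right m2 _
        _ = (μ (Metric.ball e0 r) * ν Set.univ) * ν U := by ring
        _ = _ := by rw [← h.ratio h' r]; ring
    exact (ENNReal.mul_le_mul_iff_right (hp r hr0) (measure_ne_top _ _)).1 m3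
  calc ν Set.univ * μ U ≤ ν Set.univ * μ (⋃ k, Uk k) := mul_le_mul_right (measure_mono hun) _
    _ = ⨆ k, ν Set.univ * μ (Uk k) := by rw [hmono.measure_iUnion, ENNReal.mul_iSup]
    _ ≤ _ := iSup_le hk

lemma RotInv.uniq {μ ν : Measure (E 2)} (h : RotInv μ) (h' : RotInv ν)
    (hp : ∀ r > 0, ν (Metric.ball e0 r) ≠ 0) (hμ : μ Set.univ ≠ 0) :
    ν Set.univ • μ = μ Set.univ • ν := by
  have := h.fin
  have := h'.fin
  have hp' : ∀ r > 0, μ (Metric.ball e0 r) ≠ 0 := by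
    intro r hr h0
    have := h.ratio h' r
    rw [h0, zero_mul] at this
    exact (mul_ne_zero (hp r hr) hμ) this
  have hop : ∀ U : Set (E 2), IsOpen U → (ν Set.univ • μ) U = (μ Set.univ • ν) U := by
    intro U hU
    exact le_antisymm (h.open_le h' hp hU) (h'.open_le h hp' hU)
  have : IsFiniteMeasure (ν Set.univ • μ) := ⟨by
    rw [Measure.smul_apply]; exact ENNReal.mul_lt_top (measure_lt_top _ _) (measure_lt_top _ _)⟩
  refine ext_of_generate_finite _ (BorelSpace.measurable_eq) isPiSystem_isOpen ?_ ?_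
  · exact fun s hs => hop s hs
  · exact hop _ isOpen_univ

lemma rotInv_sg : RotInv sg := ⟨inferInstance, nrm_sphere_ae, mp_isom⟩

lemma sg_ball_pos (r : ℝ) (hr : 0 < r) : sg (Metric.ball e0 r) ≠ 0 := by
  intro h0
  set t := max (1 / 2) (1 - r ^ 2 / 4) with ht
  have ht0 : 0 < t := lt_of_lt_of_le (by norm_num) (le_max_left _ _)
  have ht1 : t < 1 := max_lt (by norm_num) (by nlinarith [sq_pos_of_pos hr])
  have hc := cap_area norm_e0 ht0 ht1.le
  have : sg.real {u | t < ⟪u, e0⟫} = 0 := by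
    rw [measureReal_eq_zero_iff]
    refine measure_mono_null_ae ?_ h0
    filter_upwards [nrm_sphere_ae] with u hu hut
    change t < ⟪u, e0⟫ at hut
    change u ∈ Metric.ball e0 r
    rw [Metric.mem_ball, dist_eq_norm]
    have h2 : ‖u - e0‖ ^ 2 < r ^ 2 := by
      rw [norm_sub_sq_real, hu, norm_e0]
      have := le_max_right (1 / 2) (1 - r ^ 2 / 4)
      nlinarith [sq_pos_of_pos hr]
    exact lt_of_pow_lt_pow_left₀ 2 hr.le h2
  rw [this] at hc
  have := Real.pi_pos
  nlinarith

lemma haus_fin : μH[2] (unitSphere 2) ≠ ⊤ := by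
  let F : ℝ × ℝ → E 2 := fun p => !₂[Real.cos p.1 * Real.cos p.2, Real.cos p.1 * Real.sin p.2, Real.sin p.1]
  have hF : ContDiff ℝ 1 F := by
    rw [contDiff_euclidean]
    intro i
    fin_cases i <;> simp [F] <;> fun_prop
  have hcpt : IsCompact (Set.Icc (-(π / 2), -π) (π / 2, π)) := isCompact_Icc
  obtain ⟨K, hK⟩ := hF.contDiffOn.exists_lipschitzOnWith (s := Set.Icc (-(π / 2), -π) (π / 2, π)) one_ne_zero (convex_Icc _ _) hcpt
  have himg := hK.hausdorffMeasure_image_le (d := 2) (by norm_num)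
  have hsub : unitSphere 2 ⊆ F '' (Set.Icc (-(π / 2), -π) (π / 2, π)) := by
    intro u hu
    have hu1 : ‖u‖ = 1 := by simpa [unitSphere] using hu
    have hs : u 0 ^ 2 + u 1 ^ 2 + u 2 ^ 2 = 1 := by
      have := EuclideanSpace.real_norm_sq_eq u
      rw [hu1, Fin.sum_univ_three] at this
      linarith
    set z : ℂ := ⟨u 0, u 1⟩ with hz
    have hn : ‖z‖ = Real.cos (Real.arcsin (u 2)) := by
      rw [Real.cos_arcsin, Complex.norm_eq_sqrt_sq_add_sq]
      congr 1
      simp only [hz]; linarith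
    refine ⟨(Real.arcsin (u 2), Complex.arg z), ⟨⟨Real.neg_pi_div_two_le_arcsin _, (Complex.neg_pi_lt_arg z).le⟩,
      ⟨Real.arcsin_le_pi_div_two _, Complex.arg_le_pi z⟩⟩, ?_⟩
    ext i
    fin_cases i
    · change Real.cos (Real.arcsin (u 2)) * Real.cos (Complex.arg z) = u 0
      rw [← hn, Complex.norm_mul_cos_arg]
    · change Real.cos (Real.arcsin (u 2)) * Real.sin (Complex.arg z) = u 1
      rw [← hn, Complex.norm_mul_sin_arg]
    · change Real.sin (Real.arcsin (u 2)) = u 2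
      rw [Real.sin_arcsin] <;> nlinarith [sq_nonneg (u 0), sq_nonneg (u 1)]
  refine ne_top_of_le_ne_top ?_ ((measure_mono hsub).trans himg)
  rw [hausdorffMeasure_prod_real]
  exact ENNReal.mul_ne_top (by simp) hcpt.measure_lt_top.ne

lemma haus_pos : μH[2] (unitSphere 2) ≠ 0 := by
  let g : E 2 → ℝ × ℝ := fun u => (u 0, u 1)
  have hg : LipschitzWith 1 g := by
    apply LipschitzWith.of_dist_le_mul
    intro x y
    rw [NNReal.coe_one, one_mul, Prod.dist_eq, dist_eq_norm x y]
    have hb : ∀ i, dist (x i) (y i) ≤ ‖x - y‖ := by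
      intro i
      rw [Real.dist_eq]
      have := PiLp.norm_apply_le (x - y) i
      simpa using this
    exact max_le (hb 0) (hb 1)
  intro h0
  have himg := hg.hausdorffMeasure_image_le (d := 2) (by norm_num) (unitSphere 2)
  rw [h0, mul_zero, hausdorffMeasure_prod_real] at himg
  have hsub : Set.Icc (0 : ℝ) (1 / 2) ×ˢ Set.Icc (0 : ℝ) (1 / 2) ⊆ g '' unitSphere 2 := by
    rintro ⟨a, b⟩ ⟨⟨ha, ha'⟩, ⟨hb, hb'⟩⟩
    simp only at ha ha' hb hb'
    refine ⟨!₂[a, b, √(1 - a ^ 2 - b ^ 2)], ?_, rfl⟩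
    have : ‖(!₂[a, b, √(1 - a ^ 2 - b ^ 2)] : E 2)‖ ^ 2 = 1 := by
      rw [EuclideanSpace.real_norm_sq_eq, Fin.sum_univ_three]
      change a ^ 2 + b ^ 2 + √(1 - a ^ 2 - b ^ 2) ^ 2 = 1
      rw [Real.sq_sqrt (by nlinarith)]; ring
    have := (pow_eq_one_iff_of_nonneg (norm_nonneg _) two_ne_zero).1 this
    simpa [unitSphere] using this
  have := (measure_mono hsub).trans himg
  rw [Measure.volume_eq_prod, Measure.prod_prod] at this
  norm_num at this

lemma rotInv_haus : RotInv (μH[2].restrict (unitSphere 2)) := by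
  have hm : MeasurableSet (unitSphere 2) := Metric.isClosed_sphere.measurableSet
  refine ⟨⟨?_⟩, ?_, ?_⟩
  · rw [Measure.restrict_apply_univ]; exact haus_fin.lt_top
  · filter_upwards [ae_restrict_mem hm] with u hu
    simpa [unitSphere] using hu
  · intro f
    have h0 : MeasurePreserving f (μH[2]) (μH[2]) := f.toIsometryEquiv.measurePreserving_hausdorffMeasure 2
    have := h0.restrict_preimage hm
    convert this using 2
    ext u; simp [unitSphere]

theorem area_eq : ∃ c0 : ℝ, 0 < c0 ∧ ∀ X : Set (E 2), MeasurableSet X → X ⊆ unitSphere 2 → area X = c0 * sg.real X := by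
  have hu := rotInv_haus.uniq rotInv_sg sg_ball_pos (by rw [Measure.restrict_apply_univ]; exact haus_pos)
  rw [Measure.restrict_apply_univ] at hu
  have h4 := sg_univ
  have hpi := Real.pi_pos
  have hh : 0 < (μH[2] (unitSphere 2)).toReal := ENNReal.toReal_pos haus_pos haus_fin
  refine ⟨(μH[2] (unitSphere 2)).toReal / (4 * π), by positivity, fun X hX hXs => ?_⟩
  have := congrArg (fun μ : Measure (E 2) => (μ X).toReal) hu
  simp only [Measure.smul_apply, smul_eq_mul, ENNReal.toReal_mul, Measure.restrict_apply hX] at this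
  rw [Set.inter_eq_left.2 hXs] at this
  change sg.real Set.univ * area X = _ * sg.real X at this
  rw [h4] at this
  field_simp
  linarith
end PalAux

/-! Part P4a -/

namespace PalAux

lemma self_nonpos {x : E 2} (h : ⟪x, x⟫ ≤ 0) : x = 0 := by
  rw [real_inner_self_eq_norm_sq] at h
  have : ‖x‖ = 0 := by nlinarith [norm_nonneg x]
  exact norm_eq_zero.1 this

def Cd (V : Set (E 2)) : Set (E 2) := {q | ∀ v ∈ V, ⟪q, v⟫ ≤ 0}
def Cc (V : Set (E 2)) : Set (E 2) := {u | ∀ q ∈ Cd V, ⟪q, u⟫ ≤ 0}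

lemma isClosed_Cd (V : Set (E 2)) : IsClosed (Cd V) := by
  have : Cd V = ⋂ v ∈ V, {q | ⟪q, v⟫ ≤ 0} := by ext; simp [Cd]
  rw [this]
  exact isClosed_biInter fun v _ => isClosed_le (by fun_prop) (by fun_prop)

lemma isClosed_Cc (V : Set (E 2)) : IsClosed (Cc V) := by
  have : Cc V = ⋂ v ∈ Cd V, {q | ⟪v, q⟫ ≤ 0} := by ext; simp [Cc]
  rw [this]
  exact isClosed_biInter fun v _ => isClosed_le (by fun_prop) (by fun_prop)

/-- Moreau decomposition over a cone spanned by a compact convex set -/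
lemma moreau {S : Set (E 2)} (hS : IsCompact S) (hcv : Convex ℝ S) (hne : S.Nonempty) (h0 : (0 : E 2) ∉ S) (u : E 2) :
    ∃ t : ℝ, 0 ≤ t ∧ ∃ x ∈ S, ⟪u - t • x, t • x⟫ = 0 ∧ ∀ y ∈ S, ⟪u - t • x, y⟫ ≤ 0 := by
  obtain ⟨x0, hx0, hmin⟩ := hS.exists_isMinOn hne (continuous_norm.continuousOn)
  have hδ : 0 < ‖x0‖ := norm_pos_iff.2 (by rintro rfl; exact h0 hx0)
  set T := 2 * ‖u‖ / ‖x0‖ with hT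
  have hT0 : 0 ≤ T := by positivity
  have hK : IsCompact (Set.Icc 0 T ×ˢ S) := isCompact_Icc.prod hS
  obtain ⟨⟨t, x⟩, ⟨ht, hx⟩, hm⟩ := hK.exists_isMinOn ⟨(0, x0), ⟨by simp [hT0], hx0⟩⟩
    (f := fun p : ℝ × E 2 => ‖u - p.1 • p.2‖) (by fun_prop)
  simp only at ht hx
  have hglob : ∀ s : ℝ, 0 ≤ s → ∀ y ∈ S, ‖u - t • x‖ ≤ ‖u - s • y‖ := by
    intro s hs y hy
    by_cases hsT : s ≤ T
    · exact hm (a := (s, y)) ⟨⟨hs, hsT⟩, hy⟩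
    · push Not at hsT
      have h1 : ‖u - t • x‖ ≤ ‖u‖ := by
        have := hm (a := (0, x0)) ⟨⟨le_rfl, hT0⟩, hx0⟩
        simpa using this
      have h2 : ‖x0‖ ≤ ‖y‖ := hmin hy
      have h3 : 2 * ‖u‖ ≤ ‖s • y‖ := by
        rw [norm_smul, Real.norm_of_nonneg hs]
        have : T * ‖x0‖ = 2 * ‖u‖ := by rw [hT]; field_simp
        rw [← this]; gcongr
      have h4 := norm_sub_norm_le (s • y) u
      rw [norm_sub_rev] at h4
      linarith
  -- first variation
  have var : ∀ v : E 2, (∃ e0 > (0:ℝ), ∀ e, 0 < e → e < e0 → ‖u - t • x‖ ≤ ‖(u - t • x) - e • v‖) → ⟪u - t • x, v⟫ ≤ 0 := by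
    rintro v ⟨e0, he0, hv⟩
    by_contra hpos
    push Not at hpos
    set q := u - t • x
    set e := min (e0 / 2) (⟪q, v⟫ / (‖v‖ ^ 2 + 1)) with he
    have hep : 0 < e := lt_min (by positivity) (by positivity)
    have := hv e hep (lt_of_le_of_lt (min_le_left _ _) (by linarith))
    have h2 : ‖q‖ ^ 2 ≤ ‖q - e • v‖ ^ 2 := by gcongr
    rw [norm_sub_sq_real q, real_inner_smul_right q v e, norm_smul, mul_pow, Real.norm_of_nonneg hep.le] at h2
    have h3 : e * (‖v‖ ^ 2 + 1) ≤ ⟪q, v⟫ := by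
      rw [← le_div_iff₀ (by positivity)]; exact min_le_right _ _
    nlinarith [mul_pos hep hpos]
  have hcone : ∀ y ∈ S, ∀ e > (0:ℝ), ∃ s : ℝ, 0 ≤ s ∧ ∃ z ∈ S, t • x + e • y = s • z := by
    intro y hy e he
    have hte : 0 < t + e := by linarith [ht.1]
    refine ⟨t + e, hte.le, (t / (t + e)) • x + (e / (t + e)) • y, hcv hx hy (div_nonneg ht.1 hte.le) (by positivity) (by field_simp), ?_⟩
    rw [smul_add, smul_smul, smul_smul]
    congr 2 <;> field_simp
  refine ⟨t, ht.1, x, hx, ?_, ?_⟩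
  · rcases ht.1.eq_or_lt with h | h
    · rw [← h]; simp
    · apply le_antisymm
      · rw [real_inner_smul_right]
        have : ⟪u - t • x, x⟫ ≤ 0 := by
          apply var
          refine ⟨1, one_pos, fun e he _ => ?_⟩
          have := hglob (t + e) (by linarith) x hx
          rwa [add_smul, ← sub_sub] at this
        nlinarith
      · have : ⟪u - t • x, -x⟫ ≤ 0 := by
          apply var
          refine ⟨t, h, fun e he het => ?_⟩
          have := hglob (t - e) (by linarith) x hx
          convert this using 2
          module
        rw [inner_neg_right] at this
        rw [real_inner_smul_right]
        nlinarith
  · intro y hy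
    apply var
    refine ⟨1, one_pos, fun e he _ => ?_⟩
    obtain ⟨s, hs, z, hz, hh⟩ := hcone y hy e he
    rw [sub_sub, hh]
    exact hglob s hs z hz

/-- finite set of unit vectors with pairwise inner products at least `c` -/
structure FinV (V : Finset (E 2)) (c : ℝ) : Prop where
  ne : V.Nonempty
  pos : 0 < c
  lt1 : c < 1
  unit : ∀ v ∈ V, ‖v‖ = 1
  inn : ∀ v ∈ V, ∀ w ∈ V, c ≤ ⟪v, w⟫

lemma FinV.moreau {V : Finset (E 2)} {c : ℝ} (h : FinV V c) (u : E 2) :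
    ∃ k : E 2 → ℝ, (∀ v, 0 ≤ k v) ∧ u - ∑ v ∈ V, k v • v ∈ Cd (V : Set (E 2)) ∧ ⟪u - ∑ v ∈ V, k v • v, ∑ v ∈ V, k v • v⟫ = 0 := by
  obtain ⟨p, hp⟩ := h.ne
  have hpos : ∀ x ∈ convexHull ℝ (V : Set (E 2)), c ≤ ⟪p, x⟫ := by
    have : convexHull ℝ (V : Set (E 2)) ⊆ {x | c ≤ ⟪p, x⟫} := by
      apply convexHull_min
      · intro v hv; exact h.inn p hp v hv
      · exact convex_halfSpace_ge (𝕜 := ℝ) (innerₛₗ ℝ p).isLinear c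
    exact this
  obtain ⟨t, ht, x, hx, h1, h2⟩ := PalAux.moreau (S := convexHull ℝ (V : Set (E 2)))
    (Set.Finite.isCompact_convexHull (𝕜 := ℝ) V.finite_toSet) (convex_convexHull _ _) (h.ne.coe_sort.elim fun a => ⟨a, subset_convexHull _ _ a.2⟩)
    (fun h0 => by have := hpos 0 h0; rw [inner_zero_right] at this; linarith [h.pos]) u
  obtain ⟨k, hk, -, hkx⟩ := Finset.mem_convexHull'.1 hx
  classical
  refine ⟨fun v => if v ∈ V then t * k v else 0, ?_, ?_⟩
  · intro v
    simp only
    split_ifs with hv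
    · exact mul_nonneg ht (hk v hv)
    · exact le_rfl
  · have : ∑ v ∈ V, (if v ∈ V then t * k v else 0) • v = t • x := by
      rw [← hkx, Finset.smul_sum]
      apply Finset.sum_congr rfl
      intro v hv
      rw [if_pos hv, smul_smul]
    rw [this]
    exact ⟨fun v hv => h2 v (subset_convexHull _ _ hv), h1⟩

lemma sub_Cc (V : Set (E 2)) : V ⊆ Cc V := fun v hv q hq => hq v hv

lemma sum_mem_Cc {V : Finset (E 2)} {k : E 2 → ℝ} (hk : ∀ v, 0 ≤ k v) : ∑ v ∈ V, k v • v ∈ Cc (V : Set (E 2)) := by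
  intro q hq
  rw [inner_sum]
  apply Finset.sum_nonpos
  intro v hv
  rw [real_inner_smul_right]
  exact mul_nonpos_of_nonneg_of_nonpos (hk v) (hq v hv)

lemma FinV.rep {V : Finset (E 2)} {c : ℝ} (h : FinV V c) {u : E 2} (hu : u ∈ Cc (V : Set (E 2))) :
    ∃ k : E 2 → ℝ, (∀ v, 0 ≤ k v) ∧ u = ∑ v ∈ V, k v • v := by
  obtain ⟨k, hk, h1, h2⟩ := h.moreau u
  refine ⟨k, hk, ?_⟩
  have h3 := hu _ h1
  set q := u - ∑ v ∈ V, k v • v with hq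
  have : ⟪q, q⟫ ≤ 0 := by
    have e : ⟪q, q⟫ = ⟪q, u⟫ - ⟪q, ∑ v ∈ V, k v • v⟫ := by rw [← inner_sub_right]
    rw [e, h2]; linarith
  have := self_nonpos this
  rwa [sub_eq_zero] at this

/-- uniqueness of the Moreau decomposition -/
lemma moreau_uniq {V : Set (E 2)} {g q g' q' : E 2} (hg : g ∈ Cc V) (hq : q ∈ Cd V) (hg' : g' ∈ Cc V) (hq' : q' ∈ Cd V)
    (h : ⟪q, g⟫ = 0) (h' : ⟪q', g'⟫ = 0) (e : g + q = g' + q') : g = g' ∧ q = q' := by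
  have h1 := hg' q hq
  have h2 := hg q' hq'
  have e1 : g - g' = q' - q := by rw [sub_eq_sub_iff_add_eq_add, e]; abel
  have : ⟪g - g', g - g'⟫ ≤ 0 := by
    nth_rewrite 1 [e1]
    rw [inner_sub_left, inner_sub_right, inner_sub_right]
    linarith
  have h3 := self_nonpos this
  rw [h3] at e1
  exact ⟨sub_eq_zero.1 h3, (sub_eq_zero.1 e1.symm).symm⟩

/-- points of the cone are close to all points close to `V` -/
lemma FinV.close {V : Finset (E 2)} {c : ℝ} (h : FinV V c) {g m : E 2} (hg : g ∈ Cc (V : Set (E 2)))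
    (hm : ∀ v ∈ V, c ≤ ⟪m, v⟫) : c * ‖g‖ ≤ ⟪m, g⟫ := by
  obtain ⟨k, hk, rfl⟩ := h.rep hg
  rw [inner_sum]
  calc c * ‖∑ v ∈ V, k v • v‖ ≤ c * ∑ v ∈ V, ‖k v • v‖ := mul_le_mul_of_nonneg_left (norm_sum_le _ _) h.pos.le
    _ = ∑ v ∈ V, c * ‖k v • v‖ := Finset.mul_sum _ _ _
    _ ≤ _ := by
      apply Finset.sum_le_sum
      intro v hv
      rw [norm_smul, h.unit v hv, mul_one, Real.norm_of_nonneg (hk v), real_inner_smul_right, mul_comm]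
      exact mul_le_mul_of_nonneg_left (hm v hv) (hk v)

/-- the key inclusion for the parallel body -/
lemma FinV.par {V : Finset (E 2)} {c s : ℝ} (h : FinV V c) (hs : 0 < s) (hcs : c ^ 2 + s ^ 2 = 1) {g q m : E 2} (hg : g ∈ Cc (V : Set (E 2)))
    (hm1 : ‖m‖ = 1) (hm : ∀ v ∈ V, c ≤ ⟪m, v⟫) (hgq : ⟪q, g⟫ = 0) (hgs : s ≤ ‖g‖) (hqc : ‖q‖ ≤ c) : 0 ≤ ⟪m, g + q⟫ := by
  have h1 := h.close hg hm
  have hg0 : 0 < ‖g‖ := by linarith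
  -- the component of m orthogonal to g
  set m' := m - (⟪m, g⟫ / ‖g‖ ^ 2) • g with hm'
  have e1 : ⟪m, q⟫ = ⟪m', q⟫ := by
    rw [hm', inner_sub_left, real_inner_smul_left, real_inner_comm q g, hgq]; ring
  have e2 : ‖m'‖ ^ 2 = 1 - (⟪m, g⟫ / ‖g‖) ^ 2 := by
    rw [hm', norm_sub_sq_real, hm1, real_inner_smul_right, norm_smul, Real.norm_eq_abs, mul_pow, sq_abs]
    field_simp; ring
  have e3 : c ≤ ⟪m, g⟫ / ‖g‖ := by rwa [le_div_iff₀ hg0]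
  have e4 : ‖m'‖ ≤ s := by
    refine le_of_sq_le ?_ hs.le
    have hc := h.pos
    nlinarith
  have e5 : |⟪m', q⟫| ≤ s * c := (abs_real_inner_le_norm _ _).trans (mul_le_mul e4 hqc (norm_nonneg _) hs.le)
  rw [inner_add_right, e1]
  have := (abs_le.1 e5).1
  nlinarith [h.pos]
end PalAux

/-! Part P4b -/

namespace PalAux

lemma real_le_of_ae {X Y : Set (E 2)} (h : ∀ᵐ u ∂sg, u ∈ X → u ∈ Y) : sg.real X ≤ sg.real Y :=
  ENNReal.toReal_mono (measure_ne_top _ _) (measure_mono_ae h)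

/-- cross product -/
def cr (a b : E 2) : E 2 := !₂[a 1 * b 2 - a 2 * b 1, a 2 * b 0 - a 0 * b 2, a 0 * b 1 - a 1 * b 0]

lemma cr0 (a b : E 2) : cr a b 0 = a 1 * b 2 - a 2 * b 1 := rfl
lemma cr1 (a b : E 2) : cr a b 1 = a 2 * b 0 - a 0 * b 2 := rfl
lemma cr2 (a b : E 2) : cr a b 2 = a 0 * b 1 - a 1 * b 0 := rfl

lemma inner3 (a b : E 2) : ⟪a, b⟫ = a 0 * b 0 + a 1 * b 1 + a 2 * b 2 := by
  rw [PiLp.inner_apply, Fin.sum_univ_three]; simp [mul_comm]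

lemma ext3 {a b : E 2} (h0 : a 0 = b 0) (h1 : a 1 = b 1) (h2 : a 2 = b 2) : a = b := by
  ext i; fin_cases i
  · exact h0
  · exact h1
  · exact h2

lemma cr_cr (a b c : E 2) : cr a (cr b c) = ⟪a, c⟫ • b - ⟪a, b⟫ • c := by
  apply ext3 <;> simp [cr0, cr1, cr2, inner3] <;> ring

lemma cr_anti (a b : E 2) : cr a b = -cr b a := by
  apply ext3 <;> simp [cr0, cr1, cr2] <;> ring

lemma cr_smul_right (a b : E 2) (t : ℝ) : cr a (t • b) = t • cr a b := by
  apply ext3 <;> simp [cr0, cr1, cr2] <;> ring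

lemma cr_smul_left (a b : E 2) (t : ℝ) : cr (t • a) b = t • cr a b := by
  apply ext3 <;> simp [cr0, cr1, cr2] <;> ring

lemma binet (a b z z' : E 2) : ⟪a, z⟫ * ⟪b, z'⟫ - ⟪a, z'⟫ * ⟪b, z⟫ = ⟪cr a b, cr z z'⟫ := by
  simp only [inner3, cr0, cr1, cr2]; ring

lemma cr_self_left (a b : E 2) : ⟪cr a b, a⟫ = 0 := by simp only [inner3, cr0, cr1, cr2]; ring
lemma cr_self_right (a b : E 2) : ⟪cr a b, b⟫ = 0 := by simp only [inner3, cr0, cr1, cr2]; ring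

lemma par_of_cr {a b : E 2} (h : cr a b = 0) : ⟪b, b⟫ • a = ⟪a, b⟫ • b := by
  have := cr_cr b a b
  rw [h] at this
  have h0 : cr b 0 = 0 := by apply ext3 <;> simp [cr0, cr1, cr2]
  rw [h0, real_inner_comm a b] at this
  exact (sub_eq_zero.1 this.symm)

/-- a vector orthogonal to two vectors is a multiple of the cross product -/
lemma par_cr {q x y : E 2} (hx : ⟪q, x⟫ = 0) (hy : ⟪q, y⟫ = 0) :
    ⟪cr x y, cr x y⟫ • q = ⟪q, cr x y⟫ • cr x y := by
  apply par_of_cr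
  rw [cr_cr, hx, hy]; simp

lemma det_cyc (u x y v : E 2) : ⟪u, u⟫ * ⟪cr x y, v⟫ = ⟪u, x⟫ * ⟪u, cr y v⟫ - ⟪u, y⟫ * ⟪u, cr x v⟫ + ⟪u, v⟫ * ⟪u, cr x y⟫ := by
  simp only [inner3, cr0, cr1, cr2]; ring

lemma det1 (u x y v : E 2) : ⟪u, cr (⟪u, y⟫ • x - ⟪u, x⟫ • y) (⟪u, v⟫ • x - ⟪u, x⟫ • v)⟫ = ⟪u, x⟫ * (⟪u, u⟫ * ⟪cr x y, v⟫) := by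
  rw [det_cyc]
  generalize ⟪u, x⟫ = X, ⟪u, y⟫ = Y, ⟪u, v⟫ = W
  simp only [inner3, cr0, cr1, cr2, PiLp.sub_apply, PiLp.smul_apply, smul_eq_mul]; ring

lemma det2 (u x y v : E 2) : ⟪u, cr (⟪u, y⟫ • x - ⟪u, x⟫ • y) (⟪u, y⟫ • v - ⟪u, v⟫ • y)⟫ = -⟪u, y⟫ * (⟪u, u⟫ * ⟪cr x y, v⟫) := by
  rw [det_cyc]
  generalize ⟪u, x⟫ = X, ⟪u, y⟫ = Y, ⟪u, v⟫ = W
  simp only [inner3, cr0, cr1, cr2, PiLp.sub_apply, PiLp.smul_apply, smul_eq_mul]; ring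

lemma nrm_pos {q : E 2} {t : ℝ} (ht : 0 < t) : nrm (t • q) = nrm q := by
  unfold nrm
  rw [norm_smul, Real.norm_of_nonneg ht.le, smul_smul]
  congr 1
  field_simp

lemma norm_nrm {q : E 2} (hq : q ≠ 0) : ‖nrm q‖ = 1 := by
  unfold nrm
  rw [norm_smul, norm_inv, norm_norm, inv_mul_cancel₀ (norm_ne_zero_iff.2 hq)]

lemma norm_smul_nrm (q : E 2) : ‖q‖ • nrm q = q := by
  unfold nrm
  by_cases hq : q = 0
  · simp [hq]
  · rw [smul_smul, mul_inv_cancel₀ (norm_ne_zero_iff.2 hq), one_smul]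

lemma Cd_smul {V : Set (E 2)} {q : E 2} (hq : q ∈ Cd V) {t : ℝ} (ht : 0 ≤ t) : t • q ∈ Cd V := by
  intro v hv
  rw [real_inner_smul_left]
  exact mul_nonpos_of_nonneg_of_nonpos ht (hq v hv)

lemma Cc_smul {V : Set (E 2)} {q : E 2} (hq : q ∈ Cc V) {t : ℝ} (ht : 0 ≤ t) : t • q ∈ Cc V := by
  intro v hv
  rw [real_inner_smul_right]
  exact mul_nonpos_of_nonneg_of_nonpos ht (hq v hv)

open Classical in
/-- outer unit normals of the facets -/
def Nn (V : Finset (E 2)) : Finset (E 2) :=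
  ((V ×ˢ V).image (fun p => nrm (-(cr p.1 p.2)))).filter (fun n => ‖n‖ = 1 ∧ n ∈ Cd (V : Set (E 2)))

def pj (n u : E 2) : E 2 := u - ⟪u, n⟫ • n

lemma pj_lin {n : E 2} (hn : ‖n‖ = 1) (u : E 2) (α s : ℝ) : pj n (α • u + s • n) = α • pj n u := by
  unfold pj
  rw [inner_add_left, real_inner_smul_left, real_inner_smul_left, inner_self_one hn]
  module

def Bn (V : Set (E 2)) (n : E 2) : Set (E 2) := {u | pj n u ∈ Cc V}
def Bx (V : Set (E 2)) (n : E 2) : Set (E 2) := {u | pj n u ∈ Cd V}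

lemma Bn_cyl (V : Set (E 2)) {n : E 2} (hn : ‖n‖ = 1) : CylInv n (Bn V n) := by
  intro u α s hα
  simp only [Bn, Set.mem_ofPred_eq, pj_lin hn]
  constructor
  · intro h
    have := Cc_smul h (inv_nonneg.2 hα.le)
    rwa [smul_smul, inv_mul_cancel₀ hα.ne', one_smul] at this
  · intro h; exact Cc_smul h hα.le

lemma Bx_cyl (V : Set (E 2)) {n : E 2} (hn : ‖n‖ = 1) : CylInv n (Bx V n) := by
  intro u α s hα
  simp only [Bx, Set.mem_ofPred_eq, pj_lin hn]
  constructor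
  · intro h
    have := Cd_smul h (inv_nonneg.2 hα.le)
    rwa [smul_smul, inv_mul_cancel₀ hα.ne', one_smul] at this
  · intro h; exact Cd_smul h hα.le

lemma continuous_pj (n : E 2) : Continuous (pj n) := by unfold pj; fun_prop

lemma Bn_meas (V : Set (E 2)) (n : E 2) : MeasurableSet (Bn V n) := ((isClosed_Cc V).preimage (continuous_pj n)).measurableSet
lemma Bx_meas (V : Set (E 2)) (n : E 2) : MeasurableSet (Bx V n) := ((isClosed_Cd V).preimage (continuous_pj n)).measurableSet

lemma FinV.cover {V : Finset (E 2)} {c : ℝ} (h : FinV V c) (u : E 2) :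
    u ∈ Cc (V : Set (E 2)) ∨ u ∈ Cd (V : Set (E 2)) ∨ (∃ n ∈ Nn V, u ∈ Bn (V : Set (E 2)) n ∧ 0 < ⟪u, n⟫) ∨
      (∃ x ∈ V, u ∈ Bx (V : Set (E 2)) x ∧ 0 < ⟪u, x⟫) := by
  classical
  obtain ⟨k, hk, h1, h2⟩ := h.moreau u
  have hgC : ∑ v ∈ V, k v • v ∈ Cc (V : Set (E 2)) := sum_mem_Cc hk
  obtain ⟨q, hq⟩ : ∃ q, q = u - ∑ v ∈ V, k v • v := ⟨_, rfl⟩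
  rw [← hq] at h1 h2
  have hu : u = ∑ v ∈ V, k v • v + q := by rw [hq]; abel
  have hsupp : ∀ v ∈ V, 0 < k v → ⟪q, v⟫ = 0 := by
    intro v hv hkv
    rw [inner_sum] at h2
    have h3 : ∀ v ∈ V, ⟪q, k v • v⟫ ≤ 0 := by
      intro v hv
      rw [real_inner_smul_right]; exact mul_nonpos_of_nonneg_of_nonpos (hk v) (h1 v hv)
    have h4 := (Finset.sum_eq_zero_iff_of_nonpos h3).1 h2 v hv
    rw [real_inner_smul_right] at h4
    exact (mul_eq_zero.1 h4).resolve_left hkv.ne'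
  by_cases hq0 : q = 0
  · left; rw [hu, hq0, add_zero]; exact hgC
  by_cases hx : ∃ x ∈ V, 0 < k x
  swap
  · right; left
    push Not at hx
    have : ∑ v ∈ V, k v • v = 0 := by
      apply Finset.sum_eq_zero
      intro v hv
      rw [le_antisymm (hx v hv) (hk v), zero_smul]
    rw [hu, this, zero_add]; exact h1
  obtain ⟨x, hxV, hkx⟩ := hx
  have hqx := hsupp x hxV hkx
  right; right
  by_cases hy : ∃ y ∈ V, 0 < k y ∧ cr x y ≠ 0
  · left
    obtain ⟨y, hyV, hky, hxy⟩ := hy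
    have hqy := hsupp y hyV hky
    have hp := par_cr hqx hqy
    set w := cr x y with hw
    have hww : 0 < ⟪w, w⟫ := by rw [real_inner_self_eq_norm_sq]; have := norm_pos_iff.2 hxy; positivity
    have hqw : q = (⟪q, w⟫ / ⟪w, w⟫) • w := by
      rw [div_eq_inv_mul, mul_smul, ← hp, smul_smul, inv_mul_cancel₀ hww.ne', one_smul]
    set l := ⟪q, w⟫ / ⟪w, w⟫ with hl
    have hl0 : l ≠ 0 := by intro h0; rw [h0, zero_smul] at hqw; exact hq0 hqw
    have hqn := norm_pos_iff.2 hq0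
    have hmem : nrm q ∈ Nn V := by
      unfold Nn
      rw [Finset.mem_filter]
      refine ⟨?_, norm_nrm hq0, Cd_smul h1 (inv_nonneg.2 (norm_nonneg _))⟩
      rw [Finset.mem_image]
      rcases lt_or_gt_of_ne hl0 with hl | hl
      · refine ⟨(x, y), Finset.mem_product.2 ⟨hxV, hyV⟩, ?_⟩
        simp only
        rw [hqw, ← hw, ← nrm_pos (q := -w) (neg_pos.2 hl)]
        congr 1; module
      · refine ⟨(y, x), Finset.mem_product.2 ⟨hyV, hxV⟩, ?_⟩
        simp only
        rw [hqw, ← cr_anti x y, ← hw, ← nrm_pos (q := w) hl]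
    have hun : ⟪u, nrm q⟫ = ‖q‖ := by
      rw [hu, inner_add_left]
      unfold nrm
      rw [real_inner_smul_right, real_inner_smul_right, real_inner_comm, h2, real_inner_self_eq_norm_sq]
      field_simp; ring
    refine ⟨nrm q, hmem, ?_, ?_⟩
    · simp only [Bn, Set.mem_ofPred_eq, pj]
      rw [hun, norm_smul_nrm, hu, add_sub_cancel_right]
      exact hgC
    · rw [hun]; exact hqn
  · right
    push Not at hy
    refine ⟨x, hxV, ?_, ?_⟩
    · have hg : ∑ v ∈ V, k v • v = ⟪∑ v ∈ V, k v • v, x⟫ • x := by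
        rw [sum_inner, Finset.sum_smul]
        apply Finset.sum_congr rfl
        intro v hv
        rcases (hk v).eq_or_lt with h0 | h0
        · rw [← h0]; simp
        · have h3 := hy v hv h0
          have h4 : cr v x = 0 := by rw [cr_anti, h3, neg_zero]
          have h5 := par_of_cr h4
          rw [inner_self_one (h.unit x hxV), one_smul] at h5
          rw [real_inner_smul_left, mul_smul, ← h5]
      simp only [Bx, Set.mem_ofPred_eq, pj]
      have : u - ⟪u, x⟫ • x = q := by
        rw [hu, inner_add_left, hqx, add_zero, ← hg]; abel
      rw [this]; exact h1
    · rw [hu, inner_add_left, hqx, add_zero, sum_inner]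
      apply Finset.sum_pos'
      · intro v hv
        rw [real_inner_smul_left]
        exact mul_nonneg (hk v) (h.pos.le.trans (h.inn v hv x hxV))
      · refine ⟨x, hxV, ?_⟩
        rw [real_inner_smul_left, inner_self_one (h.unit x hxV)]; linarith

lemma Cc_add {V : Set (E 2)} {a b : E 2} (ha : a ∈ Cc V) (hb : b ∈ Cc V) : a + b ∈ Cc V := by
  intro q hq; rw [inner_add_right]; linarith [ha q hq, hb q hq]

lemma FinV.crofton {V : Finset (E 2)} {c : ℝ} (h : FinV V c) {u : E 2} (hu : ‖u‖ = 1) (h0 : ∀ v ∈ V, ⟪u, v⟫ ≠ 0)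
    (h1 : ∀ v ∈ V, ∀ β γ : ℝ, u ≠ β • v + γ • v) :
    u ∈ Cd (V : Set (E 2)) ∨ -u ∈ Cd (V : Set (E 2)) ∨ ∃ n ∈ Nn V, cr n u ∈ Cc (V : Set (E 2)) := by
  classical
  by_cases hc1 : u ∈ Cd (V : Set (E 2))
  · exact Or.inl hc1
  by_cases hc2 : -u ∈ Cd (V : Set (E 2))
  · exact Or.inr (Or.inl hc2)
  right; right
  simp only [Cd, Set.mem_ofPred_eq, not_forall, not_le] at hc1 hc2
  obtain ⟨y0, hy0, hy0'⟩ := hc1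
  obtain ⟨x0, hx0, hx0'⟩ := hc2
  rw [inner_neg_left] at hx0'
  obtain ⟨p, hp⟩ := h.ne
  let z : E 2 × E 2 → E 2 := fun t => ⟪u, t.2⟫ • t.1 - ⟪u, t.1⟫ • t.2
  let P := (V ×ˢ V).filter (fun t => ⟪u, t.1⟫ < 0 ∧ 0 < ⟪u, t.2⟫)
  have hPne : P.Nonempty := ⟨(x0, y0), by simp only [P, Finset.mem_filter, Finset.mem_product]; exact ⟨⟨hx0, hy0⟩, by linarith, hy0'⟩⟩
  obtain ⟨⟨x, y⟩, hxy, hmin⟩ := P.exists_min_image (fun t => ⟪cr p u, z t⟫ / ⟪p, z t⟫) hPne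
  have hzp : ∀ t ∈ P, 0 < ⟪p, z t⟫ := by
    intro t ht
    simp only [P, Finset.mem_filter, Finset.mem_product] at ht
    simp only [z, inner_sub_right, real_inner_smul_right]
    have a1 := h.pos.trans_le (h.inn p hp t.1 ht.1.1)
    have a2 := h.pos.trans_le (h.inn p hp t.2 ht.1.2)
    nlinarith [mul_pos ht.2.2 a1, mul_pos (neg_pos.2 ht.2.1) a2]
  have hzu : ∀ t, ⟪u, z t⟫ = 0 := by
    intro t; simp only [z, inner_sub_right, real_inner_smul_right]; ring
  have huu := inner_self_one hu
  have hdet : ∀ t ∈ P, ⟪u, cr (z (x, y)) (z t)⟫ ≤ 0 := by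
    intro t ht
    have m := hmin t ht
    rw [div_le_div_iff₀ (hzp _ hxy) (hzp _ ht)] at m
    have b := binet (cr p u) p (z (x, y)) (z t)
    have par := par_of_cr (a := cr (z (x, y)) (z t)) (b := u) (by
      rw [cr_anti, cr_cr, hzu, hzu]; simp)
    rw [huu, one_smul] at par
    rw [par, real_inner_smul_right, cr_anti (cr p u) p, cr_cr, inner_neg_left, inner_sub_left, real_inner_smul_left, real_inner_smul_left,
      huu, inner_self_one (h.unit p hp), real_inner_comm u (cr (z (x, y)) (z t))] at b
    have hk : 0 < 1 - ⟪p, u⟫ ^ 2 := by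
      have hlt : |⟪p, u⟫| < 1 := by
        refine lt_of_le_of_ne (by simpa [h.unit p hp, hu] using abs_real_inner_le_norm p u) ?_
        intro he
        have e1 : ⟪p, u⟫ ^ 2 = 1 := by rw [← sq_abs, he]; norm_num
        have : ⟪u - ⟪p, u⟫ • p, u - ⟪p, u⟫ • p⟫ ≤ 0 := by
          simp only [inner_sub_left, inner_sub_right, real_inner_smul_left, real_inner_smul_right, huu, inner_self_one (h.unit p hp), real_inner_comm p u]
          nlinarith
        have := sub_eq_zero.1 (self_nonpos this)
        exact h1 p hp ⟪p, u⟫ 0 (by rw [zero_smul, add_zero]; exact this)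
      have := sq_lt_one_iff_abs_lt_one (⟪p, u⟫) |>.2 hlt
      linarith
    by_contra hcon
    push Not at hcon
    nlinarith [mul_pos hcon hk]
  simp only [P, Finset.mem_filter, Finset.mem_product] at hxy
  obtain ⟨⟨hxV, hyV⟩, hux, huy⟩ := hxy
  have hge : ∀ v ∈ V, 0 ≤ ⟪cr x y, v⟫ := by
    intro v hv
    rcases lt_or_gt_of_ne (h0 v hv) with hs | hs
    · have := hdet (v, y) (by simp only [P, Finset.mem_filter, Finset.mem_product]; exact ⟨⟨hv, hyV⟩, hs, huy⟩)
      simp only [z] at this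
      rw [det2, huu, one_mul] at this
      nlinarith
    · have := hdet (x, v) (by simp only [P, Finset.mem_filter, Finset.mem_product]; exact ⟨⟨hxV, hv⟩, hux, hs⟩)
      simp only [z] at this
      rw [det1, huu, one_mul] at this
      nlinarith
  have hne : cr x y ≠ 0 := by
    intro he
    have := par_of_cr he
    rw [inner_self_one (h.unit y hyV), one_smul] at this
    rw [this, real_inner_smul_right] at hux
    have := h.pos.trans_le (h.inn x hxV y hyV)
    nlinarith
  refine ⟨nrm (-(cr x y)), ?_, ?_⟩
  · unfold Nn
    rw [Finset.mem_filter]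
    refine ⟨Finset.mem_image.2 ⟨(x, y), Finset.mem_product.2 ⟨hxV, hyV⟩, rfl⟩, norm_nrm (neg_ne_zero.2 hne), ?_⟩
    apply Cd_smul _ (inv_nonneg.2 (norm_nonneg _))
    intro v hv
    rw [inner_neg_left]; linarith [hge v hv]
  · unfold nrm
    rw [cr_smul_left]
    apply Cc_smul _ (inv_nonneg.2 (norm_nonneg _))
    rw [cr_anti]
    have e : -cr u (-cr x y) = ⟪u, y⟫ • x + (-⟪u, x⟫) • y := by
      have := cr_smul_right u (cr x y) (-1)
      rw [neg_one_smul] at this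
      rw [this, cr_cr]; module
    rw [e]
    exact Cc_add (Cc_smul (sub_Cc _ hxV) huy.le) (Cc_smul (sub_Cc _ hyV) (by linarith))
end PalAux

/-! Part P4c -/

namespace PalAux

lemma sum_le_sg {ι : Type} (s : Finset ι) (R : ι → Set (E 2)) (hR : ∀ i ∈ s, MeasurableSet (R i)) {Y : Set (E 2)}
    (hd : ∀ᵐ u ∂sg, ∀ i ∈ s, ∀ j ∈ s, u ∈ R i → u ∈ R j → i = j)
    (hsub : ∀ᵐ u ∂sg, ∀ i ∈ s, u ∈ R i → u ∈ Y) : ∑ i ∈ s, sg.real (R i) ≤ sg.real Y := by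
  classical
  have h1 : sg (⋃ i ∈ s, R i) = ∑ i ∈ s, sg (R i) := by
    apply measure_biUnion_finset₀
    · intro i hi j hj hij
      show sg (R i ∩ R j) = 0
      have : ∀ᵐ u ∂sg, u ∉ R i ∩ R j := by
        filter_upwards [hd] with u hu h
        exact hij (hu i hi j hj h.1 h.2)
      rw [ae_iff] at this
      simpa using this
    · intro i hi; exact (hR i hi).nullMeasurableSet
  have h2 : ∑ i ∈ s, sg.real (R i) = sg.real (⋃ i ∈ s, R i) := by
    rw [measureReal_def, h1, ENNReal.toReal_sum (fun i _ => measure_ne_top _ _)]; rfl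
  rw [h2]
  apply real_le_of_ae
  filter_upwards [hsub] with u hu h
  simp only [Set.mem_iUnion] at h
  obtain ⟨i, hi, h⟩ := h
  exact hu i hi h

lemma sg_le_sum {ι : Type} (s : Finset ι) (R : ι → Set (E 2)) {Y : Set (E 2)}
    (hsub : ∀ᵐ u ∂sg, u ∈ Y → ∃ i ∈ s, u ∈ R i) : sg.real Y ≤ ∑ i ∈ s, sg.real (R i) := by
  calc sg.real Y ≤ sg.real (⋃ i ∈ s, R i) := by
        apply real_le_of_ae
        filter_upwards [hsub] with u hu h
        obtain ⟨i, hi, h⟩ := hu h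
        simp only [Set.mem_iUnion]
        exact ⟨i, hi, h⟩
    _ ≤ _ := measureReal_biUnion_finset_le s R

lemma Nn_mem {V : Finset (E 2)} {n : E 2} (h : n ∈ Nn V) : ‖n‖ = 1 ∧ n ∈ Cd (V : Set (E 2)) := by
  classical
  unfold Nn at h
  exact (Finset.mem_filter.1 h).2

abbrev IX := Unit ⊕ (E 2 ⊕ E 2)
def SX (V : Finset (E 2)) : Finset IX := Finset.disjSum {()} (Finset.disjSum (Nn V) V)

lemma SX_sum (V : Finset (E 2)) (f : IX → ℝ) : ∑ i ∈ SX V, f i =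
    f (Sum.inl ()) + (∑ n ∈ Nn V, f (Sum.inr (Sum.inl n)) + ∑ x ∈ V, f (Sum.inr (Sum.inr x))) := by
  unfold SX
  rw [Finset.sum_disjSum, Finset.sum_disjSum, Finset.sum_singleton]

def EV (V : Finset (E 2)) : ℝ := ∑ n ∈ Nn V, sg.real (Bn (V : Set (E 2)) n)
def XV (V : Finset (E 2)) : ℝ := ∑ x ∈ V, sg.real (Bx (V : Set (E 2)) x)

lemma pj_norm {n u : E 2} (hn : ‖n‖ = 1) (hu : ‖u‖ = 1) : ‖pj n u‖ ^ 2 = 1 - ⟪u, n⟫ ^ 2 := by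
  unfold pj
  rw [norm_sub_sq_real, hu, norm_smul, hn, real_inner_smul_right, Real.norm_eq_abs, mul_one, sq_abs]; ring

lemma pj_inner {n : E 2} (hn : ‖n‖ = 1) (u : E 2) : ⟪pj n u, n⟫ = 0 := by
  unfold pj
  rw [inner_sub_left, real_inner_smul_left, inner_self_one hn]; ring

lemma inner_le1 {n u : E 2} (hn : ‖n‖ = 1) (hu : ‖u‖ = 1) : ⟪u, n⟫ ≤ 1 := by
  have := real_inner_le_norm u n
  rwa [hn, hu, one_mul] at this

lemma FinV.stA {V : Finset (E 2)} {c : ℝ} (h : FinV V c) :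
    4 * π ≤ sg.real (Cc (V : Set (E 2))) + sg.real (Cd (V : Set (E 2))) + EV V / 2 + XV V / 2 := by
  let R : IX ⊕ Unit → Set (E 2) := fun i => match i with
    | Sum.inl (Sum.inl _) => Cc (V : Set (E 2))
    | Sum.inl (Sum.inr (Sum.inl n)) => Bn (V : Set (E 2)) n ∩ {u | 0 < ⟪u, n⟫ ∧ ⟪u, n⟫ ≤ 1}
    | Sum.inl (Sum.inr (Sum.inr x)) => Bx (V : Set (E 2)) x ∩ {u | 0 < ⟪u, x⟫ ∧ ⟪u, x⟫ ≤ 1}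
    | Sum.inr _ => Cd (V : Set (E 2))
  have := sg_le_sum (Finset.disjSum (SX V) {()}) R (Y := Set.univ) (by
    filter_upwards [nrm_sphere_ae] with u hu _
    rcases h.cover u with h1 | h1 | ⟨n, hn, h1, h2⟩ | ⟨n, hn, h1, h2⟩
    · exact ⟨Sum.inl (Sum.inl ()), by simp [SX], h1⟩
    · exact ⟨Sum.inr (), by simp [SX], h1⟩
    · exact ⟨Sum.inl (Sum.inr (Sum.inl n)), by simpa [SX] using hn, h1, h2, inner_le1 (Nn_mem hn).1 hu⟩
    · exact ⟨Sum.inl (Sum.inr (Sum.inr n)), by simpa [SX] using hn, h1, h2, inner_le1 (h.unit n hn) hu⟩)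
  rw [sg_univ, Finset.sum_disjSum, SX_sum, Finset.sum_singleton] at this
  have e1 : ∑ n ∈ Nn V, sg.real (R (Sum.inl (Sum.inr (Sum.inl n)))) = EV V / 2 := by
    unfold EV
    rw [Finset.sum_div]
    apply Finset.sum_congr rfl
    intro n hn
    have := height (Nn_mem hn).1 (Bn_cyl (V : Set (E 2)) (Nn_mem hn).1) (Bn_meas _ n) one_pos le_rfl
    simp only [R]
    rw [this]; ring
  have e2 : ∑ x ∈ V, sg.real (R (Sum.inl (Sum.inr (Sum.inr x)))) = XV V / 2 := by
    unfold XV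
    rw [Finset.sum_div]
    apply Finset.sum_congr rfl
    intro n hn
    have := height (h.unit n hn) (Bx_cyl (V : Set (E 2)) (h.unit n hn)) (Bx_meas _ n) one_pos le_rfl
    simp only [R]
    rw [this]; ring
  rw [e1, e2] at this
  simp only [R] at this
  linarith

def rotL (n : E 2) (hn : ‖n‖ = 1) : E 2 →ₗᵢ[ℝ] E 2 where
  toFun w := cr n w + ⟪n, w⟫ • n
  map_add' x y := by
    rw [inner_add_right]
    have : cr n (x + y) = cr n x + cr n y := by apply ext3 <;> simp [cr0, cr1, cr2] <;> ring
    rw [this]; module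
  map_smul' t x := by
    rw [cr_smul_right, real_inner_smul_right, smul_add, smul_smul]; rfl
  norm_map' w := by
    have e : ‖cr n w + ⟪n, w⟫ • n‖ ^ 2 = ‖w‖ ^ 2 := by
      have hb := binet n w n w
      have h0 : ⟪cr n w, n⟫ = 0 := by simp only [inner3, cr0, cr1, cr2]; ring
      have h1 := inner_self_one hn
      rw [← real_inner_self_eq_norm_sq, ← real_inner_self_eq_norm_sq]
      simp only [inner_add_left, inner_add_right, real_inner_smul_left, real_inner_smul_right, real_inner_comm (cr n w) n, h0, h1] at hb ⊢
      rw [← hb, real_inner_comm n w]; ring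
    exact (pow_left_inj₀ (norm_nonneg _) (norm_nonneg _) two_ne_zero).1 e

def rotE (n : E 2) (hn : ‖n‖ = 1) : E 2 ≃ₗᵢ[ℝ] E 2 := (rotL n hn).toLinearIsometryEquiv rfl

lemma rotE_pj {n : E 2} (hn : ‖n‖ = 1) (u : E 2) : pj n (rotE n hn u) = cr n u := by
  change pj n (cr n u + ⟪n, u⟫ • n) = _
  have h0 : ⟪cr n u, n⟫ = 0 := by simp only [inner3, cr0, cr1, cr2]; ring
  unfold pj
  rw [inner_add_left, real_inner_smul_left, h0, inner_self_one hn]; module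

lemma FinV.stB {V : Finset (E 2)} {c : ℝ} (h : FinV V c) :
    4 * π ≤ 2 * sg.real (Cd (V : Set (E 2))) + EV V := by
  let R : E 2 ⊕ Bool → Set (E 2) := fun i => match i with
    | Sum.inl n => {u | cr n u ∈ Cc (V : Set (E 2))}
    | Sum.inr true => Cd (V : Set (E 2))
    | Sum.inr false => (fun u => -u) ⁻¹' (Cd (V : Set (E 2)))
  have a1 : ∀ᵐ u ∂sg, ∀ v ∈ V, ⟪u, v⟫ ≠ 0 := by
    rw [Finset.eventually_all]
    intro v hv
    exact plane_ae (by rintro rfl; simpa using h.unit _ hv)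
  have a2 : ∀ᵐ u ∂sg, ∀ v ∈ V, ∀ β γ : ℝ, u ≠ β • v + γ • v := by
    rw [Finset.eventually_all]
    intro v hv
    exact ae_not_span v v
  have := sg_le_sum (Finset.disjSum (Nn V) Finset.univ) R (Y := Set.univ) (by
    filter_upwards [nrm_sphere_ae, a1, a2] with u hu h1 h2 _
    rcases h.crofton hu h1 h2 with h1 | h1 | ⟨n, hn, h1⟩
    · exact ⟨Sum.inr true, by simp, h1⟩
    · exact ⟨Sum.inr false, by simp, h1⟩
    · exact ⟨Sum.inl n, by simpa using hn, h1⟩)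
  rw [sg_univ, Finset.sum_disjSum, Fintype.sum_bool] at this
  have e1 : ∑ n ∈ Nn V, sg.real (R (Sum.inl n)) = EV V := by
    unfold EV
    apply Finset.sum_congr rfl
    intro n hn
    have e := (mp_isom (rotE n (Nn_mem hn).1)).measure_preimage (Bn_meas (V : Set (E 2)) n).nullMeasurableSet
    rw [measureReal_def, measureReal_def, ← e]
    congr 2
    ext u
    simp only [R, Bn, Set.mem_preimage, Set.mem_ofPred_eq, rotE_pj]
  rw [e1] at this
  simp only [R] at this
  rw [sg_neg (isClosed_Cd _).measurableSet] at this
  linarith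

lemma smul_unit_eq {a b : ℝ} {x y : E 2} (hx : ‖x‖ = 1) (hy : ‖y‖ = 1) (ha : 0 < a) (hb : 0 < b) (h : a • x = b • y) : x = y := by
  have h1 : ‖a • x‖ = ‖b • y‖ := by rw [h]
  rw [norm_smul, norm_smul, hx, hy, Real.norm_of_nonneg ha.le, Real.norm_of_nonneg hb.le, mul_one, mul_one] at h1
  rw [h1] at h
  exact smul_right_injective _ hb.ne' h

lemma FinV.stC {V : Finset (E 2)} {c s : ℝ} (h : FinV V c) (hs : 0 < s) (hcs : c ^ 2 + s ^ 2 = 1) {M : Set (E 2)}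
    (hM1 : ∀ m ∈ M, ‖m‖ = 1) (hM : ∀ m ∈ M, ∀ v ∈ V, c ≤ ⟪m, v⟫) :
    sg.real (Cc (V : Set (E 2))) + c / 2 * EV V + (1 - s) / 2 * XV V ≤ sg.real (PolS M) := by
  have hs1 : s < 1 := by nlinarith [h.pos]
  let R : IX → Set (E 2) := fun i => match i with
    | (Sum.inl _) => Cc (V : Set (E 2))
    | (Sum.inr (Sum.inl n)) => Bn (V : Set (E 2)) n ∩ {u | 0 < ⟪u, n⟫ ∧ ⟪u, n⟫ ≤ c}
    | (Sum.inr (Sum.inr x)) => Bx (V : Set (E 2)) x ∩ {u | s < ⟪u, x⟫}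
  let G : IX → E 2 → E 2 := fun i u => match i with
    | (Sum.inl _) => u
    | (Sum.inr (Sum.inl n)) => pj n u
    | (Sum.inr (Sum.inr x)) => ⟪u, x⟫ • x
  let Q : IX → E 2 → E 2 := fun i u => match i with
    | (Sum.inl _) => 0
    | (Sum.inr (Sum.inl n)) => ⟪u, n⟫ • n
    | (Sum.inr (Sum.inr x)) => pj x u
  have hdata : ∀ u, ∀ i ∈ SX V, u ∈ R i → G i u ∈ Cc (V : Set (E 2)) ∧ Q i u ∈ Cd (V : Set (E 2)) ∧ ⟪Q i u, G i u⟫ = 0 ∧ G i u + Q i u = u := by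
    rintro u (_ | n | x) hi hu
    · refine ⟨hu, ?_, ?_, ?_⟩
      · intro v _; simp [Q]
      · simp [Q]
      · simp [G, Q]
    · have hn : n ∈ Nn V := by simpa [SX] using hi
      obtain ⟨h1, h2, h3⟩ := hu
      refine ⟨h1, Cd_smul (Nn_mem hn).2 h2.le, ?_, ?_⟩
      · simp only [G, Q]
        rw [real_inner_smul_left, real_inner_comm (pj n u) n, pj_inner (Nn_mem hn).1, mul_zero]
      · simp only [G, Q, pj]; abel
    · have hx : x ∈ V := by simpa [SX] using hi
      obtain ⟨h1, h2⟩ := hu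
      refine ⟨Cc_smul (sub_Cc _ hx) (hs.trans h2).le, h1, ?_, ?_⟩
      · simp only [G, Q]
        rw [real_inner_smul_right, pj_inner (h.unit x hx), mul_zero]
      · simp only [G, Q, pj]; abel
  have a2 : ∀ᵐ u ∂sg, ∀ v ∈ V, ∀ β γ : ℝ, u ≠ β • v + γ • v := by
    rw [Finset.eventually_all]
    intro v hv
    exact ae_not_span v v
  have a3 : ∀ᵐ u ∂sg, ∀ v ∈ V, ∀ n ∈ Nn V, ∀ β γ : ℝ, u ≠ β • v + γ • n := by
    rw [Finset.eventually_all]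
    intro v hv
    rw [Finset.eventually_all]
    intro n hn
    exact ae_not_span v n
  have := sum_le_sg (SX V) R (Y := PolS M) (by
    rintro (_ | n | x) hi
    · exact (isClosed_Cc _).measurableSet
    · exact (Bn_meas _ n).inter (ms_slab n c)
    · exact (Bx_meas _ x).inter (measurableSet_lt (by fun_prop) (by fun_prop))) (by
    filter_upwards [a2, a3] with u h2 h3 i hi j hj hui huj
    obtain ⟨b1, b2, b3, b4⟩ := hdata u i hi hui
    obtain ⟨c1, c2, c3, c4⟩ := hdata u j hj huj
    obtain ⟨d1, d2⟩ := moreau_uniq b1 b2 c1 c2 b3 c3 (b4.trans c4.symm)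
    have key1 : ∀ n ∈ Nn V, u ∈ R (Sum.inr (Sum.inl n)) → ⟪u, n⟫ • n ≠ 0 := by
      intro n hn hh h0
      have := hh.2.1
      rcases smul_eq_zero.1 h0 with h0 | h0
      · rw [h0] at this; exact lt_irrefl _ this
      · rw [h0] at this; simp at this
    have key2 : ∀ x ∈ V, pj x u ≠ 0 := by
      intro x hx h0
      apply h2 x hx ⟪u, x⟫ 0
      rw [zero_smul, add_zero]; exact sub_eq_zero.1 h0
    have key3 : ∀ x ∈ V, ∀ n ∈ Nn V, pj n u ≠ ⟪u, x⟫ • x := by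
      intro x hx n hn h0
      apply h3 x hx n hn ⟪u, x⟫ ⟪u, n⟫
      exact sub_eq_iff_eq_add.1 h0
    rcases i with _ | n | x <;> rcases j with _ | n' | x'
    · rfl
    · exact absurd d2.symm (key1 n' (by simpa [SX] using hj) huj)
    · exact absurd d2.symm (key2 x' (by simpa [SX] using hj))
    · exact absurd d2 (key1 n (by simpa [SX] using hi) hui)
    · congr 2
      exact smul_unit_eq (Nn_mem (by simpa [SX] using hi)).1 (Nn_mem (by simpa [SX] using hj)).1 hui.2.1 huj.2.1 d2
    · exact absurd d1 (key3 x' (by simpa [SX] using hj) n (by simpa [SX] using hi))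
    · exact absurd d2 (key2 x (by simpa [SX] using hi))
    · exact absurd d1.symm (key3 x (by simpa [SX] using hi) n' (by simpa [SX] using hj))
    · congr 2
      exact smul_unit_eq (h.unit _ (by simpa [SX] using hi)) (h.unit _ (by simpa [SX] using hj)) (hs.trans hui.2) (hs.trans huj.2) d1) (by
    filter_upwards [nrm_sphere_ae] with u hu i hi hui
    refine ⟨hu, fun m hm => ?_⟩
    obtain ⟨b1, b2, b3, b4⟩ := hdata u i hi hui
    rw [← b4]
    rcases i with _ | n | x
    · have := h.close b1 (hM m hm)
      simp only [G, Q] at this ⊢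
      rw [add_zero]
      have := h.pos
      rw [hu] at *
      linarith
    · have hn := (Nn_mem (V := V) (n := n) (by simpa [SX] using hi)).1
      have hp := pj_norm hn hu
      obtain ⟨-, g1, g2⟩ := hui
      refine h.par hs hcs b1 (hM1 m hm) (hM m hm) b3 ?_ ?_
      · refine le_of_sq_le ?_ (norm_nonneg _)
        simp only [G]; rw [hp]; nlinarith
      · simp only [Q]
        rw [norm_smul, hn, mul_one, Real.norm_of_nonneg g1.le]; exact g2
    · have hn := h.unit x (by simpa [SX] using hi)
      have hp := pj_norm hn hu
      obtain ⟨-, g1⟩ := hui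
      refine h.par hs hcs b1 (hM1 m hm) (hM m hm) b3 ?_ ?_
      · simp only [G]
        rw [norm_smul, hn, mul_one]
        exact g1.le.trans (le_abs_self _)
      · refine le_of_sq_le ?_ h.pos.le
        simp only [Q]; rw [hp]
        have : s < ⟪u, x⟫ := g1
        nlinarith)
  rw [SX_sum] at this
  have e1 : ∑ n ∈ Nn V, sg.real (R (Sum.inr (Sum.inl n))) = c / 2 * EV V := by
    unfold EV
    rw [Finset.mul_sum]
    apply Finset.sum_congr rfl
    intro n hn
    exact height (Nn_mem hn).1 (Bn_cyl (V : Set (E 2)) (Nn_mem hn).1) (Bn_meas _ n) h.pos h.lt1.le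
  have e2 : ∑ x ∈ V, sg.real (R (Sum.inr (Sum.inr x))) = (1 - s) / 2 * XV V := by
    unfold XV
    rw [Finset.mul_sum]
    apply Finset.sum_congr rfl
    intro n hn
    exact height_ge (h.unit n hn) (Bx_cyl (V : Set (E 2)) (h.unit n hn)) (Bx_meas _ n) hs hs1.le
  rw [e1, e2] at this
  simp only [R] at this
  linarith

/-- discrete Steiner type inequality -/
lemma FinV.steiner {V : Finset (E 2)} {c s : ℝ} (h : FinV V c) (hs : 0 < s) (hcs : c ^ 2 + s ^ 2 = 1) {M : Set (E 2)}
    (hM1 : ∀ m ∈ M, ‖m‖ = 1) (hM : ∀ m ∈ M, ∀ v ∈ V, c ≤ ⟪m, v⟫) :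
    s * sg.real (Cc (V : Set (E 2))) + c * (2 * π - sg.real (Cd (V : Set (E 2)))) + (1 - s) * 2 * π ≤ sg.real (PolS M) := by
  have hs1 : s < 1 := by nlinarith [h.pos]
  have hcs1 : 1 ≤ c + s := by nlinarith [h.pos, h.lt1]
  have A := h.stA
  have B := h.stB
  have C := h.stC hs hcs hM1 hM
  nlinarith [mul_nonneg (sub_nonneg.2 hs1.le) (sub_nonneg.2 A), mul_nonneg (sub_nonneg.2 hcs1) (sub_nonneg.2 B)]

lemma sg_Cd (V : Set (E 2)) : sg.real (Cd V) = sg.real (PolS V) := by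
  rw [← sg_neg (isClosed_Cd V).measurableSet]
  apply measureReal_congr
  rw [Filter.eventuallyEq_set]
  filter_upwards [nrm_sphere_ae] with u hu
  simp only [Set.mem_preimage, Cd, PolS, Set.mem_ofPred_eq, inner_neg_left, hu, true_and, real_inner_comm u]
  simp
end PalAux

/-! Part P4d -/

namespace PalAux

lemma Cd_anti {V W : Set (E 2)} (h : V ⊆ W) : Cd W ⊆ Cd V := fun _ hq v hv => hq v (h hv)
lemma Cc_mono {V W : Set (E 2)} (h : V ⊆ W) : Cc V ⊆ Cc W := fun _ hu q hq => hu q (Cd_anti h hq)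

lemma Cc_convex (V : Set (E 2)) : Convex ℝ (Cc V) := by
  intro x hx y hy a b ha hb _
  exact Cc_add (Cc_smul hx ha) (Cc_smul hy hb)

lemma Cc_nrm {V : Set (E 2)} {u : E 2} (hu : u ≠ 0) : nrm u ∈ Cc V ↔ u ∈ Cc V := by
  constructor
  · intro h
    have := Cc_smul h (norm_nonneg u)
    rwa [norm_smul_nrm] at this
  · intro h; exact Cc_smul h (inv_nonneg.2 (norm_nonneg u))

lemma Cc_limit {M : Set (E 2)} (V : ℕ → Set (E 2)) (hmono : Monotone V)
    (hlim : ∀ q, (∀ n, q ∈ Cd (V n)) → q ∈ Cd M) : interior (Cc M) ⊆ ⋃ n, Cc (V n) := by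
  intro u hu
  by_contra hcon
  simp only [Set.mem_iUnion, not_exists] at hcon
  let Q : ℕ → Set (E 2) := fun n => Metric.sphere 0 1 ∩ Cd (V n) ∩ {q | 0 ≤ ⟪q, u⟫}
  have hcl : IsClosed {q : E 2 | 0 ≤ ⟪q, u⟫} := isClosed_le continuous_const (by fun_prop)
  have hcp : ∀ n, IsCompact (Q n) := fun n =>
    ((isCompact_sphere (0 : E 2) 1).inter_right (isClosed_Cd _)).inter_right hcl
  have hne : ∀ n, (Q n).Nonempty := by
    intro n
    have := hcon n
    simp only [Cc, Set.mem_ofPred_eq, not_forall, not_le] at this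
    obtain ⟨q, hq, hqu⟩ := this
    have hq0 : q ≠ 0 := by rintro rfl; simp at hqu
    refine ⟨nrm q, ⟨by simpa using norm_nrm hq0, Cd_smul hq (inv_nonneg.2 (norm_nonneg _))⟩, ?_⟩
    simp only [Set.mem_ofPred_eq, nrm, real_inner_smul_left]
    positivity
  have hdec : ∀ n, Q (n + 1) ⊆ Q n := by
    intro n q hq
    exact ⟨⟨hq.1.1, Cd_anti (hmono (Nat.le_succ n)) hq.1.2⟩, hq.2⟩
  obtain ⟨q, hq⟩ := IsCompact.nonempty_iInter_of_sequence_nonempty_isCompact_isClosed Q hdec hne (hcp 0) (fun n => (hcp n).isClosed)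
  rw [Set.mem_iInter] at hq
  have hqM := hlim q (fun n => (hq n).1.2)
  have hq1 : ‖q‖ = 1 := by simpa using (hq 0).1.1
  have hqu : 0 ≤ ⟪q, u⟫ := (hq 0).2
  rw [mem_interior_iff_mem_nhds, Metric.mem_nhds_iff] at hu
  obtain ⟨ε, hε, hb⟩ := hu
  have h1 : u + (ε / 2) • q ∈ Cc M := by
    apply hb
    rw [mem_ball_iff_norm, add_sub_cancel_left, norm_smul, hq1, mul_one, Real.norm_of_nonneg (by positivity)]
    linarith
  have := h1 q hqM
  rw [inner_add_right, real_inner_smul_right, inner_self_one hq1] at this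
  linarith

lemma sg_Cc_limit {M : Set (E 2)} (V : ℕ → Set (E 2)) (hmono : Monotone V)
    (hlim : ∀ q, (∀ n, q ∈ Cd (V n)) → q ∈ Cd M) : sg (Cc M) ≤ sg (⋃ n, Cc (V n)) := by
  apply measure_mono_ae
  have hm : MeasurableSet (Cc M \ ⋃ n, Cc (V n)) := (isClosed_Cc _).measurableSet.diff
    (MeasurableSet.iUnion (fun n => (isClosed_Cc _).measurableSet))
  have h0 : sg (Cc M \ ⋃ n, Cc (V n)) = 0 := by
    rw [sg_apply hm]
    have : volume (nrm ⁻¹' (Cc M \ ⋃ n, Cc (V n)) ∩ Metric.ball 0 1) = 0 := by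
      refine measure_mono_null (t := frontier (Cc M) ∪ {0}) ?_ ?_
      · rintro u ⟨⟨h1, h2⟩, -⟩
        by_cases hu : u = 0
        · right; exact hu
        · left
          rw [Cc_nrm hu] at h1
          refine ⟨subset_closure h1, fun hi => h2 ?_⟩
          have := Cc_limit V hmono hlim hi
          rw [Set.mem_iUnion] at this ⊢
          obtain ⟨n, hn⟩ := this
          exact ⟨n, (Cc_nrm hu).2 hn⟩
      · rw [measure_union_null_iff]
        exact ⟨(Cc_convex M).addHaar_frontier volume, by simp⟩
    rw [this, mul_zero]
  have : ∀ᵐ u ∂sg, u ∉ Cc M \ ⋃ n, Cc (V n) := by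
    rw [ae_iff]; simp only [not_not]; exact h0
  filter_upwards [this] with u hu h1
  by_contra h2
  exact hu ⟨h1, h2⟩

theorem steiner {M : Set (E 2)} {c s : ℝ} (hne : M.Nonempty) (hc : 0 < c) (hc1 : c < 1) (hs : 0 < s) (hcs : c ^ 2 + s ^ 2 = 1)
    (hM1 : ∀ m ∈ M, ‖m‖ = 1) (hM : ∀ m ∈ M, ∀ v ∈ M, c ≤ ⟪m, v⟫) :
    s * sg.real M + 2 * π * (1 + c - s) ≤ (1 + c) * sg.real (PolS M) := by
  classical
  have : Nonempty M := hne.to_subtype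
  obtain ⟨d, hd⟩ := TopologicalSpace.exists_dense_seq M
  let V : ℕ → Finset (E 2) := fun n => (Finset.range (n + 1)).image (fun k => (d k : E 2))
  have hVM : ∀ n, ∀ v ∈ V n, v ∈ M := by
    intro n v hv
    obtain ⟨k, -, rfl⟩ := Finset.mem_image.1 hv
    exact (d k).2
  have hmono : Monotone (fun n => (V n : Set (E 2))) := by
    intro a b hab
    simp only [V, Finset.coe_image]
    apply Set.image_mono
    intro k hk
    simp at hk ⊢; omega
  have hlim : ∀ q, (∀ n, q ∈ Cd (V n : Set (E 2))) → q ∈ Cd M := by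
    intro q hq v hv
    have hcl : IsClosed {m : M | ⟪q, (m : E 2)⟫ ≤ 0} := isClosed_le (by fun_prop) continuous_const
    have : Set.range d ⊆ {m : M | ⟪q, (m : E 2)⟫ ≤ 0} := by
      rintro _ ⟨k, rfl⟩
      exact hq k (d k) (by simp [V]; exact ⟨k, le_rfl, rfl⟩)
    have h2 := hcl.closure_subset_iff.2 this
    rw [hd.closure_range] at h2
    exact h2 (Set.mem_univ (⟨v, hv⟩ : M))
  have hF : ∀ n, FinV (V n) c := fun n =>
    { ne := ⟨d 0, by simp only [V]; exact Finset.mem_image.2 ⟨0, by simp, rfl⟩⟩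
      pos := hc
      lt1 := hc1
      unit := fun v hv => hM1 v (hVM n v hv)
      inn := fun v hv w hw => hM v (hVM n v hv) w (hVM n w hw) }
  have hst := fun n => (hF n).steiner hs hcs hM1 (fun m hm v hv => hM m hm v (hVM n v hv))
  have hCdeq : Cd M = ⋂ n, Cd (V n : Set (E 2)) := by
    apply subset_antisymm
    · exact Set.subset_iInter (fun n => Cd_anti (hVM n))
    · intro q hq; rw [Set.mem_iInter] at hq; exact hlim q hq
  have t1 : Filter.Tendsto (fun n => sg.real (Cd (V n : Set (E 2)))) Filter.atTop (nhds (sg.real (Cd M))) := by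
    rw [hCdeq]
    refine (ENNReal.tendsto_toReal (measure_ne_top _ _)).comp ?_
    exact tendsto_measure_iInter_atTop (fun n => (isClosed_Cd _).measurableSet.nullMeasurableSet)
      (fun a b hab => Cd_anti (hmono hab)) ⟨0, measure_ne_top _ _⟩
  have t2 : Filter.Tendsto (fun n => sg.real (Cc (V n : Set (E 2)))) Filter.atTop (nhds (sg.real (⋃ n, Cc (V n : Set (E 2))))) := by
    refine (ENNReal.tendsto_toReal (measure_ne_top _ _)).comp ?_
    exact tendsto_measure_iUnion_atTop (fun a b hab => Cc_mono (hmono hab))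
  have t3 := ((t2.const_mul s).add ((t1.const_sub (2 * π)).const_mul c)).add_const ((1 - s) * 2 * π)
  have h1 := le_of_tendsto' t3 hst
  have h2 : sg.real M ≤ sg.real (⋃ n, Cc (V n : Set (E 2))) :=
    ENNReal.toReal_mono (measure_ne_top _ _) ((measure_mono (sub_Cc M)).trans (sg_Cc_limit _ hmono hlim))
  rw [sg_Cd] at h1
  nlinarith
end PalAux

/-! Part P5a -/

namespace PalAux

structure Iso (p m v : E 2) (k c : ℝ) : Prop where
  hp : ‖p‖ = 1
  hm : ‖m‖ = 1
  hv : ‖v‖ = 1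
  pm : ⟪p, m⟫ = k
  pv : ⟪p, v⟫ = k
  mv : ⟪m, v⟫ = c

def psi (k c : ℝ) : ℝ := Real.arccos ((c - k ^ 2) / (1 - k ^ 2))
def bet (k c : ℝ) : ℝ := Real.arccos (k * (1 - c) / (√(1 - k ^ 2) * √(1 - c ^ 2)))

lemma Iso.LI {p m v : E 2} {k c : ℝ} (h : Iso p m v k c) (hc1 : c < 1) (hk : 2 * k ^ 2 < 1 + c) : LI3 v p m := by
  intro γ α β h0
  have e : ∀ w : E 2, γ * ⟪v, w⟫ + α * ⟪p, w⟫ + β * ⟪m, w⟫ = 0 := by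
    intro w
    have := congrArg (fun z => ⟪z, w⟫) h0
    simpa only [inner_add_left, real_inner_smul_left, inner_zero_left] using this
  have e1 := e p
  have e2 := e m
  have e3 := e v
  rw [real_inner_comm, h.pv, inner_self_one h.hp, real_inner_comm, h.pm] at e1
  rw [real_inner_comm, h.mv, h.pm, inner_self_one h.hm] at e2
  rw [inner_self_one h.hv, h.pv, h.mv] at e3
  have h1 : β = γ := by
    have : (β - γ) * (1 - c) = 0 := by linarith
    rcases mul_eq_zero.1 this with h | h <;> linarith
  subst h1
  have h2 : α = -2 * k * β := by linarith
  subst h2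
  have h3 : β = 0 := by
    have : β * (1 + c - 2 * k ^ 2) = 0 := by linarith
    rcases mul_eq_zero.1 this with h | h
    · exact h
    · linarith
  subst h3; simp

def Hc (p m v : E 2) (c : ℝ) : Set (E 2) := Oct p m (-v) ∩ {u | c < ⟪u, v⟫}

lemma Iso.LI' {p m v : E 2} {k c : ℝ} (h : Iso p m v k c) (hc1 : c < 1) (hk : 2 * k ^ 2 < 1 + c) : LI3 p m (-v) :=
  (h.LI hc1 hk).neg1.rot

lemma Iso.meas {p m v : E 2} {k c : ℝ} (h : Iso p m v k c) (hc1 : c < 1) (hk : 2 * k ^ 2 < 1 + c) :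
    MeasurableSet (Hc p m v c) :=
  (measurableSet_oct h.hp h.hm (h.LI' hc1 hk)).inter (measurableSet_lt (by fun_prop) (by fun_prop))

lemma Iso.area {p m v : E 2} {k c : ℝ} (h : Iso p m v k c) (hc : 0 < c) (hc1 : c < 1) (hk : 2 * k ^ 2 < 1 + c) :
    (1 - c) * bet k c - (psi k c + 2 * bet k c - π) ≤ sg.real (Hc p m v c) := by
  have hLI := h.LI hc1 hk
  have hk1 : 0 < 1 - k ^ 2 := by nlinarith
  have a1 : sangle p v m = bet k c := by
    rw [sangle_eq h.hp h.hv h.hm, h.pm, real_inner_comm, h.pv, real_inner_comm, h.mv, bet]; congr 1; ring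
  have a2 : sangle v m p = bet k c := by
    rw [sangle_eq h.hv h.hm h.hp, h.mv, real_inner_comm, h.pv, real_inner_comm, h.pm, bet]; congr 1; ring
  have a3 : sangle m p v = psi k c := by
    rw [sangle_eq h.hm h.hp h.hv, h.mv, h.pv, h.pm, psi, Real.mul_self_sqrt hk1.le]; congr 1; ring
  have g := girard h.hv h.hp h.hm hLI
  have l := lune_gt h.hv hLI hc hc1.le
  rw [a1, a2, a3] at g
  rw [a1] at l
  have : sg.real (Lune v p m ∩ {u | c < ⟪u, v⟫}) ≤ sg.real (Hc p m v c ∪ Oct v p m) := by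
    apply real_le_of_ae
    filter_upwards [ae_not_span p m] with u hu
    rintro ⟨⟨α, β, γ, h1, h2, h3⟩, h4⟩
    rcases lt_trichotomy γ 0 with hγ | hγ | hγ
    · left
      exact ⟨⟨α, β, -γ, h1, h2, by linarith, by rw [h3]; module⟩, h4⟩
    · rw [hγ, zero_smul, add_zero] at h3
      exact absurd h3 (hu α β)
    · right
      exact ⟨γ, α, β, hγ, h1, h2, by rw [h3]; module⟩
  have := this.trans (measureReal_union_le _ _)
  linarith

/-- lune around `p` -/
lemma Iso.lune {p m v : E 2} {k c : ℝ} (h : Iso p m v k c) (hc1 : c < 1) (hk : 2 * k ^ 2 < 1 + c) {t : ℝ} (ht : 0 < t) (ht1 : t ≤ 1) :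
    sg.real (Lune p m (-v) ∩ {u | t < ⟪u, p⟫}) = (1 - t) * (π - psi k c) := by
  have hk1 : 0 < 1 - k ^ 2 := by nlinarith
  rw [lune_gt h.hp (h.LI' hc1 hk) ht ht1]
  have a3 : sangle v p m = psi k c := by
    rw [sangle_comm, sangle_eq h.hm h.hp h.hv, h.mv, h.pv, h.pm, psi, Real.mul_self_sqrt hk1.le]; congr 1; ring
  rw [sangle_comm, sangle_neg, a3]

lemma Hc_sub_lune (p m v : E 2) (c : ℝ) : Hc p m v c ⊆ Lune p m (-v) := by
  rintro u ⟨⟨α, β, γ, h1, h2, h3, rfl⟩, -⟩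
  exact ⟨β, γ, α, h2, h3, by abel⟩

def Compl (M : Set (E 2)) (c : ℝ) : Prop := ∀ x : E 2, x ∈ M ↔ ‖x‖ = 1 ∧ ∀ y ∈ M, c ≤ ⟪x, y⟫

lemma Compl.unit {M : Set (E 2)} {c : ℝ} (h : Compl M c) {x : E 2} (hx : x ∈ M) : ‖x‖ = 1 := ((h x).1 hx).1
lemma Compl.inn {M : Set (E 2)} {c : ℝ} (h : Compl M c) {x y : E 2} (hx : x ∈ M) (hy : y ∈ M) : c ≤ ⟪x, y⟫ := ((h x).1 hx).2 y hy

lemma Iso.Hc_sub {p m v : E 2} {k c : ℝ} (h : Iso p m v k c) {M : Set (E 2)} (hM : Compl M c) (hm : m ∈ M)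
    (hp : ∀ y ∈ M, k ≤ ⟪p, y⟫) {u : E 2} (hu : ‖u‖ = 1) (hH : u ∈ Hc p m v c) : u ∈ M := by
  obtain ⟨⟨α, β, γ, h1, h2, h3, rfl⟩, h4⟩ := hH
  rw [hM]
  refine ⟨hu, fun y hy => ?_⟩
  simp only [Set.mem_ofPred_eq, inner_add_left, real_inner_smul_left, inner_neg_left, h.pv, h.mv, inner_self_one h.hv] at h4
  simp only [inner_add_left, real_inner_smul_left, inner_neg_left]
  have b1 := mul_le_mul_of_nonneg_left (hp y hy) h1.le
  have b2 := mul_le_mul_of_nonneg_left (hM.inn hm hy) h2.le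
  have b3 := mul_le_mul_of_nonneg_left (inner_le1 (hM.unit hy) h.hv) h3.le
  nlinarith

/-- spherical triangle inequality -/
lemma inner_ge {p x y : E 2} (hp : ‖p‖ = 1) (hx : ‖x‖ = 1) (hy : ‖y‖ = 1) {a b a' b' : ℝ} (ha : a ≤ ⟪x, p⟫) (hb : b ≤ ⟪y, p⟫)
    (ha0 : 0 ≤ a) (hb0 : 0 ≤ b) (ha' : 0 ≤ a') (hb' : 0 ≤ b') (haa : a ^ 2 + a' ^ 2 = 1) (hbb : b ^ 2 + b' ^ 2 = 1) :
    a * b - a' * b' ≤ ⟪x, y⟫ := by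
  have e : ⟪x, y⟫ = ⟪x, p⟫ * ⟪y, p⟫ + ⟪pj p x, pj p y⟫ := by
    simp only [pj, inner_sub_left, inner_sub_right, real_inner_smul_left, real_inner_smul_right, inner_self_one hp, real_inner_comm y p]
    ring
  have h1 := pj_norm hp hx
  have h2 := pj_norm hp hy
  have h3 : ‖pj p x‖ ≤ a' := le_of_sq_le (by nlinarith) ha'
  have h4 : ‖pj p y‖ ≤ b' := le_of_sq_le (by nlinarith) hb'
  have h5 := (abs_le.1 (abs_real_inner_le_norm (pj p x) (pj p y))).1
  have h6 := mul_le_mul h3 h4 (norm_nonneg _) ha'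
  have h7 := mul_le_mul ha hb hb0 (ha0.trans ha)
  linarith

end PalAux

/-! Part P5b -/

namespace PalAux

lemma ang_key {q s X2 Y2 X3 Y3 l1 l2 l3 : ℝ} (hq1 : -1 < q) (hq0 : q < 0) (hs : 0 < s) (hqs : q ^ 2 + s ^ 2 = 1)
    (h2 : X2 ^ 2 + Y2 ^ 2 = 1) (h3 : X3 ^ 2 + Y3 ^ 2 = 1) (hY2 : 0 < Y2) (hY3 : Y3 < 0)
    (l1p : 0 < l1) (l2p : 0 < l2) (lX : l1 + l2 * X2 + l3 * X3 = 0) (lY : l2 * Y2 + l3 * Y3 = 0)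
    (q2 : q ≤ X2) (q23 : q ≤ X2 * X3 + Y2 * Y3) : q ≤ q * X3 + s * Y3 := by
  obtain ⟨θ, ⟨hθ0, hθπ⟩, hcθ⟩ : ∃ θ, (0 ≤ θ ∧ θ ≤ π) ∧ Real.cos θ = X2 :=
    ⟨Real.arccos X2, ⟨Real.arccos_nonneg _, Real.arccos_le_pi _⟩, Real.cos_arccos (by nlinarith) (by nlinarith)⟩
  obtain ⟨φ, ⟨hφ0, hφπ⟩, hcφ⟩ : ∃ θ, (0 ≤ θ ∧ θ ≤ π) ∧ Real.cos θ = X3 :=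
    ⟨Real.arccos X3, ⟨Real.arccos_nonneg _, Real.arccos_le_pi _⟩, Real.cos_arccos (by nlinarith) (by nlinarith)⟩
  obtain ⟨ψ, ⟨hψ0, hψπ⟩, hcψ⟩ : ∃ θ, (0 ≤ θ ∧ θ ≤ π) ∧ Real.cos θ = q :=
    ⟨Real.arccos q, ⟨Real.arccos_nonneg _, Real.arccos_le_pi _⟩, Real.cos_arccos (by nlinarith) (by nlinarith)⟩
  have sθ : Real.sin θ = Y2 := by
    have := Real.sin_nonneg_of_nonneg_of_le_pi hθ0 hθπ
    have h := Real.sin_sq_add_cos_sq θ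
    rw [hcθ] at h
    exact (pow_left_inj₀ this hY2.le two_ne_zero).1 (by linarith)
  have sφ : Real.sin φ = -Y3 := by
    have := Real.sin_nonneg_of_nonneg_of_le_pi hφ0 hφπ
    have h := Real.sin_sq_add_cos_sq φ
    rw [hcφ] at h
    exact (pow_left_inj₀ this (by linarith) two_ne_zero).1 (by rw [neg_sq]; linarith)
  have sψ : Real.sin ψ = s := by
    have := Real.sin_nonneg_of_nonneg_of_le_pi hψ0 hψπ
    have h := Real.sin_sq_add_cos_sq ψ
    rw [hcψ] at h
    exact (pow_left_inj₀ this hs.le two_ne_zero).1 (by linarith)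
  have hneg : Real.sin (θ + φ) < 0 := by
    rw [Real.sin_add, hcθ, hcφ, sθ, sφ]
    have : l2 * (Y2 * X3 + X2 * -Y3) = l1 * Y3 := by linear_combination X3 * lY - Y3 * lX
    have h' : l1 * Y3 < 0 := mul_neg_of_pos_of_neg l1p hY3
    by_contra hcon
    push Not at hcon
    nlinarith [mul_nonneg l2p.le hcon]
  have hge : π < θ + φ := by
    by_contra hcon
    push Not at hcon
    linarith [Real.sin_nonneg_of_nonneg_of_le_pi (by linarith : 0 ≤ θ + φ) hcon]
  have hθψ : θ ≤ ψ := by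
    by_contra hcon
    push Not at hcon
    have := Real.cos_lt_cos_of_nonneg_of_le_pi hψ0 hθπ hcon
    linarith
  have h23 : 2 * π - (θ + φ) ≤ ψ := by
    by_contra hcon
    push Not at hcon
    have := Real.cos_lt_cos_of_nonneg_of_le_pi hψ0 (by linarith) hcon
    rw [Real.cos_two_pi_sub, Real.cos_add, hcθ, hcφ, sθ, sφ] at this
    linarith
  have : Real.cos ψ ≤ Real.cos (2 * π - (ψ + φ)) :=
    Real.cos_le_cos_of_nonneg_of_le_pi (by linarith) hψπ (by linarith)
  rw [Real.cos_two_pi_sub, Real.cos_add, hcψ, hcφ, sψ, sφ] at this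
  linarith

lemma ang_all {q s X2 Y2 X3 Y3 l1 l2 l3 : ℝ} (hq1 : -1 < q) (hq0 : q < 0) (hs : 0 < s) (hqs : q ^ 2 + s ^ 2 = 1)
    (h2 : X2 ^ 2 + Y2 ^ 2 = 1) (h3 : X3 ^ 2 + Y3 ^ 2 = 1) (hY2 : Y2 ≠ 0)
    (l1p : 0 < l1) (l2p : 0 < l2) (l3p : 0 < l3) (lX : l1 + l2 * X2 + l3 * X3 = 0) (lY : l2 * Y2 + l3 * Y3 = 0)
    (q2 : q ≤ X2) (q3 : q ≤ X3) (q23 : q ≤ X2 * X3 + Y2 * Y3) :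
    (q ≤ q * X2 + s * Y2 ∧ q ≤ q * X3 + s * Y3) ∧ (q ≤ q * X2 - s * Y2 ∧ q ≤ q * X3 - s * Y3) := by
  have x2 : X2 ≤ 1 := by nlinarith
  have x3 : X3 ≤ 1 := by nlinarith
  have b2 : q ≤ q * X2 := by nlinarith
  have b3 : q ≤ q * X3 := by nlinarith
  rcases lt_or_gt_of_ne hY2 with hY | hY
  · have hY3 : 0 < Y3 := by
      by_contra hcon
      push Not at hcon
      nlinarith [mul_neg_of_pos_of_neg l2p hY, mul_nonneg l3p.le (neg_nonneg.2 hcon)]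
    have c1 := ang_key hq1 hq0 hs hqs h3 h2 hY3 hY l1p l3p (l3 := l2) (by linarith) (by linarith) q3 (by linarith)
    have c2 := ang_key hq1 hq0 hs hqs (X2 := X2) (Y2 := -Y2) (X3 := X3) (Y3 := -Y3) (by rw [neg_sq]; exact h2) (by rw [neg_sq]; exact h3)
      (by linarith) (by linarith) l1p l2p (l3 := l3) (by linarith) (by linarith) q2 (by linarith)
    refine ⟨⟨c1, ?_⟩, ?_, ?_⟩
    · nlinarith [mul_pos hs hY3]
    · nlinarith [mul_pos hs (neg_pos.2 hY)]
    · linarith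
  · have hY3 : Y3 < 0 := by
      by_contra hcon
      push Not at hcon
      nlinarith [mul_pos l2p hY, mul_nonneg l3p.le hcon]
    have c1 := ang_key hq1 hq0 hs hqs h2 h3 hY hY3 l1p l2p (l3 := l3) (by linarith) (by linarith) q2 (by linarith)
    have c2 := ang_key hq1 hq0 hs hqs (X2 := X3) (Y2 := -Y3) (X3 := X2) (Y3 := -Y2) (by rw [neg_sq]; exact h3) (by rw [neg_sq]; exact h2)
      (by linarith) (by linarith) l1p l3p (l3 := l2) (by linarith) (by linarith) q3 (by linarith)
    refine ⟨⟨?_, c1⟩, ?_, ?_⟩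
    · nlinarith [mul_pos hs hY]
    · linarith
    · nlinarith [mul_pos hs (neg_pos.2 hY3)]

structure Ctc (p m1 m2 m3 : E 2) (k c l1 l2 l3 : ℝ) : Prop where
  hp : ‖p‖ = 1
  h1 : ‖m1‖ = 1
  h2 : ‖m2‖ = 1
  h3 : ‖m3‖ = 1
  p1 : ⟪p, m1⟫ = k
  p2 : ⟪p, m2⟫ = k
  p3 : ⟪p, m3⟫ = k
  c12 : c ≤ ⟪m1, m2⟫
  c13 : c ≤ ⟪m1, m3⟫
  c23 : c ≤ ⟪m2, m3⟫
  l1p : 0 < l1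
  l2p : 0 < l2
  l3p : 0 < l3
  ls : l1 + l2 + l3 = 1
  eq : k • p = l1 • m1 + l2 • m2 + l3 • m3
  LI : LI3 m1 m2 m3
  k0 : 0 < k

lemma Ctc.rot {p m1 m2 m3 : E 2} {k c l1 l2 l3 : ℝ} (h : Ctc p m1 m2 m3 k c l1 l2 l3) : Ctc p m2 m3 m1 k c l2 l3 l1 :=
  ⟨h.hp, h.h2, h.h3, h.h1, h.p2, h.p3, h.p1, h.c23, by rw [real_inner_comm]; exact h.c12, by rw [real_inner_comm]; exact h.c13,
    h.l2p, h.l3p, h.l1p, by linarith [h.ls], by rw [h.eq]; abel, h.LI.rot, h.k0⟩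

lemma Ctc.ksq {p m1 m2 m3 : E 2} {k c l1 l2 l3 : ℝ} (h : Ctc p m1 m2 m3 k c l1 l2 l3) :
    k ^ 2 = l1 ^ 2 + l2 ^ 2 + l3 ^ 2 + 2 * (l1 * l2 * ⟪m1, m2⟫ + l1 * l3 * ⟪m1, m3⟫ + l2 * l3 * ⟪m2, m3⟫) := by
  have : ⟪k • p, k • p⟫ = k ^ 2 := by
    rw [real_inner_smul_left, real_inner_smul_right, inner_self_one h.hp]; ring
  rw [← this, h.eq]
  simp only [inner_add_left, inner_add_right, real_inner_smul_left, real_inner_smul_right, inner_self_one h.h1, inner_self_one h.h2, inner_self_one h.h3,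
    real_inner_comm m1 m2, real_inner_comm m1 m3, real_inner_comm m2 m3]
  ring

lemma Ctc.jung {p m1 m2 m3 : E 2} {k c l1 l2 l3 : ℝ} (h : Ctc p m1 m2 m3 k c l1 l2 l3) (hc1 : c < 1) :
    (1 + 2 * c) / 3 ≤ k ^ 2 := by
  rw [h.ksq]
  have b1 := mul_le_mul_of_nonneg_left h.c12 (mul_pos h.l1p h.l2p).le
  have b2 := mul_le_mul_of_nonneg_left h.c13 (mul_pos h.l1p h.l3p).le
  have b3 := mul_le_mul_of_nonneg_left h.c23 (mul_pos h.l2p h.l3p).le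
  have hl : l3 = 1 - l1 - l2 := by linarith [h.ls]
  have : (1 - c) * (1 / 3) ≤ (1 - c) * (l1 ^ 2 + l2 ^ 2 + l3 ^ 2) := by
    apply mul_le_mul_of_nonneg_left _ (by linarith)
    subst hl
    nlinarith [sq_nonneg (l1 - l2), sq_nonneg (2 * l1 + l2 - 1), sq_nonneg (2 * l2 + l1 - 1)]
  have e : l1 ^ 2 + l2 ^ 2 + l3 ^ 2 + 2 * (l1 * l2 * c + l1 * l3 * c + l2 * l3 * c) = (1 - c) * (l1 ^ 2 + l2 ^ 2 + l3 ^ 2) + c := by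
    subst hl; ring
  linarith

end PalAux

/-! Part P5c -/

namespace PalAux

lemma gram2 (a b p m : E 2) : ⟪a, cr p m⟫ * ⟪b, cr p m⟫ =
    ⟪a, b⟫ * (⟪p, p⟫ * ⟪m, m⟫ - ⟪p, m⟫ ^ 2) - ⟪a, p⟫ * (⟪b, p⟫ * ⟪m, m⟫ - ⟪b, m⟫ * ⟪p, m⟫)
     + ⟪a, m⟫ * (⟪b, p⟫ * ⟪p, m⟫ - ⟪b, m⟫ * ⟪p, p⟫) := by
  simp only [inner3, cr0, cr1, cr2]; ring

/-- data of the two auxiliary points for the contact point `m1`. -/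
lemma Ctc.vdata {p m1 m2 m3 : E 2} {k c l1 l2 l3 : ℝ} (h : Ctc p m1 m2 m3 k c l1 l2 l3) (hc : 0 < c) (hc1 : c < 1)
    (hk : 2 * k ^ 2 < 1 + c) : ∃ v : Bool → E 2, (∀ b, Iso p m1 (v b) k c ∧ c ≤ ⟪v b, m2⟫ ∧ c ≤ ⟪v b, m3⟫) ∧
      0 < ⟪v true, cr p m1⟫ ∧ ⟪v false, cr p m1⟫ < 0 := by
  have hj := h.jung hc1
  have hk1 : 0 < 1 - k ^ 2 := by nlinarith
  obtain ⟨t, ht⟩ : ∃ t, t = 1 - k ^ 2 := ⟨_, rfl⟩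
  have ht0 : 0 < t := ht ▸ hk1
  obtain ⟨q, hq⟩ : ∃ q, q = (c - k ^ 2) / t := ⟨_, rfl⟩
  have hqt : q * t = c - k ^ 2 := by rw [hq]; field_simp
  have hq0 : q < 0 := by rw [hq]; apply div_neg_of_neg_of_pos _ ht0; nlinarith
  have hq1 : -1 < q := by rw [hq, lt_div_iff₀ ht0]; linarith
  obtain ⟨s, hs⟩ : ∃ s, s = √(1 - q ^ 2) := ⟨_, rfl⟩
  have hs2 : s ^ 2 = 1 - q ^ 2 := by rw [hs, Real.sq_sqrt (by nlinarith)]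
  have hs0 : 0 < s := by rw [hs]; apply Real.sqrt_pos.2; nlinarith
  have pp := inner_self_one h.hp
  have mm := inner_self_one h.h1
  have fp : ⟪p, cr p m1⟫ = 0 := by rw [real_inner_comm, cr_self_left]
  have fm : ⟪m1, cr p m1⟫ = 0 := by rw [real_inner_comm, cr_self_right]
  have ff : ⟪cr p m1, cr p m1⟫ = t := by rw [← binet, pp, mm, real_inner_comm p m1, h.p1, ht]; ring
  have c21 : c ≤ ⟪m2, m1⟫ := by rw [real_inner_comm]; exact h.c12
  have c31 : c ≤ ⟪m3, m1⟫ := by rw [real_inner_comm]; exact h.c13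
  have p2' : ⟪m2, p⟫ = k := by rw [real_inner_comm]; exact h.p2
  have p3' : ⟪m3, p⟫ = k := by rw [real_inner_comm]; exact h.p3
  have p1' : ⟪m1, p⟫ = k := by rw [real_inner_comm]; exact h.p1
  have g22 := gram2 m2 m2 p m1
  have g33 := gram2 m3 m3 p m1
  have g23 := gram2 m2 m3 p m1
  rw [pp, mm, h.p1, p2', inner_self_one h.h2] at g22
  rw [pp, mm, h.p1, p3', inner_self_one h.h3] at g33
  rw [pp, mm, h.p1, p2', p3'] at g23
  have E0 : ∀ w, l1 * ⟪m1, w⟫ + l2 * ⟪m2, w⟫ + l3 * ⟪m3, w⟫ = k * ⟪p, w⟫ := by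
    intro w
    have := congrArg (fun z => ⟪z, w⟫) h.eq
    simp only [inner_add_left, real_inner_smul_left] at this
    linarith
  have E1 := E0 m1
  have E2 := E0 (cr p m1)
  rw [mm, h.p1] at E1
  rw [fm, fp] at E2
  have hY2 : ⟪m2, cr p m1⟫ ≠ 0 := by
    intro h0
    have h3 : ⟪m3, cr p m1⟫ = 0 := by
      rw [h0] at E2
      have : l3 * ⟪m3, cr p m1⟫ = 0 := by linarith
      rcases mul_eq_zero.1 this with h' | h'
      · exact absurd h' h.l3p.ne'
      · exact h'
    obtain ⟨α, β, γ, e⟩ := h.LI.span (cr p m1)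
    have : ⟪cr p m1, cr p m1⟫ = 0 := by
      have e' := congrArg (fun z => ⟪z, cr p m1⟫) e
      simp only [inner_add_left, real_inner_smul_left, fm, h0, h3] at e'
      linarith
    linarith
  obtain ⟨x2, hx2⟩ : ∃ x, x = ⟪m2, m1⟫ := ⟨_, rfl⟩
  obtain ⟨x3, hx3⟩ : ∃ x, x = ⟪m3, m1⟫ := ⟨_, rfl⟩
  obtain ⟨y2, hy2⟩ : ∃ x, x = ⟪m2, cr p m1⟫ := ⟨_, rfl⟩
  obtain ⟨y3, hy3⟩ : ∃ x, x = ⟪m3, cr p m1⟫ := ⟨_, rfl⟩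
  have hc23 := h.c23
  rw [← hx2] at g22 g23 E1 c21
  rw [← hx3] at g33 g23 E1 c31
  rw [← hy2] at g22 g23 E2 hY2
  rw [← hy3] at g33 g23 E2
  have key := ang_all (X2 := (x2 - k ^ 2) / t) (Y2 := y2 / t) (X3 := (x3 - k ^ 2) / t) (Y3 := y3 / t) hq1 hq0 hs0 (by linarith)
    (by
      have : (x2 - k ^ 2) ^ 2 + y2 ^ 2 = t ^ 2 := by rw [ht]; linarith
      field_simp; linarith)
    (by
      have : (x3 - k ^ 2) ^ 2 + y3 ^ 2 = t ^ 2 := by rw [ht]; linarith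
      field_simp; linarith)
    (div_ne_zero hY2 ht0.ne') h.l1p h.l2p h.l3p
    (by
      have : l1 * t + l2 * (x2 - k ^ 2) + l3 * (x3 - k ^ 2) = 0 := by
        rw [ht]; have := h.ls; have h3 : l3 = 1 - l1 - l2 := by linarith
        subst h3; linarith
      field_simp; linarith)
    (by field_simp; linarith)
    (by rw [le_div_iff₀ ht0]; linarith) (by rw [le_div_iff₀ ht0]; linarith)
    (by
      have : (x2 - k ^ 2) / t * ((x3 - k ^ 2) / t) + y2 / t * (y3 / t) = (⟪m2, m3⟫ - k ^ 2) / t := by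
        have : (x2 - k ^ 2) * (x3 - k ^ 2) + y2 * y3 = t * (⟪m2, m3⟫ - k ^ 2) := by rw [ht]; linarith
        field_simp; linarith
      rw [this, le_div_iff₀ ht0]; linarith)
  obtain ⟨⟨k1, k2⟩, k3, k4⟩ := key
  have mul : ∀ {X Y e : ℝ}, q ≤ q * ((X - k ^ 2) / t) + e * (Y / t) → c ≤ k * k + q * (X - k * k) + e * Y := by
    intro X Y e h0
    have h1 := mul_le_mul_of_nonneg_right h0 ht0.le
    have h2 : (q * ((X - k ^ 2) / t) + e * (Y / t)) * t = q * (X - k ^ 2) + e * Y := by field_simp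
    rw [h2] at h1
    linarith
  have k1' := mul k1
  have k2' := mul k2
  have k3' := mul (X := x2) (Y := y2) (e := -s) (by linarith)
  have k4' := mul (X := x3) (Y := y3) (e := -s) (by linarith)
  have main : ∀ e : ℝ, e ^ 2 = s ^ 2 → Iso p m1 (k • p + q • (m1 - k • p) + e • cr p m1) k c := by
    intro e he
    refine ⟨h.hp, h.h1, ?_, h.p1, ?_, ?_⟩
    · apply norm_one_of_inner
      simp only [inner_add_left, inner_add_right, inner_sub_left, inner_sub_right, real_inner_smul_left, real_inner_smul_right, pp, mm, fp, fm, ff, h.p1, p1',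
        real_inner_comm p (cr p m1), real_inner_comm m1 (cr p m1), real_inner_comm (cr p m1) p, real_inner_comm (cr p m1) m1]
      have : e ^ 2 = 1 - q ^ 2 := by linarith
      linear_combination t * this + (1 - q ^ 2) * ht
    · simp only [inner_add_right, inner_sub_right, real_inner_smul_right, pp, fp, h.p1]; ring
    · simp only [inner_add_right, inner_sub_right, real_inner_smul_right, mm, fm, p1']; linear_combination hqt - q * ht
  refine ⟨fun b => k • p + q • (m1 - k • p) + (if b then s else -s) • cr p m1, ?_, ?_, ?_⟩
  · rintro (_ | _)
    · refine ⟨main _ (by simp), ?_, ?_⟩ <;> rw [real_inner_comm] <;>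
        simp only [inner_add_right, inner_sub_right, real_inner_smul_right, p2', p3', ← hx2, ← hy2, ← hx3, ← hy3, if_false, Bool.false_eq_true] <;> linarith
    · refine ⟨main _ (by simp), ?_, ?_⟩ <;> rw [real_inner_comm] <;>
        simp only [inner_add_right, inner_sub_right, real_inner_smul_right, p2', p3', ← hx2, ← hy2, ← hx3, ← hy3, if_true] <;> linarith
  · simp only [inner_add_left, inner_sub_left, real_inner_smul_left, fp, fm, ff, if_true]
    have := mul_pos hs0 ht0
    linarith
  · simp only [inner_add_left, inner_sub_left, real_inner_smul_left, fp, fm, ff, if_false, Bool.false_eq_true]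
    have := mul_pos hs0 ht0
    linarith

end PalAux

/-! Part P5d -/

namespace PalAux

lemma area_gen {ι : Type} [Fintype ι] {p : E 2} {m v : ι → E 2} {k c t : ℝ} {M : Set (E 2)} (hc : 0 < c) (hc1 : c < 1)
    (hk : 2 * k ^ 2 < 1 + c) (hI : ∀ i, Iso p (m i) (v i) k c) (hp1 : ‖p‖ = 1)
    (hd : ∀ᵐ u ∂sg, ∀ i j, u ∈ Lune p (m i) (-(v i)) → u ∈ Lune p (m j) (-(v j)) → i = j)
    (hM : Compl M c) (hm : ∀ i, m i ∈ M) (hp : ∀ y ∈ M, k ≤ ⟪p, y⟫) (ht : 0 < t) (ht1 : t ≤ 1)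
    (hcap : ∀ u : E 2, ‖u‖ = 1 → t < ⟪u, p⟫ → u ∈ M) :
    (Fintype.card ι : ℝ) * ((1 - c) * bet k c - (psi k c + 2 * bet k c - π)) +
      (1 - t) * (2 * π - (Fintype.card ι : ℝ) * (π - psi k c)) ≤ sg.real M := by
  classical
  have mL : ∀ i, MeasurableSet (Lune p (m i) (-(v i))) := fun i => measurableSet_lune hp1 ((hI i).LI' hc1 hk)
  have mC : MeasurableSet {u : E 2 | t < ⟪u, p⟫} := measurableSet_lt (by fun_prop) (by fun_prop)
  obtain ⟨Q, hQ⟩ : ∃ Q : Set (E 2), Q = {u : E 2 | t < ⟪u, p⟫} \ ⋃ i, Lune p (m i) (-(v i)) := ⟨_, rfl⟩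
  have mQ : MeasurableSet Q := by rw [hQ]; exact mC.diff (MeasurableSet.iUnion mL)
  -- the cap part
  have h1 : 2 * π * (1 - t) ≤ sg.real Q + (Fintype.card ι : ℝ) * ((1 - t) * (π - psi k c)) := by
    rw [← cap_area hp1 ht ht1]
    have : {u : E 2 | t < ⟪u, p⟫} ⊆ Q ∪ ⋃ i ∈ (Finset.univ : Finset ι), (Lune p (m i) (-(v i)) ∩ {u | t < ⟪u, p⟫}) := by
      intro u hu
      by_cases h : u ∈ ⋃ i, Lune p (m i) (-(v i))
      · right
        obtain ⟨i, hi⟩ := Set.mem_iUnion.1 h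
        simp only [Set.mem_iUnion]
        exact ⟨i, Finset.mem_univ _, hi, hu⟩
      · left; rw [hQ]; exact ⟨hu, h⟩
    refine (measureReal_mono this).trans ((measureReal_union_le _ _).trans ?_)
    have := measureReal_biUnion_finset_le (μ := sg) (Finset.univ : Finset ι) (fun i => Lune p (m i) (-(v i)) ∩ {u | t < ⟪u, p⟫})
    have e : ∑ i : ι, sg.real (Lune p (m i) (-(v i)) ∩ {u | t < ⟪u, p⟫}) = (Fintype.card ι : ℝ) * ((1 - t) * (π - psi k c)) := by
      rw [Finset.sum_congr rfl (fun i _ => (hI i).lune hc1 hk ht ht1)]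
      simp
    linarith
  have h2 := sum_le_sg (Finset.univ : Finset (Option ι)) (fun o => match o with | none => Q | some i => Hc p (m i) (v i) c)
    (Y := M)
    (by
      rintro (_ | i) -
      · exact mQ
      · exact (hI i).meas hc1 hk)
    (by
      filter_upwards [hd] with u hu
      rintro (_ | i) - (_ | j) - hi hj
      · rfl
      · exfalso
        simp only [hQ] at hi
        exact hi.2 (Set.mem_iUnion.2 ⟨j, Hc_sub_lune _ _ _ _ hj⟩)
      · exfalso
        simp only [hQ] at hj
        exact hj.2 (Set.mem_iUnion.2 ⟨i, Hc_sub_lune _ _ _ _ hi⟩)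
      · rw [hu i j (Hc_sub_lune _ _ _ _ hi) (Hc_sub_lune _ _ _ _ hj)])
    (by
      filter_upwards [nrm_sphere_ae] with u hu
      rintro (_ | i) - hi
      · simp only [hQ] at hi
        exact hcap u hu hi.1
      · exact (hI i).Hc_sub hM (hm i) hp hu hi)
  rw [Fintype.sum_option] at h2
  have h3 : ∑ i : ι, ((1 - c) * bet k c - (psi k c + 2 * bet k c - π)) ≤ ∑ i : ι, sg.real (Hc p (m i) (v i) c) :=
    Finset.sum_le_sum fun i _ => (hI i).area hc hc1 hk
  simp only [Finset.sum_const, Finset.card_univ, nsmul_eq_mul] at h3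
  linarith

lemma lune_sep {p m1 m2 v u : E 2} {k c : ℝ} (h : Iso p m1 v k c) (h2 : ‖m2‖ = 1) (hp2 : ⟪p, m2⟫ = k) (hv : c ≤ ⟪v, m2⟫)
    (hu : u ∈ Lune p m1 (-v)) : ⟪u, m2⟫ ≤ ⟪u, m1⟫ := by
  obtain ⟨α, β, γ, h1, h3, rfl⟩ := hu
  simp only [inner_add_left, real_inner_smul_left, inner_neg_left, inner_self_one h.hm, h.pm, hp2]
  have := inner_le1 h2 h.hm
  have e : ⟪v, m1⟫ = c := by rw [real_inner_comm, h.mv]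
  rw [e]
  nlinarith

theorem Ctc.area {p m1 m2 m3 : E 2} {k c s l1 l2 l3 : ℝ} (h : Ctc p m1 m2 m3 k c l1 l2 l3) (hc : 0 < c) (hc1 : c < 1)
    (hs : 0 < s) (hcs : c ^ 2 + s ^ 2 = 1) {σ : ℝ} (hσ : 0 < σ) (hkσ : k ^ 2 + σ ^ 2 = 1)
    (hk : 2 * k ^ 2 < 1 + c) {M : Set (E 2)} (hM : Compl M c) (M1 : m1 ∈ M) (M2 : m2 ∈ M) (M3 : m3 ∈ M) (hp : ∀ y ∈ M, k ≤ ⟪p, y⟫) :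
    6 * ((1 - c) * bet k c - (psi k c + 2 * bet k c - π)) + (1 - (c * k + s * σ)) * (6 * psi k c - 4 * π) ≤ sg.real M := by
  have hj := h.jung hc1
  have hk0 := h.k0
  have hkc : c < k := by
    by_contra hcon
    push Not at hcon
    nlinarith
  have hσs : σ < s := by
    by_contra hcon
    push Not at hcon
    nlinarith
  have hsk : 0 ≤ s * k - c * σ := by nlinarith
  have htt : (c * k + s * σ) ^ 2 + (s * k - c * σ) ^ 2 = 1 := by
    have : (c * k + s * σ) ^ 2 + (s * k - c * σ) ^ 2 = (c ^ 2 + s ^ 2) * (k ^ 2 + σ ^ 2) := by ring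
    rw [this, hcs, hkσ]; ring
  have ht0 : 0 < c * k + s * σ := by positivity
  obtain ⟨v1, hv1, hv1p, hv1n⟩ := h.vdata hc hc1 hk
  obtain ⟨v2, hv2, hv2p, hv2n⟩ := h.rot.vdata hc hc1 hk
  obtain ⟨v3, hv3, hv3p, hv3n⟩ := h.rot.rot.vdata hc hc1 hk
  have ne12 : m1 - m2 ≠ 0 := by
    intro h0
    have := h.LI 1 (-1) 0 (by rw [← h0]; module)
    exact one_ne_zero this.1
  have ne13 : m1 - m3 ≠ 0 := by
    intro h0
    have := h.LI 1 0 (-1) (by rw [← h0]; module)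
    exact one_ne_zero this.1
  have ne23 : m2 - m3 ≠ 0 := by
    intro h0
    have := h.LI 0 1 (-1) (by rw [← h0]; module)
    exact one_ne_zero this.2.1
  have sgn : ∀ {m : E 2} {v : Bool → E 2} {u : E 2} {b b' : Bool}, 0 < ⟪v true, cr p m⟫ → ⟪v false, cr p m⟫ < 0 →
      u ∈ Lune p m (-(v b)) → u ∈ Lune p m (-(v b')) → b = b' := by
    intro m v u b b' h1 h2 hb hb'
    have fp : ⟪p, cr p m⟫ = 0 := by rw [real_inner_comm, cr_self_left]
    have fm : ⟪m, cr p m⟫ = 0 := by rw [real_inner_comm, cr_self_right]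
    have F : ∀ b, u ∈ Lune p m (-(v b)) → ∃ γ > 0, ⟪u, cr p m⟫ = -γ * ⟪v b, cr p m⟫ := by
      rintro b ⟨α, β, γ, h3, h4, rfl⟩
      refine ⟨β, h4, ?_⟩
      simp only [inner_add_left, real_inner_smul_left, inner_neg_left, fp, fm]; ring
    obtain ⟨γ, hγ, e⟩ := F b hb
    obtain ⟨γ', hγ', e'⟩ := F b' hb'
    rcases b with _ | _ <;> rcases b' with _ | _
    · rfl
    · nlinarith [mul_pos hγ' h1, mul_neg_of_pos_of_neg hγ h2]
    · nlinarith [mul_pos hγ h1, mul_neg_of_pos_of_neg hγ' h2]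
    · rfl
  have key := area_gen (ι := Fin 3 × Bool) (p := p) (m := fun i => ![m1, m2, m3] i.1) (v := fun i => ![v1, v2, v3] i.1 i.2)
    (k := k) (c := c) (t := c * k + s * σ) (M := M) hc hc1 hk
    (by
      rintro ⟨i, b⟩
      fin_cases i
      · exact (hv1 b).1
      · exact (hv2 b).1
      · exact (hv3 b).1) h.hp
    (by
      filter_upwards [plane_ae ne12, plane_ae ne13, plane_ae ne23] with u u12 u13 u23
      rw [inner_sub_right] at u12 u13 u23
      have a12 : ∀ b, u ∈ Lune p m1 (-(v1 b)) → ⟪u, m2⟫ ≤ ⟪u, m1⟫ := fun b hu => lune_sep (hv1 b).1 h.h2 h.p2 (hv1 b).2.1 hu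
      have a13 : ∀ b, u ∈ Lune p m1 (-(v1 b)) → ⟪u, m3⟫ ≤ ⟪u, m1⟫ := fun b hu => lune_sep (hv1 b).1 h.h3 h.p3 (hv1 b).2.2 hu
      have a23 : ∀ b, u ∈ Lune p m2 (-(v2 b)) → ⟪u, m3⟫ ≤ ⟪u, m2⟫ := fun b hu => lune_sep (hv2 b).1 h.h3 h.p3 (hv2 b).2.1 hu
      have a21 : ∀ b, u ∈ Lune p m2 (-(v2 b)) → ⟪u, m1⟫ ≤ ⟪u, m2⟫ := fun b hu => lune_sep (hv2 b).1 h.h1 h.p1 (hv2 b).2.2 hu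
      have a31 : ∀ b, u ∈ Lune p m3 (-(v3 b)) → ⟪u, m1⟫ ≤ ⟪u, m3⟫ := fun b hu => lune_sep (hv3 b).1 h.h1 h.p1 (hv3 b).2.1 hu
      have a32 : ∀ b, u ∈ Lune p m3 (-(v3 b)) → ⟪u, m2⟫ ≤ ⟪u, m3⟫ := fun b hu => lune_sep (hv3 b).1 h.h2 h.p2 (hv3 b).2.2 hu
      rintro ⟨i, b⟩ ⟨j, b'⟩ hi hj
      fin_cases i <;> fin_cases j
      · have : b = b' := sgn hv1p hv1n hi hj
        rw [this]
      · exact absurd (by linarith [a12 b hi, a21 b' hj]) u12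
      · exact absurd (by linarith [a13 b hi, a31 b' hj]) u13
      · exact absurd (by linarith [a12 b' hj, a21 b hi]) u12
      · have : b = b' := sgn hv2p hv2n hi hj
        rw [this]
      · exact absurd (by linarith [a23 b hi, a32 b' hj]) u23
      · exact absurd (by linarith [a13 b' hj, a31 b hi]) u13
      · exact absurd (by linarith [a23 b' hj, a32 b hi]) u23
      · have : b = b' := sgn hv3p hv3n hi hj
        rw [this])
    hM
    (by
      rintro ⟨i, b⟩
      fin_cases i
      · exact M1
      · exact M2
      · exact M3) hp ht0 (by nlinarith)
    (by
      intro u hu hut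
      rw [hM]
      refine ⟨hu, fun y hy => ?_⟩
      have := inner_ge h.hp hu (hM.unit hy) hut.le (by rw [real_inner_comm]; exact hp y hy) ht0.le hk0.le hsk hσ.le htt hkσ
      have e : (c * k + s * σ) * k - (s * k - c * σ) * σ = c * (k ^ 2 + σ ^ 2) := by ring
      rw [e, hkσ] at this
      linarith)
  have card : (Fintype.card (Fin 3 × Bool) : ℝ) = 6 := by norm_num [Fintype.card_prod]
  rw [card] at key
  linarith

/-- circumradius at most half of the diameter -/
lemma area_small {p : E 2} {k c : ℝ} (hp1 : ‖p‖ = 1) (hc : 0 < c) (hc1 : c < 1) (hk0 : 0 < k) (hk : 1 + c ≤ 2 * k ^ 2) {M : Set (E 2)} (hM : Compl M c)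
    (hp : ∀ y ∈ M, k ≤ ⟪p, y⟫) : 2 * π * (1 - √((1 + c) / 2)) ≤ sg.real M := by
  have hC : √((1 + c) / 2) ^ 2 = (1 + c) / 2 := Real.sq_sqrt (by linarith)
  have hS : √((1 - c) / 2) ^ 2 = (1 - c) / 2 := Real.sq_sqrt (by linarith)
  have hC0 : 0 < √((1 + c) / 2) := Real.sqrt_pos.2 (by linarith)
  have hS0 : 0 < √((1 - c) / 2) := Real.sqrt_pos.2 (by linarith)
  rw [← cap_area hp1 hC0 (by nlinarith)]
  apply real_le_of_ae
  filter_upwards [nrm_sphere_ae] with u hu hut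
  rw [hM]
  refine ⟨hu, fun y hy => ?_⟩
  have h1 : √((1 + c) / 2) ≤ k := le_of_sq_le (by linarith) hk0.le
  have := inner_ge hp1 hu (hM.unit hy) (le_of_lt hut) (by rw [real_inner_comm]; exact h1.trans (hp y hy)) hC0.le hC0.le hS0.le hS0.le (by linarith) (by linarith)
  nlinarith

end PalAux

/-! Part P5e -/

namespace PalAux

lemma hull_compact {M : Set (E 2)} (hM : IsCompact M) (hne : M.Nonempty) : IsCompact (convexHull ℝ M) := by
  classical
  obtain ⟨m0, hm0⟩ := hne
  have hc : IsCompact ((fun q : (Fin 4 → ℝ) × (Fin 4 → E 2) => ∑ i, q.1 i • q.2 i) ''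
      (stdSimplex ℝ (Fin 4) ×ˢ (Set.univ.pi fun _ : Fin 4 => M))) := by
    apply IsCompact.image
    · exact (isCompact_stdSimplex ℝ (Fin 4)).prod (isCompact_univ_pi fun _ => hM)
    · fun_prop
  convert hc using 1
  apply Set.Subset.antisymm
  · intro x hx
    obtain ⟨ι, _, z, w, hz, hA, hw, hw1, hx⟩ := eq_pos_convex_span_of_mem_convexHull hx
    have hcard : Fintype.card ι ≤ Fintype.card (Fin 4) := by
      have h1 := hA.card_le_finrank_succ
      have h2 := Submodule.finrank_le (vectorSpan ℝ (Set.range z))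
      have h3 : Module.finrank ℝ (E 2) = 3 := by simp
      simp only [Fintype.card_fin]
      omega
    obtain ⟨e⟩ := Function.Embedding.nonempty_of_card_le hcard
    refine ⟨(Function.extend e w 0, Function.extend e z (fun _ => m0)), ⟨⟨?_, ?_⟩, ?_⟩, ?_⟩
    · intro j
      by_cases hj : ∃ i, e i = j
      · obtain ⟨i, rfl⟩ := hj
        simp only [e.injective.extend_apply]; exact (hw i).le
      · simp only [Function.extend_apply' _ _ _ hj]; exact le_rfl
    · rw [← hw1]
      symm
      apply Fintype.sum_of_injective e e.injective
      · intro j hj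
        simp only [Function.extend_apply' _ _ _ (fun h => hj h)]; rfl
      · intro i; simp only [e.injective.extend_apply]
    · intro j _
      by_cases hj : ∃ i, e i = j
      · obtain ⟨i, rfl⟩ := hj
        simp only [e.injective.extend_apply]; exact hz ⟨i, rfl⟩
      · simp only [Function.extend_apply' _ _ _ hj]; exact hm0
    · rw [← hx]
      symm
      apply Fintype.sum_of_injective e e.injective
      · intro j hj
        simp only [Function.extend_apply' _ _ _ (fun h => hj h)]; simp
      · intro i; simp only [e.injective.extend_apply]
  · rintro x ⟨⟨w, z⟩, ⟨⟨h1, h2⟩, h3⟩, rfl⟩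
    apply (convex_convexHull ℝ M).sum_mem
    · intro i _; exact h1 i
    · exact h2
    · intro i _; exact subset_convexHull _ _ (h3 i (Set.mem_univ _))

theorem exists_ctc {M : Set (E 2)} {c : ℝ} (hM : IsCompact M) (hne : M.Nonempty) (hc : 0 < c) (hc1 : c < 1)
    (hM1 : ∀ m ∈ M, ‖m‖ = 1) (hMc : ∀ m ∈ M, ∀ v ∈ M, c ≤ ⟪m, v⟫) :
    ∃ (p : E 2) (k : ℝ), ‖p‖ = 1 ∧ 0 < k ∧ (∀ y ∈ M, k ≤ ⟪p, y⟫) ∧ (1 + c ≤ 2 * k ^ 2 ∨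
      ∃ m1 ∈ M, ∃ m2 ∈ M, ∃ m3 ∈ M, ∃ l1 l2 l3 : ℝ, Ctc p m1 m2 m3 k c l1 l2 l3) := by
  have hK := hull_compact hM hne
  obtain ⟨z, hz, hz1⟩ := exists_norm_eq_iInf_of_complete_convex (K := convexHull ℝ M) (hne.mono (subset_convexHull _ _)) hK.isComplete
    (convex_convexHull _ _) 0
  rw [norm_eq_iInf_iff_real_inner_le_zero (convex_convexHull _ _) hz] at hz1
  obtain ⟨m0, hm0⟩ := hne
  have hz0 : z ≠ 0 := by
    have : convexHull ℝ M ⊆ {x | c ≤ ⟪m0, x⟫} := by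
      apply convexHull_min
      · intro y hy; exact hMc _ hm0 _ hy
      · exact convex_halfSpace_ge (f := fun x => ⟪m0, x⟫) ⟨fun a b => inner_add_right _ _ _, fun a b => real_inner_smul_right _ _ _⟩ c
    intro h
    have := this hz
    rw [h] at this
    simp only [Set.mem_ofPred_eq, inner_zero_right] at this
    linarith
  have hk : 0 < ‖z‖ := norm_pos_iff.2 hz0
  obtain ⟨k, hkz⟩ : ∃ k, k = ‖z‖ := ⟨_, rfl⟩
  rw [← hkz] at hk
  have hp : ‖nrm z‖ = 1 := norm_nrm hz0
  have hkp : k • nrm z = z := by rw [hkz]; exact norm_smul_nrm z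
  obtain ⟨p, hpz⟩ : ∃ p, p = nrm z := ⟨_, rfl⟩
  rw [← hpz] at hp hkp
  have hkM : ∀ y ∈ M, k ≤ ⟪p, y⟫ := by
    intro y hy
    have := hz1 y (subset_convexHull _ _ hy)
    rw [← hkp] at this
    simp only [zero_sub, inner_neg_left, inner_sub_right, real_inner_smul_left, real_inner_smul_right, inner_self_one hp] at this
    have h2 : k * k ≤ k * ⟪p, y⟫ := by linarith
    exact le_of_mul_le_mul_left h2 hk
  refine ⟨p, k, hp, hk, hkM, ?_⟩
  obtain ⟨ι, _, y, w, hy, hA, hw, hw1, hx⟩ := eq_pos_convex_span_of_mem_convexHull hz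
  have hyM : ∀ i, y i ∈ M := fun i => hy ⟨i, rfl⟩
  have hct : ∀ i, ⟪p, y i⟫ = k := by
    have h1 : ∑ i, w i * (⟪p, y i⟫ - k) = 0 := by
      have : ∑ i, w i * ⟪p, y i⟫ = k := by
        have e := congrArg (fun x => ⟪p, x⟫) hx
        simp only [inner_sum, real_inner_smul_right] at e
        rw [e, ← hkp, real_inner_smul_right, inner_self_one hp, mul_one]
      simp only [mul_sub, Finset.sum_sub_distrib, ← Finset.sum_mul]
      rw [this, hw1]; ring
    intro i
    have := (Finset.sum_eq_zero_iff_of_nonneg (fun i _ => mul_nonneg (hw i).le (sub_nonneg.2 (hkM _ (hyM i))))).1 h1 i (Finset.mem_univ _)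
    rcases mul_eq_zero.1 this with h | h
    · exact absurd h (hw i).ne'
    · linarith
  have hLI : LinearIndependent ℝ y := by
    rw [Fintype.linearIndependent_iff]
    intro g hg i
    apply affineIndependent_iff.1 hA Finset.univ g _ hg i (Finset.mem_univ _)
    have e := congrArg (fun x => ⟪p, x⟫) hg
    simp only [inner_sum, real_inner_smul_right, inner_zero_right, hct, ← Finset.sum_mul] at e
    rcases mul_eq_zero.1 e with h | h
    · exact h
    · exact absurd h hk.ne'
  have hcard : Fintype.card ι ≤ 3 := by
    have := hLI.fintype_card_le_finrank
    simpa using this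
  have e0 := (Fintype.equivFin ι).symm
  rw [← e0.sum_comp] at hw1 hx
  have hLI' := hLI.comp e0 e0.injective
  generalize Fintype.card ι = n at *
  interval_cases n
  · simp at hw1
  · left
    rw [Fin.sum_univ_one] at hw1 hx
    rw [hw1, one_smul] at hx
    have : k = 1 := by rw [hkz, ← hx]; exact hM1 _ (hyM _)
    rw [this]; linarith
  · left
    rw [Fin.sum_univ_two] at hw1 hx
    have f : ∀ i, w (e0 0) * ⟪y (e0 0), y i⟫ + w (e0 1) * ⟪y (e0 1), y i⟫ = k * k := by
      intro i
      have e := congrArg (fun x => ⟪x, y i⟫) hx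
      simp only [inner_add_left, real_inner_smul_left] at e
      rw [e, ← hkp, real_inner_smul_left, hct]
    have f0 := f (e0 0)
    have f1 := f (e0 1)
    rw [inner_self_one (hM1 _ (hyM _))] at f0 f1
    rw [real_inner_comm] at f0
    have := hMc _ (hyM (e0 0)) _ (hyM (e0 1))
    have h2 : 2 * k ^ 2 = 1 + ⟪y (e0 0), y (e0 1)⟫ := by
      have hw0 : w (e0 0) = 1 - w (e0 1) := by linarith
      rw [hw0] at f0 f1
      linarith
    linarith
  · right
    rw [Fin.sum_univ_three] at hw1 hx
    refine ⟨_, hyM (e0 0), _, hyM (e0 1), _, hyM (e0 2), w (e0 0), w (e0 1), w (e0 2), hp, hM1 _ (hyM _), hM1 _ (hyM _), hM1 _ (hyM _),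
      hct _, hct _, hct _, hMc _ (hyM _) _ (hyM _), hMc _ (hyM _) _ (hyM _), hMc _ (hyM _) _ (hyM _), hw _, hw _, hw _, hw1, ?_, ?_, hk⟩
    · rw [hkp, hx]
    · intro α β γ h0
      have := Fintype.linearIndependent_iff.1 hLI' ![α, β, γ] (by rw [Fin.sum_univ_three]; exact h0)
      exact ⟨this 0, this 1, this 2⟩

lemma Compl.closed {M : Set (E 2)} {c : ℝ} (h : Compl M c) : IsCompact M := by
  apply (isCompact_sphere (0 : E 2) 1).of_isClosed_subset
  · have : M = {x | ‖x‖ = 1} ∩ ⋂ y ∈ M, {x | c ≤ ⟪x, y⟫} := by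
      ext x
      rw [h x]
      simp
    rw [this]
    apply IsClosed.inter
    · exact isClosed_eq (by fun_prop) (by fun_prop)
    · exact isClosed_biInter fun y _ => isClosed_le (by fun_prop) (by fun_prop)
  · intro x hx
    rw [mem_sphere_zero_iff_norm]; exact h.unit hx

end PalAux

/-! Part P6 -/

namespace PalAux

def Hf (c k : ℝ) : ℝ := 6 * ((1 - c) * bet k c - (psi k c + 2 * bet k c - π)) + (1 - (c * k + √(1 - c ^ 2) * √(1 - k ^ 2))) * (6 * psi k c - 4 * π)

lemma psi_deriv {c k : ℝ} (hc : 0 < c) (hc1 : c < 1) (hk : 2 * k ^ 2 < 1 + c) :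
    HasDerivAt (fun k => psi k c) (2 * k * (√(1 - c) / ((1 - k ^ 2) * √(1 + c - 2 * k ^ 2)))) k := by
  have ht : 0 < 1 - k ^ 2 := by nlinarith
  have h1 : 0 < 1 - c := by linarith
  have h2 : 0 < 1 + c - 2 * k ^ 2 := by linarith
  have ha : HasDerivAt (fun k : ℝ => (c - k ^ 2) / (1 - k ^ 2)) (-(2 * k * (1 - c)) / (1 - k ^ 2) ^ 2) k := by
    have e1 : HasDerivAt (fun k : ℝ => c - k ^ 2) (-(2 * k)) k := by
      simpa using ((hasDerivAt_id k).pow 2).const_sub c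
    have e2 : HasDerivAt (fun k : ℝ => 1 - k ^ 2) (-(2 * k)) k := by
      simpa using ((hasDerivAt_id k).pow 2).const_sub 1
    refine (e1.div e2 ht.ne').congr_deriv ?_
    ring
  have hx : 1 - ((c - k ^ 2) / (1 - k ^ 2)) ^ 2 = (1 - c) * (1 + c - 2 * k ^ 2) / (1 - k ^ 2) ^ 2 := by
    field_simp; ring
  have hpos : 0 < 1 - ((c - k ^ 2) / (1 - k ^ 2)) ^ 2 := by rw [hx]; positivity
  have hb : HasDerivAt Real.arccos (-(1 / √(1 - ((c - k ^ 2) / (1 - k ^ 2)) ^ 2))) ((c - k ^ 2) / (1 - k ^ 2)) := by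
    apply Real.hasDerivAt_arccos
    · intro h; rw [h] at hpos; norm_num at hpos
    · intro h; rw [h] at hpos; norm_num at hpos
  have := hb.comp k ha
  refine this.congr_deriv ?_
  rw [hx, Real.sqrt_div (by positivity), Real.sqrt_sq ht.le, Real.sqrt_mul h1.le]
  have h3 := Real.mul_self_sqrt h1.le
  have : √(1 - c) ≠ 0 := (Real.sqrt_pos.2 h1).ne'
  have : √(1 + c - 2 * k ^ 2) ≠ 0 := (Real.sqrt_pos.2 h2).ne'
  have ht' := ht.ne'
  field_simp
  linear_combination (-k) * h3

lemma sigma_deriv {k : ℝ} (hk : k ^ 2 < 1) : HasDerivAt (fun k => √(1 - k ^ 2)) (-k / √(1 - k ^ 2)) k := by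
  have ht : 0 < 1 - k ^ 2 := by linarith
  have e2 : HasDerivAt (fun k : ℝ => 1 - k ^ 2) (-(2 * k)) k := by
    simpa using ((hasDerivAt_id k).pow 2).const_sub 1
  convert e2.sqrt ht.ne' using 1
  ring

lemma bet_deriv {c k : ℝ} (hc : 0 < c) (hc1 : c < 1) (hk : 2 * k ^ 2 < 1 + c) :
    HasDerivAt (fun k => bet k c) (-(√(1 - c) / ((1 - k ^ 2) * √(1 + c - 2 * k ^ 2)))) k := by
  have ht : 0 < 1 - k ^ 2 := by nlinarith
  have h1 : 0 < 1 - c := by linarith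
  have h1' : 0 < 1 + c := by linarith
  have h2 : 0 < 1 + c - 2 * k ^ 2 := by linarith
  have hσ : 0 < √(1 - k ^ 2) := Real.sqrt_pos.2 ht
  have hσ2 : √(1 - k ^ 2) ^ 2 = 1 - k ^ 2 := Real.sq_sqrt ht.le
  have hs' : √(1 - c ^ 2) = √(1 - c) * √(1 + c) := by rw [← Real.sqrt_mul h1.le]; congr 1; ring
  have a0 : 0 < √(1 - c) := Real.sqrt_pos.2 h1
  have b0 : 0 < √(1 + c) := Real.sqrt_pos.2 h1'
  have d0 : 0 < √(1 + c - 2 * k ^ 2) := Real.sqrt_pos.2 h2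
  have a2 := Real.sq_sqrt h1.le
  have b2 := Real.sq_sqrt h1'.le
  have hs0 : 0 < √(1 - c ^ 2) := by rw [hs']; positivity
  have hs2 : √(1 - c ^ 2) ^ 2 = 1 - c ^ 2 := Real.sq_sqrt (by nlinarith)
  obtain ⟨σ, hσe⟩ : ∃ σ, σ = √(1 - k ^ 2) := ⟨_, rfl⟩
  have ha : HasDerivAt (fun k : ℝ => k * (1 - c) / (√(1 - k ^ 2) * √(1 - c ^ 2))) ((1 - c) / (√(1 - k ^ 2) ^ 3 * √(1 - c ^ 2))) k := by
    have e1 : HasDerivAt (fun k : ℝ => k * (1 - c)) (1 - c) k := by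
      simpa using (hasDerivAt_id k).mul_const (1 - c)
    have e2 := (sigma_deriv (k := k) (by linarith)).mul_const (√(1 - c ^ 2))
    refine (e1.div e2 (by positivity)).congr_deriv ?_
    show _ = _
    rw [← hσe] at hσ hσ2 ⊢
    field_simp
    rw [show k ^ 2 = 1 - σ ^ 2 by linarith]
    ring
  have hx : 1 - (k * (1 - c) / (√(1 - k ^ 2) * √(1 - c ^ 2))) ^ 2 = (1 + c - 2 * k ^ 2) / ((1 - k ^ 2) * (1 + c)) := by
    rw [div_pow, mul_pow _ (√(1 - c ^ 2)), hσ2, hs2]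
    have : (1 - c ^ 2) = (1 - c) * (1 + c) := by ring
    rw [this]
    field_simp; ring
  have hpos : 0 < 1 - (k * (1 - c) / (√(1 - k ^ 2) * √(1 - c ^ 2))) ^ 2 := by rw [hx]; positivity
  have hb : HasDerivAt Real.arccos (-(1 / √(1 - (k * (1 - c) / (√(1 - k ^ 2) * √(1 - c ^ 2))) ^ 2))) (k * (1 - c) / (√(1 - k ^ 2) * √(1 - c ^ 2))) := by
    apply Real.hasDerivAt_arccos
    · intro h; rw [h] at hpos; norm_num at hpos
    · intro h; rw [h] at hpos; norm_num at hpos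
  have := hb.comp k ha
  refine this.congr_deriv ?_
  rw [hx, Real.sqrt_div h2.le, Real.sqrt_mul ht.le, hs', ← hσ2, ← hσe]
  rw [← hσe] at hσ
  rw [Real.sqrt_sq hσ.le]
  field_simp
  linear_combination a2

lemma psi_ge {c k : ℝ} (hc1 : c < 1) (hk : 2 * k ^ 2 ≤ 1 + c) (hkJ : (1 + 2 * c) / 3 ≤ k ^ 2) : 2 * π / 3 ≤ psi k c := by
  have ht : 0 < 1 - k ^ 2 := by nlinarith
  have h3 : Real.cos (2 * π / 3) = -(1 / 2) := by
    rw [show 2 * π / 3 = π - π / 3 by ring, Real.cos_pi_sub, Real.cos_pi_div_three]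
  rw [← Real.arccos_cos (x := 2 * π / 3) (by positivity) (by linarith [Real.pi_pos]), h3, psi]
  apply Real.arccos_le_arccos
  rw [div_le_iff₀ ht]; linarith

lemma Hf_deriv {c k : ℝ} (hc : 0 < c) (hc1 : c < 1) (hk : 2 * k ^ 2 < 1 + c) (hkJ : (1 + 2 * c) / 3 ≤ k ^ 2) (hk0 : 0 < k) :
    ∃ D, HasDerivAt (Hf c) D k ∧ 3 * √(1 - c) * (1 + c - 2 * k ^ 2) ^ 2 ≤ D := by
  have ht : 0 < 1 - k ^ 2 := by nlinarith
  have hσ : 0 < √(1 - k ^ 2) := Real.sqrt_pos.2 ht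
  have hσ2 : √(1 - k ^ 2) ^ 2 = 1 - k ^ 2 := Real.sq_sqrt ht.le
  have hs0 : 0 < √(1 - c ^ 2) := Real.sqrt_pos.2 (by nlinarith)
  have hs2 : √(1 - c ^ 2) ^ 2 = 1 - c ^ 2 := Real.sq_sqrt (by nlinarith)
  have h2 : 0 < 1 + c - 2 * k ^ 2 := by linarith
  have d0 : 0 < √(1 + c - 2 * k ^ 2) := Real.sqrt_pos.2 h2
  have a0 : 0 < √(1 - c) := Real.sqrt_pos.2 (by linarith)
  have hP := psi_deriv hc hc1 hk
  have hB := bet_deriv hc hc1 hk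
  have hS := sigma_deriv (k := k) (by linarith)
  have hpsi := psi_ge hc1 hk.le hkJ
  obtain ⟨g, hg⟩ : ∃ g, g = √(1 - c) / ((1 - k ^ 2) * √(1 + c - 2 * k ^ 2)) := ⟨_, rfl⟩
  rw [← hg] at hP hB
  have hg1 : √(1 - c) ≤ g := by
    rw [hg, le_div_iff₀ (by positivity)]
    have : (1 - k ^ 2) * √(1 + c - 2 * k ^ 2) ≤ 1 := by
      have u1 : 1 - k ^ 2 ≤ 1 := by nlinarith
      have u2 : √(1 + c - 2 * k ^ 2) ≤ 1 := by
        rw [Real.sqrt_le_one]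
        nlinarith
      exact mul_le_one₀ u1 d0.le u2
    nlinarith
  have hg0 : 0 < g := a0.trans_le hg1
  have hD := ((((hB.const_mul (1 - c)).sub ((hP.add (hB.const_mul 2)).sub_const π)).const_mul 6)).add
    ((((hasDerivAt_id k).const_mul c).add (hS.const_mul (√(1 - c ^ 2)))).const_sub 1 |>.mul ((hP.const_mul 6).sub_const (4 * π)))
  refine ⟨_, hD, ?_⟩
  simp only [id_eq, Pi.add_apply, mul_one]
  obtain ⟨σ, hσe⟩ : ∃ σ, σ = √(1 - k ^ 2) := ⟨_, rfl⟩
  obtain ⟨s, hse⟩ : ∃ σ, σ = √(1 - c ^ 2) := ⟨_, rfl⟩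
  obtain ⟨P, hPe⟩ : ∃ σ, σ = psi k c := ⟨_, rfl⟩
  rw [← hσe] at hσ hσ2
  rw [← hse] at hs0 hs2
  rw [← hPe] at hpsi
  rw [← hσe, ← hse, ← hPe]
  have hcos : (1 + c - 2 * k ^ 2) ^ 2 / 2 ≤ 1 + c - 2 * k * (c * k + s * σ) := by
    have : (1 + c - 2 * k ^ 2) ^ 2 + (2 * k * σ - s) ^ 2 = 2 * (1 + c - 2 * k * (c * k + s * σ)) := by
      linear_combination (4 * k ^ 2) * hσ2 + hs2
    nlinarith [sq_nonneg (2 * k * σ - s)]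
  have hkc : c < k := by
    by_contra hcon
    push Not at hcon
    nlinarith
  have hσs : σ < s := by
    by_contra hcon
    push Not at hcon
    nlinarith
  have hsk : 0 ≤ s * k / σ - c := by
    rw [sub_nonneg, le_div_iff₀ hσ]; nlinarith
  have h6 : 0 ≤ (s * k / σ - c) * (6 * P - 4 * π) := mul_nonneg hsk (by linarith)
  have h7 : √(1 - c) * ((1 + c - 2 * k ^ 2) ^ 2 / 2) ≤ g * (1 + c - 2 * k * (c * k + s * σ)) := mul_le_mul hg1 hcos (by positivity) hg0.le
  have e : s * (-k / σ) = - (s * k / σ) := by ring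
  rw [e]
  nlinarith

lemma Hf_cont {c : ℝ} (hc : 0 < c) (hc1 : c < 1) : ContinuousOn (Hf c) {k | 2 * k ^ 2 ≤ 1 + c} := by
  have ht : ∀ k ∈ {k : ℝ | 2 * k ^ 2 ≤ 1 + c}, 1 - k ^ 2 ≠ 0 := by
    intro k hk
    simp only [Set.mem_ofPred_eq] at hk
    have : 0 < 1 - k ^ 2 := by nlinarith
    exact this.ne'
  have ht' : ∀ k ∈ {k : ℝ | 2 * k ^ 2 ≤ 1 + c}, √(1 - k ^ 2) * √(1 - c ^ 2) ≠ 0 := by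
    intro k hk
    simp only [Set.mem_ofPred_eq] at hk
    have h1 : 0 < 1 - k ^ 2 := by nlinarith
    have h2 : 0 < 1 - c ^ 2 := by nlinarith
    positivity
  have hp : ContinuousOn (fun k => psi k c) {k | 2 * k ^ 2 ≤ 1 + c} := by
    unfold psi
    apply Real.continuous_arccos.comp_continuousOn
    exact ContinuousOn.div (by fun_prop) (by fun_prop) ht
  have hb : ContinuousOn (fun k => bet k c) {k | 2 * k ^ 2 ≤ 1 + c} := by
    unfold bet
    apply Real.continuous_arccos.comp_continuousOn
    exact ContinuousOn.div (by fun_prop) (by fun_prop) ht'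
  unfold Hf
  fun_prop

lemma Hf_J {c : ℝ} (hc : 0 < c) (hc1 : c < 1) : Hf c (√((1 + 2 * c) / 3)) = 2 * π - 3 * Real.arccos (c / (1 + c)) * (1 + c) := by
  have hk2 : √((1 + 2 * c) / 3) ^ 2 = (1 + 2 * c) / 3 := Real.sq_sqrt (by linarith)
  have hk0 : 0 < √((1 + 2 * c) / 3) := Real.sqrt_pos.2 (by linarith)
  obtain ⟨k, hk⟩ : ∃ k, k = √((1 + 2 * c) / 3) := ⟨_, rfl⟩
  rw [← hk] at hk2 hk0 ⊢
  have hp : psi k c = 2 * π / 3 := by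
    have h3 : Real.cos (2 * π / 3) = -(1 / 2) := by
      rw [show 2 * π / 3 = π - π / 3 by ring, Real.cos_pi_sub, Real.cos_pi_div_three]
    rw [← Real.arccos_cos (x := 2 * π / 3) (by positivity) (by linarith [Real.pi_pos]), h3, psi, hk2]
    congr 1
    rw [div_eq_iff (by linarith)]; ring
  have hs : 0 < 1 - k ^ 2 := by rw [hk2]; linarith
  have hs1 : 0 < 1 - c ^ 2 := by nlinarith
  have hb : 2 * bet k c = Real.arccos (c / (1 + c)) := by
    obtain ⟨b, hb⟩ : ∃ b, b = k * (1 - c) / (√(1 - k ^ 2) * √(1 - c ^ 2)) := ⟨_, rfl⟩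
    have hb0 : 0 ≤ b := by
      rw [hb]; apply div_nonneg (mul_nonneg hk0.le (by linarith)); positivity
    have hb2 : b ^ 2 = (1 + 2 * c) / (2 * (1 + c)) := by
      rw [hb, div_pow, mul_pow, mul_pow, Real.sq_sqrt hs.le, Real.sq_sqrt hs1.le, hk2]
      have : 1 - c ≠ 0 := by linarith
      have e1 : 1 - (1 + 2 * c) / 3 = 2 * (1 - c) / 3 := by ring
      have e2 : 1 - c ^ 2 = (1 - c) * (1 + c) := by ring
      rw [e1, e2]
      field_simp
    have hb1 : b ≤ 1 := by
      apply le_of_sq_le _ zero_le_one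
      rw [hb2, div_le_iff₀ (by linarith)]; linarith
    have hbet : bet k c = Real.arccos b := by rw [bet, hb]
    rw [hbet]
    have h1 := Real.arccos_nonneg b
    have h2 := Real.arccos_le_pi_div_two.2 hb0
    rw [← Real.arccos_cos (x := 2 * Real.arccos b) (by linarith) (by linarith), Real.cos_two_mul, Real.cos_arccos (by linarith) hb1, hb2]
    congr 1
    field_simp; ring
  unfold Hf
  rw [hp, ← hb]
  ring

lemma Hf_C {c : ℝ} (hc : 0 < c) (hc1 : c < 1) : Hf c (√((1 + c) / 2)) = 2 * π * (1 - √((1 + c) / 2)) := by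
  have hC : √((1 + c) / 2) ^ 2 = (1 + c) / 2 := Real.sq_sqrt (by linarith)
  have hC0 : 0 < √((1 + c) / 2) := Real.sqrt_pos.2 (by linarith)
  obtain ⟨k, hk⟩ : ∃ k, k = √((1 + c) / 2) := ⟨_, rfl⟩
  rw [← hk] at hC hC0 ⊢
  have e1 : 1 - k ^ 2 = (1 - c) / 2 := by linarith
  have hS : √((1 - c) / 2) ^ 2 = (1 - c) / 2 := Real.sq_sqrt (by linarith)
  have hS0 : 0 < √((1 - c) / 2) := Real.sqrt_pos.2 (by linarith)
  obtain ⟨S, hSe⟩ : ∃ S, S = √((1 - c) / 2) := ⟨_, rfl⟩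
  rw [← hSe] at hS hS0
  have e2 : √(1 - c ^ 2) = 2 * S * k := by
    rw [show 1 - c ^ 2 = (2 * S * k) ^ 2 by rw [mul_pow, mul_pow, hS, hC]; ring]
    exact Real.sqrt_sq (by positivity)
  have hp : psi k c = π := by
    rw [psi, e1, hC, ← Real.arccos_neg_one]; congr 1
    rw [div_eq_iff (by linarith)]; ring
  have hb : bet k c = 0 := by
    rw [bet, e1, ← hSe, e2, ← Real.arccos_one]; congr 1
    rw [div_eq_iff (by positivity)]
    have : 1 - c = 2 * S ^ 2 := by linarith
    rw [this]; ring
  unfold Hf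
  rw [hp, hb, e1, ← hSe, e2]
  have : 1 - (c * k + 2 * S * k * S) = 1 - k := by
    have : S ^ 2 = (1 - c) / 2 := hS
    linear_combination (-2 * k) * this
  rw [this]; ring

theorem Hf_main {c : ℝ} (hc : 0 < c) (hc1 : c < 1) : ∃ κ > 0, ∀ k : ℝ, 0 < k → (1 + 2 * c) / 3 ≤ k ^ 2 → 2 * k ^ 2 ≤ 1 + c →
    2 * π - 3 * Real.arccos (c / (1 + c)) * (1 + c) + κ * (k - √((1 + 2 * c) / 3)) ≤ Hf c k := by
  rw [← Hf_J hc hc1]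
  have hJ2 : √((1 + 2 * c) / 3) ^ 2 = (1 + 2 * c) / 3 := Real.sq_sqrt (by linarith)
  have hJ0 : 0 < √((1 + 2 * c) / 3) := Real.sqrt_pos.2 (by linarith)
  have hC2 : √((1 + c) / 2) ^ 2 = (1 + c) / 2 := Real.sq_sqrt (by linarith)
  have hC0 : 0 < √((1 + c) / 2) := Real.sqrt_pos.2 (by linarith)
  obtain ⟨J, hJ⟩ : ∃ J, J = √((1 + 2 * c) / 3) := ⟨_, rfl⟩
  obtain ⟨C, hC⟩ : ∃ C, C = √((1 + c) / 2) := ⟨_, rfl⟩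
  rw [← hJ] at hJ2 hJ0 ⊢
  rw [← hC] at hC2 hC0
  have hJC : J < C := by
    by_contra hcon
    push Not at hcon
    nlinarith
  obtain ⟨m, hm⟩ : ∃ m, m = (J + C) / 2 := ⟨_, rfl⟩
  have hJm : J < m := by linarith
  have hmC : m < C := by linarith
  obtain ⟨κ, hκ⟩ : ∃ κ, κ = 3 * √(1 - c) * (1 + c - 2 * m ^ 2) ^ 2 := ⟨_, rfl⟩
  have hm2 : 0 < 1 + c - 2 * m ^ 2 := by nlinarith
  have hκ0 : 0 < κ := by
    have : 0 < √(1 - c) := Real.sqrt_pos.2 (by linarith)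
    rw [hκ]; positivity
  have dom : ∀ x ∈ Set.Icc J C, 2 * x ^ 2 ≤ 1 + c ∧ (1 + 2 * c) / 3 ≤ x ^ 2 := by
    rintro x ⟨h1, h2⟩
    constructor <;> nlinarith
  have dom' : ∀ x ∈ Set.Ioo J C, 2 * x ^ 2 < 1 + c := by
    rintro x ⟨h1, h2⟩
    nlinarith
  have cont : ContinuousOn (Hf c) (Set.Icc J C) := (Hf_cont hc hc1).mono fun x hx => (dom x hx).1
  have mono1 : MonotoneOn (Hf c) (Set.Icc J C) := by
    apply monotoneOn_of_deriv_nonneg (convex_Icc _ _) cont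
    · rw [interior_Icc]
      intro x hx
      obtain ⟨D, hD, -⟩ := Hf_deriv hc hc1 (dom' x hx) (dom x ⟨hx.1.le, hx.2.le⟩).2 (hJ0.trans hx.1)
      exact hD.differentiableAt.differentiableWithinAt
    · rw [interior_Icc]
      intro x hx
      obtain ⟨D, hD, hD2⟩ := Hf_deriv hc hc1 (dom' x hx) (dom x ⟨hx.1.le, hx.2.le⟩).2 (hJ0.trans hx.1)
      rw [hD.deriv]
      exact le_trans (by positivity) hD2
  have mono2 : MonotoneOn (fun x => Hf c x - κ * x) (Set.Icc J m) := by
    have hsub : Set.Icc J m ⊆ Set.Icc J C := Set.Icc_subset_Icc_right hmC.le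
    apply monotoneOn_of_deriv_nonneg (convex_Icc _ _) ((cont.mono hsub).sub (by fun_prop))
    · rw [interior_Icc]
      intro x hx
      obtain ⟨D, hD, -⟩ := Hf_deriv hc hc1 (dom' x ⟨hx.1, hx.2.trans hmC⟩) (dom x ⟨hx.1.le, (hx.2.trans hmC).le⟩).2 (hJ0.trans hx.1)
      exact (hD.differentiableAt.sub (by fun_prop)).differentiableWithinAt
    · rw [interior_Icc]
      intro x hx
      obtain ⟨D, hD, hD2⟩ := Hf_deriv hc hc1 (dom' x ⟨hx.1, hx.2.trans hmC⟩) (dom x ⟨hx.1.le, (hx.2.trans hmC).le⟩).2 (hJ0.trans hx.1)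
      have hd : HasDerivAt (fun x => Hf c x - κ * x) (D - κ) x := by
        exact (hD.sub ((hasDerivAt_id x).const_mul κ)).congr_deriv (by simp)
      change 0 ≤ deriv (fun x => Hf c x - κ * x) x
      rw [hd.deriv, sub_nonneg]
      refine le_trans ?_ hD2
      rw [hκ]
      have : 1 + c - 2 * m ^ 2 ≤ 1 + c - 2 * x ^ 2 := by nlinarith [hx.1, hx.2]
      gcongr
  refine ⟨κ / 2, by positivity, fun k hk0 hk1 hk2 => ?_⟩
  have kJ : J ≤ k := le_of_sq_le (by linarith) hk0.le
  have kC : k ≤ C := le_of_sq_le (by linarith) hC0.le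
  rcases le_total k m with h | h
  · have := mono2 ⟨le_rfl, hJm.le⟩ ⟨kJ, h⟩ kJ
    simp only at this
    nlinarith
  · have h1 := mono2 ⟨le_rfl, hJm.le⟩ ⟨hJm.le, le_rfl⟩ hJm.le
    have h2 := mono1 ⟨hJm.le, hmC.le⟩ ⟨kJ, kC⟩ h
    simp only at h1
    nlinarith

end PalAux

/-! Part P6b -/

namespace PalAux

lemma compl_lower {c : ℝ} (hc : 0 < c) (hc1 : c < 1) : ∃ κ > 0, ∀ M : Set (E 2), Compl M c → M.Nonempty →
    2 * π - 3 * Real.arccos (c / (1 + c)) * (1 + c) + κ ≤ sg.real M ∨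
    ∃ (p : E 2) (k : ℝ), ‖p‖ = 1 ∧ 0 < k ∧ (∀ y ∈ M, k ≤ ⟪p, y⟫) ∧
      ∃ m1 ∈ M, ∃ m2 ∈ M, ∃ m3 ∈ M, ∃ l1 l2 l3 : ℝ, Ctc p m1 m2 m3 k c l1 l2 l3 ∧
      2 * π - 3 * Real.arccos (c / (1 + c)) * (1 + c) + κ * (k ^ 2 - (1 + 2 * c) / 3) ≤ sg.real M := by
  obtain ⟨κ, hκ, hmain⟩ := Hf_main hc hc1
  obtain ⟨J, hJ⟩ : ∃ J, J = √((1 + 2 * c) / 3) := ⟨_, rfl⟩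
  obtain ⟨C, hC⟩ : ∃ C, C = √((1 + c) / 2) := ⟨_, rfl⟩
  have J0 : 0 < J := by rw [hJ]; exact Real.sqrt_pos.2 (by positivity)
  have C0 : 0 < C := by rw [hC]; exact Real.sqrt_pos.2 (by positivity)
  have J2 : J ^ 2 = (1 + 2 * c) / 3 := by rw [hJ]; exact Real.sq_sqrt (by positivity)
  have C2 : C ^ 2 = (1 + c) / 2 := by rw [hC]; exact Real.sq_sqrt (by positivity)
  have JC : J < C := by nlinarith
  have J1 : J < 1 := by nlinarith
  refine ⟨min (κ * (C - J)) (κ / 2), lt_min (mul_pos hκ (by linarith)) (by positivity), fun M hM hne => ?_⟩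
  obtain ⟨p, k, hp, hk, hpk, h⟩ := exists_ctc hM.closed hne hc hc1 (fun m hm => hM.unit hm) (fun m hm v hv => hM.inn hm hv)
  rcases le_or_gt (1 + c) (2 * k ^ 2) with h1 | h1
  · left
    have h2 := area_small hp hc hc1 hk h1 hM hpk
    have h3 := hmain C C0 (by nlinarith) (by nlinarith)
    rw [hC, Hf_C hc hc1, ← hC, ← hJ] at h3
    rw [← hC] at h2
    have := min_le_left (κ * (C - J)) (κ / 2)
    linarith
  · right
    rcases h with h | ⟨m1, M1, m2, M2, m3, M3, l1, l2, l3, h⟩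
    · linarith
    refine ⟨p, k, hp, hk, hpk, m1, M1, m2, M2, m3, M3, l1, l2, l3, h, ?_⟩
    have h4 := h.jung hc1
    have h2 := h.area hc hc1 (s := √(1 - c ^ 2)) (σ := √(1 - k ^ 2)) (Real.sqrt_pos.2 (by nlinarith))
      (by rw [Real.sq_sqrt (by nlinarith)]; ring) (Real.sqrt_pos.2 (by nlinarith))
      (by rw [Real.sq_sqrt (by nlinarith)]; ring) h1 hM M1 M2 M3 hpk
    have h3 := hmain k hk h4 h1.le
    rw [← hJ, Hf] at h3
    have := min_le_right (κ * (C - J)) (κ / 2)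
    have k1 : k < 1 := by nlinarith
    have kJ : J ≤ k := le_of_sq_le (by linarith) hk.le
    have e1 : min (κ * (C - J)) (κ / 2) * (k ^ 2 - (1 + 2 * c) / 3) ≤ κ / 2 * (k ^ 2 - (1 + 2 * c) / 3) :=
      mul_le_mul_of_nonneg_right this (by linarith)
    have e2 : κ / 2 * (k ^ 2 - (1 + 2 * c) / 3) ≤ κ * (k - J) := by
      rw [← J2]
      have : 0 ≤ κ * (k - J) * (2 - (k + J)) := by
        apply mul_nonneg (mul_nonneg hκ.le _) <;> linarith
      nlinarith
    linarith

/-- area of the polar of a complete set is at least the Reuleaux one. -/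
lemma pol_lower {c s : ℝ} (hc : 0 < c) (hc1 : c < 1) (hs : 0 < s) (hcs : c ^ 2 + s ^ 2 = 1) {M : Set (E 2)}
    (hM : Compl M c) (hne : M.Nonempty) :
    2 * π - 3 * Real.arccos (c / (1 + c)) * s ≤ sg.real (PolS M) := by
  have h1 := steiner hne hc hc1 hs hcs (fun m hm => hM.unit hm) (fun m hm v hv => hM.inn hm hv)
  obtain ⟨κ, hκ, h2⟩ := compl_lower hc hc1
  have h3 : 2 * π - 3 * Real.arccos (c / (1 + c)) * (1 + c) ≤ sg.real M := by
    rcases h2 M hM hne with h | ⟨p, k, hp, hk, hpk, m1, M1, m2, M2, m3, M3, l1, l2, l3, h, h5⟩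
    · linarith
    · have := mul_nonneg hκ.le (sub_nonneg.2 (h.jung hc1))
      linarith
  have h4 := mul_le_mul_of_nonneg_left h3 hs.le
  have : (1 + c) * (2 * π - 3 * Real.arccos (c / (1 + c)) * s) ≤ (1 + c) * sg.real (PolS M) := by nlinarith
  exact le_of_mul_le_mul_left this (by linarith)

lemma ctc_close {c s : ℝ} (hc : 0 < c) (hc1 : c < 1) (hs : 0 < s) (hcs : c ^ 2 + s ^ 2 = 1) :
    ∃ C > 0, ∃ ε0 > 0, ∀ M : Set (E 2), Compl M c → M.Nonempty → ∀ ε : ℝ, 0 < ε → ε < ε0 →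
      sg.real (PolS M) ≤ 2 * π - 3 * Real.arccos (c / (1 + c)) * s + ε →
    ∃ (p : E 2) (k : ℝ), ‖p‖ = 1 ∧ 0 < k ∧ (∀ y ∈ M, k ≤ ⟪p, y⟫) ∧
      ∃ m1 ∈ M, ∃ m2 ∈ M, ∃ m3 ∈ M, ∃ l1 l2 l3 : ℝ, Ctc p m1 m2 m3 k c l1 l2 l3 ∧
      k ^ 2 - (1 + 2 * c) / 3 ≤ C * ε := by
  obtain ⟨κ, hκ, h2⟩ := compl_lower hc hc1
  refine ⟨(1 + c) / (s * κ), by positivity, s * κ / (1 + c), by positivity, fun M hM hne ε hε hε0 hA => ?_⟩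
  have h1 := steiner hne hc hc1 hs hcs (fun m hm => hM.unit hm) (fun m hm v hv => hM.inn hm hv)
  have h3 : s * (sg.real M - (2 * π - 3 * Real.arccos (c / (1 + c)) * (1 + c))) ≤ (1 + c) * ε := by
    have := mul_le_mul_of_nonneg_left hA (show 0 ≤ 1 + c by linarith)
    nlinarith
  rcases h2 M hM hne with h | ⟨p, k, hp, hk, hpk, m1, M1, m2, M2, m3, M3, l1, l2, l3, h, h5⟩
  · exfalso
    rw [lt_div_iff₀ (by linarith)] at hε0
    have := mul_le_mul_of_nonneg_left (show κ ≤ sg.real M - (2 * π - 3 * Real.arccos (c / (1 + c)) * (1 + c)) by linarith) hs.le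
    linarith
  · refine ⟨p, k, hp, hk, hpk, m1, M1, m2, M2, m3, M3, l1, l2, l3, h, ?_⟩
    have := mul_le_mul_of_nonneg_left (show κ * (k ^ 2 - (1 + 2 * c) / 3) ≤ sg.real M - (2 * π - 3 * Real.arccos (c / (1 + c)) * (1 + c)) by linarith) hs.le
    rw [div_mul_eq_mul_div, le_div_iff₀ (by positivity)]
    linarith

end PalAux

/-! Part P7a -/

namespace PalAux

lemma ns1 {a b c f δ : ℝ} (hc : 0 ≤ c) (c1 : c ≤ 1) (aa : a ≤ 1) (a1 : c ≤ a) (a2 : a ≤ c + δ) (f1 : c ≤ f) (f2 : f ≤ c + δ) :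
    0 ≤ a * f - c ^ 2 ∧ a * f - c ^ 2 ≤ 2 * δ := by
  have e : a * f - c ^ 2 = a * (f - c) + c * (a - c) := by ring
  have h1 : 0 ≤ a * (f - c) := mul_nonneg (by linarith) (by linarith)
  have h2 : 0 ≤ c * (a - c) := mul_nonneg hc (by linarith)
  have h3 : a * (f - c) ≤ 1 * δ := mul_le_mul aa (by linarith) (by linarith) (by linarith)
  have h4 : c * (a - c) ≤ 1 * δ := mul_le_mul c1 (by linarith) (by linarith) (by linarith)
  constructor <;> linarith

lemma ns2 {s x D : ℝ} (hs : 0 ≤ s) (hs1 : s ≤ 1) (h1 : |x| ≤ D) : -D ≤ s * x ∧ s * x ≤ D := by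
  rw [← abs_le, abs_mul, abs_of_nonneg hs]
  nlinarith [abs_nonneg x]

lemma ns3 {s x D : ℝ} (hs : 0 ≤ s) (hs1 : s ≤ 1) (h : x ≤ D) (hx : 0 ≤ x) : s * x ≤ D := by
  nlinarith

set_option maxHeartbeats 2000000 in
lemma near_scalar {c s a b f g h g0 h0 δ : ℝ} (hc : 0 < c) (hs : 0 < s) (hcs : c ^ 2 + s ^ 2 = 1)
    (hab : a ^ 2 + b ^ 2 = 1) (hb : 0 ≤ b) (hfgh : f ^ 2 + g ^ 2 + h ^ 2 = 1) (hh : 0 ≤ h)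
    (a1 : c ≤ a) (a2 : a ≤ c + δ) (f1 : c ≤ f) (f2 : f ≤ c + δ) (q1 : c ≤ a * f + b * g) (q2 : a * f + b * g ≤ c + δ)
    (hg0 : s * g0 = c - c ^ 2) (hh0 : 0 ≤ h0) (h0s : c ^ 2 + g0 ^ 2 + h0 ^ 2 = 1) (hδ : 0 ≤ δ) (hδ1 : δ ≤ 1) :
    s ^ 4 * ((a - c) ^ 2 + (b - s) ^ 2) ≤ 49 * δ ∧
    s ^ 4 * ((f - c) ^ 2 + (g - g0) ^ 2 + (h - h0) ^ 2) ≤ 49 * δ := by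
  have c1 : c ≤ 1 := by nlinarith
  have s1 : s ≤ 1 := by nlinarith
  have aa : a ≤ 1 := by nlinarith
  have ff : f ≤ 1 := by nlinarith
  have g1 : |g| ≤ 1 := by rw [← sq_le_one_iff_abs_le_one]; nlinarith
  have g01 : |g0| ≤ 1 := by rw [← sq_le_one_iff_abs_le_one]; nlinarith
  obtain ⟨g1l, g1u⟩ := abs_le.1 g1
  obtain ⟨g2l, g2u⟩ := abs_le.1 g01
  have bs : b ≤ s := le_of_sq_le (by nlinarith) hs.le
  have acd := (ns1 (b := b) hc.le c1 aa a1 a2 a1 a2).2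
  have X : s * (s - b) ≤ 2 * δ := by
    have e : s * (s - b) = (a * a - c ^ 2) - b * (s - b) := by linear_combination hcs - hab
    have := mul_nonneg hb (sub_nonneg.2 bs)
    linarith
  have X0 : 0 ≤ s * (s - b) := mul_nonneg hs.le (by linarith)
  obtain ⟨af0, af1⟩ := ns1 (b := b) hc.le c1 aa a1 a2 f1 f2
  have Y : s ^ 2 * (g - g0) = s * (b * g - s * g0) + s * (s - b) * g := by ring
  have Z1 : b * g - s * g0 ≤ 3 * δ := by rw [hg0]; linarith
  have Z2 : -(3 * δ) ≤ b * g - s * g0 := by rw [hg0]; linarith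
  obtain ⟨W2, W1⟩ := ns2 hs.le s1 (abs_le.2 ⟨Z2, Z1⟩)
  obtain ⟨V2, V1⟩ : -(2 * δ) ≤ s * (s - b) * g ∧ s * (s - b) * g ≤ 2 * δ := by
    rw [← abs_le, abs_mul, abs_of_nonneg X0]
    calc _ ≤ (2 * δ) * 1 := mul_le_mul X g1 (abs_nonneg _) (by linarith)
      _ = _ := by ring
  have Y1 : s ^ 2 * (g - g0) ≤ 5 * δ := by linarith
  have Y2 : -(5 * δ) ≤ s ^ 2 * (g - g0) := by linarith
  have s2 : s ^ 2 ≤ 1 := by nlinarith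
  have s4 : s ^ 4 ≤ 1 := by nlinarith [sq_nonneg s]
  have s40 : 0 ≤ s ^ 4 := by positivity
  have s20 : 0 ≤ s ^ 2 := by positivity
  have dd : δ ^ 2 ≤ δ := by nlinarith
  have G : s ^ 4 * (g - g0) ^ 2 ≤ 25 * δ := by
    have : (s ^ 2 * (g - g0)) ^ 2 ≤ (5 * δ) ^ 2 := sq_le_sq' Y2 Y1
    linarith [show (s ^ 2 * (g - g0)) ^ 2 = s ^ 4 * (g - g0) ^ 2 by ring, show (5 * δ) ^ 2 = 25 * δ ^ 2 by ring]
  have F : s ^ 4 * (f - c) ^ 2 ≤ δ := by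
    have : (f - c) ^ 2 ≤ δ ^ 2 := sq_le_sq' (by linarith) (by linarith)
    exact ns3 s40 s4 (by linarith) (sq_nonneg _)
  have A : s ^ 4 * (a - c) ^ 2 ≤ δ := by
    have : (a - c) ^ 2 ≤ δ ^ 2 := sq_le_sq' (by linarith) (by linarith)
    exact ns3 s40 s4 (by linarith) (sq_nonneg _)
  have B : s ^ 4 * (b - s) ^ 2 ≤ 4 * δ := by
    have h1 : (s * (s - b)) ^ 2 ≤ (2 * δ) ^ 2 := sq_le_sq' (by linarith) X
    have : s ^ 4 * (b - s) ^ 2 = s ^ 2 * (s * (s - b)) ^ 2 := by ring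
    rw [this]
    exact ns3 s20 s2 (by linarith [show (2 * δ) ^ 2 = 4 * δ ^ 2 by ring]) (sq_nonneg _)
  have D : s ^ 2 * (h ^ 2 - h0 ^ 2) = s ^ 2 * (c ^ 2 - f ^ 2) - (s ^ 2 * (g - g0)) * (g + g0) := by
    rw [show h ^ 2 = 1 - f ^ 2 - g ^ 2 by linarith, show h0 ^ 2 = 1 - c ^ 2 - g0 ^ 2 by linarith]; ring
  obtain ⟨t, ht⟩ : ∃ t, t = s ^ 2 * (g - g0) := ⟨_, rfl⟩
  have T : |t * (g + g0)| ≤ 10 * δ := by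
    rw [abs_mul]
    have h1 : |t| ≤ 5 * δ := abs_le.2 ⟨by linarith, by linarith⟩
    have h2 : |g + g0| ≤ 2 := (abs_add_le _ _).trans (by linarith)
    calc _ ≤ (5 * δ) * 2 := mul_le_mul h1 h2 (abs_nonneg _) (by linarith)
      _ = _ := by ring
  obtain ⟨T1, T2⟩ := abs_le.1 T
  obtain ⟨E0, E1⟩ : 0 ≤ f ^ 2 - c ^ 2 ∧ f ^ 2 - c ^ 2 ≤ 2 * δ := by
    have := ns1 (b := b) hc.le c1 ff f1 f2 f1 f2
    rwa [← sq] at this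
  have E2 : s ^ 2 * (f ^ 2 - c ^ 2) ≤ 2 * δ := ns3 s20 s2 E1 E0
  have E3 : 0 ≤ s ^ 2 * (f ^ 2 - c ^ 2) := by positivity
  rw [← ht] at D
  have H : s ^ 2 * (h - h0) ^ 2 ≤ 12 * δ := by
    rcases le_total h h0 with k | k
    · have : (h - h0) ^ 2 ≤ h0 ^ 2 - h ^ 2 := by nlinarith only [k, hh]
      have := mul_le_mul_of_nonneg_left this s20
      linarith
    · have : (h - h0) ^ 2 ≤ h ^ 2 - h0 ^ 2 := by nlinarith only [k, hh0]
      have := mul_le_mul_of_nonneg_left this s20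
      linarith
  have H' : s ^ 4 * (h - h0) ^ 2 ≤ 12 * δ := by
    have : s ^ 4 * (h - h0) ^ 2 = s ^ 2 * (s ^ 2 * (h - h0) ^ 2) := by ring
    rw [this]
    exact ns3 s20 s2 H (mul_nonneg s20 (sq_nonneg _))
  constructor
  · rw [mul_add]; linarith
  · rw [mul_add, mul_add]; linarith

lemma on_inner {e1 e2 e3 : E 2} (h1 : ‖e1‖ = 1) (h2 : ‖e2‖ = 1) (h3 : ‖e3‖ = 1) (h12 : ⟪e1, e2⟫ = 0)
    (h13 : ⟪e1, e3⟫ = 0) (h23 : ⟪e2, e3⟫ = 0) (a b c a' b' c' : ℝ) :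
    ⟪a • e1 + b • e2 + c • e3, a' • e1 + b' • e2 + c' • e3⟫ = a * a' + b * b' + c * c' := by
  have i1 := inner_self_one h1
  have i2 := inner_self_one h2
  have i3 := inner_self_one h3
  simp only [inner_add_left, inner_add_right, real_inner_smul_left, real_inner_smul_right, i1, i2, i3, h12, h13, h23,
    real_inner_comm e1 e2, real_inner_comm e1 e3, real_inner_comm e2 e3]
  ring

set_option maxHeartbeats 1000000 in
lemma reg_near {c s δ : ℝ} (hc : 0 < c) (hc1 : c < 1) (hs : 0 < s) (hcs : c ^ 2 + s ^ 2 = 1) (hδ : 0 ≤ δ) (hδ1 : c + δ < 1)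
    {m1 m2 m3 : E 2} (h1 : ‖m1‖ = 1) (h2 : ‖m2‖ = 1) (h3 : ‖m3‖ = 1)
    (a12 : c ≤ ⟪m1, m2⟫) (b12 : ⟪m1, m2⟫ ≤ c + δ) (a13 : c ≤ ⟪m1, m3⟫) (b13 : ⟪m1, m3⟫ ≤ c + δ)
    (a23 : c ≤ ⟪m2, m3⟫) (b23 : ⟪m2, m3⟫ ≤ c + δ) :
    ∃ y1 y2 y3 : E 2, Reg y1 y2 y3 c ∧ ‖y1 - m1‖ ≤ 7 * √δ / s ^ 2 ∧ ‖y2 - m2‖ ≤ 7 * √δ / s ^ 2 ∧ ‖y3 - m3‖ ≤ 7 * √δ / s ^ 2 := by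
  obtain ⟨a, ha⟩ : ∃ a, a = ⟪m1, m2⟫ := ⟨_, rfl⟩
  obtain ⟨b, hb⟩ : ∃ b, b = ‖pj m1 m2‖ := ⟨_, rfl⟩
  have b2 : b ^ 2 = 1 - a ^ 2 := by rw [hb, pj_norm h1 h2, ha, real_inner_comm]
  have b0 : 0 ≤ b := by rw [hb]; exact norm_nonneg _
  have bp : 0 < b := by
    rcases b0.lt_or_eq with h | h
    · exact h
    · rw [← h] at b2; nlinarith
  have pne : pj m1 m2 ≠ 0 := by rw [← norm_pos_iff, ← hb]; exact bp
  obtain ⟨τ, hτ⟩ : ∃ τ, τ = nrm (pj m1 m2) := ⟨_, rfl⟩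
  have τ1 : ‖τ‖ = 1 := by rw [hτ]; exact norm_nrm pne
  have bτ : b • τ = pj m1 m2 := by rw [hb, hτ, norm_smul_nrm]
  have m2e : m2 = a • m1 + b • τ := by rw [bτ, pj, ha, real_inner_comm]; abel
  have mτ : ⟪m1, τ⟫ = 0 := by
    have : ⟪b • τ, m1⟫ = 0 := by rw [bτ]; exact pj_inner h1 m2
    rw [real_inner_smul_left, real_inner_comm] at this
    rcases mul_eq_zero.1 this with h | h
    · linarith
    · exact h
  have hν : ∃ ν : E 2, ‖ν‖ = 1 ∧ ⟪m1, ν⟫ = 0 ∧ ⟪τ, ν⟫ = 0 ∧ 0 ≤ ⟪ν, m3⟫ := by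
    have n1 : ‖cr m1 τ‖ = 1 := by
      apply norm_one_of_inner
      rw [← binet, inner_self_one h1, inner_self_one τ1, mτ]; norm_num
    rcases le_total 0 ⟪cr m1 τ, m3⟫ with h | h
    · exact ⟨cr m1 τ, n1, by rw [real_inner_comm, cr_self_left], by rw [real_inner_comm, cr_self_right], h⟩
    · exact ⟨-cr m1 τ, by rw [norm_neg, n1], by rw [inner_neg_right, real_inner_comm, cr_self_left, neg_zero],
        by rw [inner_neg_right, real_inner_comm, cr_self_right, neg_zero], by rw [inner_neg_left]; linarith⟩
  obtain ⟨ν, ν1, mν, τν, hh⟩ := hν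
  obtain ⟨f, hf⟩ : ∃ f, f = ⟪m1, m3⟫ := ⟨_, rfl⟩
  obtain ⟨g, hg⟩ : ∃ f, f = ⟪τ, m3⟫ := ⟨_, rfl⟩
  obtain ⟨h, hhe⟩ : ∃ f, f = ⟪ν, m3⟫ := ⟨_, rfl⟩
  have m3e : m3 = f • m1 + g • τ + h • ν := by
    have := ext_frame ν1 h1 τ1 (by rw [real_inner_comm]; exact mν) (by rw [real_inner_comm]; exact τν) mτ m3
    rw [← hf, ← hg, ← hhe] at this
    exact this
  have on := on_inner h1 τ1 ν1 mτ mν τν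
  have nfgh : f ^ 2 + g ^ 2 + h ^ 2 = 1 := by
    have e := inner_self_one h3
    rw [m3e, on] at e
    linarith
  have e23 : ⟪m2, m3⟫ = a * f + b * g := by
    have := on a b 0 f g h
    rw [← m3e] at this
    rw [m2e]
    simpa using this
  rw [e23] at a23 b23
  rw [← ha] at a12 b12
  rw [← hf] at a13 b13
  rw [← hhe] at hh
  obtain ⟨g0, hg0⟩ : ∃ g0, g0 = (c - c ^ 2) / s := ⟨_, rfl⟩
  have sg0 : s * g0 = c - c ^ 2 := by rw [hg0]; field_simp
  have g0s : g0 ^ 2 ≤ 1 - c ^ 2 := by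
    have : (s * g0) ^ 2 ≤ s ^ 2 * s ^ 2 := by
      rw [sg0, show s ^ 2 = 1 - c ^ 2 by linarith]
      have e : (1 - c ^ 2) * (1 - c ^ 2) - (c - c ^ 2) ^ 2 = (1 - c) ^ 2 * (1 + 2 * c) := by ring
      nlinarith [mul_nonneg (sq_nonneg (1 - c)) (show 0 ≤ 1 + 2 * c by linarith)]
    rw [mul_pow] at this
    have := le_of_mul_le_mul_left this (by positivity)
    linarith
  obtain ⟨h0, hh0⟩ : ∃ h0, h0 = √(1 - c ^ 2 - g0 ^ 2) := ⟨_, rfl⟩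
  have h0n : 0 ≤ h0 := by rw [hh0]; exact Real.sqrt_nonneg _
  have h0s : h0 ^ 2 = 1 - c ^ 2 - g0 ^ 2 := by rw [hh0]; exact Real.sq_sqrt (by linarith)
  obtain ⟨N2, N3⟩ := near_scalar hc hs hcs (by linarith) b0 nfgh hh a12 b12 a13 b13 a23 b23 sg0 h0n (by linarith) hδ (by linarith)
  have key : ∀ z : E 2, s ^ 4 * ⟪z, z⟫ ≤ 49 * δ → ‖z‖ ≤ 7 * √δ / s ^ 2 := by
    intro z hz
    rw [le_div_iff₀ (by positivity)]
    apply le_of_sq_le _ (by positivity)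
    rw [mul_pow, mul_pow, Real.sq_sqrt hδ, ← real_inner_self_eq_norm_sq]
    linarith [show ⟪z, z⟫ * (s ^ 2) ^ 2 = s ^ 4 * ⟪z, z⟫ by ring]
  have y1e : m1 = (1:ℝ) • m1 + (0:ℝ) • τ + (0:ℝ) • ν := by simp
  refine ⟨m1, c • m1 + s • τ + (0:ℝ) • ν, c • m1 + g0 • τ + h0 • ν, ⟨h1, ?_, ?_, ?_, ?_, ?_⟩, ?_, ?_, ?_⟩
  · apply norm_one_of_inner; rw [on]; linarith
  · apply norm_one_of_inner; rw [on]; linarith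
  · nth_rewrite 1 [y1e]; rw [on]; ring
  · nth_rewrite 1 [y1e]; rw [on]; ring
  · rw [on]; linarith
  · rw [sub_self, norm_zero]; positivity
  · apply key
    have e : c • m1 + s • τ + (0:ℝ) • ν - m2 = (c - a) • m1 + (s - b) • τ + (0:ℝ) • ν := by rw [m2e]; module
    rw [e, on]
    linarith
  · apply key
    have e : c • m1 + g0 • τ + h0 • ν - m3 = (c - f) • m1 + (g0 - g) • τ + (h0 - h) • ν := by
      nth_rewrite 1 [m3e]; module
    rw [e, on]
    linarith

/-- the Reuleaux triangle has diameter at most that of its side. -/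
lemma reu_diam_aux {x1 x2 x3 y z : E 2} {c : ℝ} (hc : 0 < c) (hc1 : c < 1) (h : Reg x1 x2 x3 c)
    (hy : y ∈ Reu x1 x2 x3 c) (hz : z ∈ Reu x1 x2 x3 c) {α β γ : ℝ} (e : z = α • x1 + β • x2 + γ • x3)
    (ha : α ≤ 0) : c ≤ ⟪y, z⟫ := by
  obtain ⟨hy1, y1, y2, y3⟩ := hy
  obtain ⟨hz1, z1, z2, z3⟩ := hz
  have i1 := inner_self_one h.h1
  have i2 := inner_self_one h.h2
  have i3 := inner_self_one h.h3
  have h21 : ⟪x2, x1⟫ = c := by rw [real_inner_comm]; exact h.h12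
  have h31 : ⟪x3, x1⟫ = c := by rw [real_inner_comm]; exact h.h13
  have h32 : ⟪x3, x2⟫ = c := by rw [real_inner_comm]; exact h.h23
  have u1 : ⟪x1, z⟫ = α + c * β + c * γ := by
    rw [e]; simp only [inner_add_right, real_inner_smul_right, i1, h.h12, h.h13]; ring
  have u2 : ⟪x2, z⟫ = c * α + β + c * γ := by
    rw [e]; simp only [inner_add_right, real_inner_smul_right, i2, h21, h.h23]; ring
  have u3 : ⟪x3, z⟫ = c * α + c * β + γ := by
    rw [e]; simp only [inner_add_right, real_inner_smul_right, i3, h31, h32]; ring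
  have v : ⟪y, z⟫ = α * ⟪x1, y⟫ + β * ⟪x2, y⟫ + γ * ⟪x3, y⟫ := by
    rw [e]; simp only [inner_add_right, real_inner_smul_right, real_inner_comm]
  have b1 := inner_le1 hy1 h.h1
  have b2 := inner_le1 hy1 h.h2
  have b3 := inner_le1 hy1 h.h3
  have d1 := inner_le1 hz1 h.h1
  have d2 := inner_le1 hz1 h.h2
  have d3 := inner_le1 hz1 h.h3
  rw [u1] at z1 d1
  rw [u2] at z2 d2
  rw [u3] at z3 d3
  rw [v]
  have p1 : α ≤ α * ⟪x1, y⟫ := by nlinarith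
  rcases le_or_gt 0 β with hb | hb
  · rcases le_or_gt 0 γ with hg | hg
    · nlinarith
    · exfalso
      have k1 := mul_le_mul_of_nonneg_left d2 hc.le
      have k2 := mul_nonneg (mul_nonneg (neg_nonneg.2 ha) hc.le) (sub_nonneg.2 hc1.le)
      have k3 := mul_pos (neg_pos.2 hg) (show 0 < 1 - c ^ 2 by nlinarith only [hc, hc1])
      linarith
  · exfalso
    rcases le_or_gt 0 γ with hg | hg
    · have k1 := mul_le_mul_of_nonneg_left d3 hc.le
      have k2 := mul_nonneg (mul_nonneg (neg_nonneg.2 ha) hc.le) (sub_nonneg.2 hc1.le)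
      have k3 := mul_pos (neg_pos.2 hb) (show 0 < 1 - c ^ 2 by nlinarith only [hc, hc1])
      linarith
    · nlinarith only [z1, ha, hb, hg, hc]

lemma reu_diam {x1 x2 x3 y z : E 2} {c : ℝ} (hc : 0 < c) (hc1 : c < 1) (h : Reg x1 x2 x3 c)
    (hy : y ∈ Reu x1 x2 x3 c) (hz : z ∈ Reu x1 x2 x3 c) : c ≤ ⟪y, z⟫ := by
  obtain ⟨α, β, γ, e⟩ := (h.LI hc hc1).span z
  rcases le_or_gt α 0 with ha | ha
  · exact reu_diam_aux hc hc1 h hy hz e ha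
  rcases le_or_gt β 0 with hb | hb
  · rw [reu_rot] at hy hz
    exact reu_diam_aux hc hc1 h.rot hy hz (α := β) (β := γ) (γ := α) (by rw [e]; abel) hb
  rcases le_or_gt γ 0 with hg | hg
  · rw [reu_rot, reu_rot] at hy hz
    exact reu_diam_aux hc hc1 h.rot.rot hy hz (α := γ) (β := α) (γ := β) (by rw [e]; abel) hg
  obtain ⟨hy1, y1, y2, y3⟩ := hy
  have v : ⟪y, z⟫ = α * ⟪x1, y⟫ + β * ⟪x2, y⟫ + γ * ⟪x3, y⟫ := by
    rw [e]; simp only [inner_add_right, real_inner_smul_right, real_inner_comm]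
  have n : 1 ≤ α + β + γ := by
    have : ‖z‖ ≤ ‖α • x1‖ + ‖β • x2‖ + ‖γ • x3‖ := by rw [e]; exact norm_add₃_le
    rw [hz.1, norm_smul, norm_smul, norm_smul, h.h1, h.h2, h.h3, Real.norm_eq_abs, Real.norm_eq_abs, Real.norm_eq_abs,
      abs_of_pos ha, abs_of_pos hb, abs_of_pos hg] at this
    linarith
  rw [v]
  nlinarith

end PalAux

/-! Part P7b -/

namespace PalAux

lemma ctc_reg {c s : ℝ} (hc : 0 < c) (hc1 : c < 1) (hs : 0 < s) (hcs : c ^ 2 + s ^ 2 = 1) {p m1 m2 m3 : E 2}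
    {k l1 l2 l3 ε : ℝ} (h : Ctc p m1 m2 m3 k c l1 l2 l3) (hε : 0 ≤ ε) (hε1 : ε < (1 - c) / 36)
    (hk : k ^ 2 - (1 + 2 * c) / 3 ≤ ε) : ∃ y1 y2 y3 : E 2, Reg y1 y2 y3 c ∧ ‖y1 - m1‖ ≤ 7 * √18 / s ^ 2 * √ε ∧
      ‖y2 - m2‖ ≤ 7 * √18 / s ^ 2 * √ε ∧ ‖y3 - m3‖ ≤ 7 * √18 / s ^ 2 * √ε := by
  have e := h.ksq
  have ls := h.ls
  obtain ⟨a, ha⟩ : ∃ a, a = ⟪m1, m2⟫ := ⟨_, rfl⟩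
  obtain ⟨b, hb⟩ : ∃ a, a = ⟪m1, m3⟫ := ⟨_, rfl⟩
  obtain ⟨d, hd⟩ : ∃ a, a = ⟪m2, m3⟫ := ⟨_, rfl⟩
  have c12 := h.c12
  have c13 := h.c13
  have c23 := h.c23
  rw [← ha] at c12
  rw [← hb] at c13
  rw [← hd] at c23
  rw [← ha, ← hb, ← hd] at e
  have l1p := h.l1p
  have l2p := h.l2p
  have l3p := h.l3p
  have q1 : 0 ≤ l1 * l2 * (a - c) := mul_nonneg (by positivity) (by linarith)
  have q2 : 0 ≤ l1 * l3 * (b - c) := mul_nonneg (by positivity) (by linarith)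
  have q3 : 0 ≤ l2 * l3 * (d - c) := mul_nonneg (by positivity) (by linarith)
  have key : k ^ 2 - (1 + 2 * c) / 3 = 2 * (l1 * l2 * (a - c)) + 2 * (l1 * l3 * (b - c)) + 2 * (l2 * l3 * (d - c))
      + (1 - c) * ((l1 - 1 / 3) ^ 2 + (l2 - 1 / 3) ^ 2 + (l3 - 1 / 3) ^ 2) := by
    rw [e]
    have : l3 = 1 - l1 - l2 := by linarith
    rw [this]; ring
  have r0 : 0 ≤ (l1 - 1 / 3) ^ 2 + (l2 - 1 / 3) ^ 2 + (l3 - 1 / 3) ^ 2 := by positivity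
  have r : (l1 - 1 / 3) ^ 2 + (l2 - 1 / 3) ^ 2 + (l3 - 1 / 3) ^ 2 < 1 / 36 := by
    by_contra hh
    push Not at hh
    have := mul_le_mul_of_nonneg_left hh (show 0 ≤ 1 - c by linarith)
    linarith
  have r1 := mul_nonneg (show 0 ≤ 1 - c by linarith) r0
  have g : ∀ l : ℝ, (l - 1 / 3) ^ 2 < 1 / 36 → 1 / 6 ≤ l := by intro l hl; nlinarith only [hl]
  have g1 := g l1 (by linarith [sq_nonneg (l2 - 1 / 3), sq_nonneg (l3 - 1 / 3)])
  have g2 := g l2 (by linarith [sq_nonneg (l1 - 1 / 3), sq_nonneg (l3 - 1 / 3)])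
  have g3 := g l3 (by linarith [sq_nonneg (l2 - 1 / 3), sq_nonneg (l1 - 1 / 3)])
  have f : ∀ x y z : ℝ, 1 / 6 ≤ x → 1 / 6 ≤ y → c ≤ z → 2 * (x * y * (z - c)) ≤ ε → z ≤ c + 18 * ε := by
    intro x y z hx hy hz hh
    have : 1 / 36 ≤ x * y := by nlinarith only [hx, hy]
    nlinarith only [mul_nonneg (sub_nonneg.2 this) (sub_nonneg.2 hz), hh]
  obtain ⟨y1, y2, y3, hR, n1, n2, n3⟩ := reg_near hc hc1 hs hcs (δ := 18 * ε) (by positivity) (by linarith) h.h1 h.h2 h.h3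
    h.c12 (by rw [← ha]; exact f l1 l2 a g1 g2 c12 (by linarith)) h.c13 (by rw [← hb]; exact f l1 l3 b g1 g3 c13 (by linarith))
    h.c23 (by rw [← hd]; exact f l2 l3 d g2 g3 c23 (by linarith))
  have ee : 7 * √(18 * ε) / s ^ 2 = 7 * √18 / s ^ 2 * √ε := by
    rw [Real.sqrt_mul (by norm_num)]; ring
  rw [ee] at n1 n2 n3
  exact ⟨y1, y2, y3, hR, n1, n2, n3⟩

lemma polS_cone {X : Set (E 2)} {q u : E 2} (hu : ∀ m ∈ X, 0 ≤ ⟪m, u⟫) (hq : nrm q ∈ X) : 0 ≤ ⟪q, u⟫ := by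
  rw [← norm_smul_nrm q, real_inner_smul_left]
  exact mul_nonneg (norm_nonneg _) (hu _ hq)

lemma inner_nrm_ge {q y : E 2} {c : ℝ} (hq : q ≠ 0) (h : c * ‖q‖ ≤ ⟪y, q⟫) : c ≤ ⟪y, nrm q⟫ := by
  rw [nrm, real_inner_smul_right, mul_comm, ← div_eq_mul_inv, le_div_iff₀ (norm_pos_iff.2 hq)]
  exact h

lemma polS_anti {X Y : Set (E 2)} (h : X ⊆ Y) : PolS Y ⊆ PolS X := fun _ hu => ⟨hu.1, fun m hm => hu.2 m (h hm)⟩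

lemma inner_abs_le {a b : E 2} (ha : ‖a‖ = 1) : |⟪a, b⟫| ≤ ‖b‖ := by
  have := abs_real_inner_le_norm a b
  rwa [ha, one_mul] at this

lemma far_area {M0 M : Set (E 2)} (hsub : M0 ⊆ M) (hM : ∀ m ∈ M, ‖m‖ = 1) {p : E 2} (hp : ‖p‖ = 1) {κ η ε : ℝ}
    (hκ : 0 < κ) (hκ1 : κ ≤ 1) (hpm : ∀ m ∈ M, κ ≤ ⟪p, m⟫) (hη : 0 < η) (hη2 : η ≤ 2)
    (hA : sg.real (PolS M0) - sg.real (PolS M) ≤ ε) (hε : ε < π * (κ * η) ^ 2 / 16) {u : E 2} (hu : u ∈ PolS M0) :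
    ∀ m ∈ M, 0 ≤ ⟪m, u + η • p⟫ := by
  intro m hm
  by_contra hneg
  push Not at hneg
  obtain ⟨ρ, hρ⟩ : ∃ ρ, ρ = κ * η / 2 := ⟨_, rfl⟩
  have ρ0 : 0 < ρ := by rw [hρ]; positivity
  have ρ1 : ρ ≤ 1 := by rw [hρ]; nlinarith
  obtain ⟨q, hq⟩ : ∃ q, q = u + (η / 2) • p := ⟨_, rfl⟩
  have q0 : ∀ m' ∈ M0, ρ ≤ ⟪m', q⟫ := by
    intro m' hm'
    have h1 := hu.2 m' hm'
    have h2 := hpm m' (hsub hm')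
    rw [real_inner_comm] at h2
    rw [hq, inner_add_right, real_inner_smul_right, hρ]
    nlinarith
  have q1 : ⟪m, q⟫ < -ρ := by
    have h2 := hpm m hm
    rw [real_inner_comm] at h2
    rw [inner_add_right, real_inner_smul_right] at hneg
    rw [hq, inner_add_right, real_inner_smul_right, hρ]
    nlinarith
  have qne : q ≠ 0 := by
    rintro rfl
    rw [inner_zero_right] at q1
    linarith
  have qn : 0 < ‖q‖ := norm_pos_iff.2 qne
  have q2 : ‖q‖ ≤ 2 := by
    rw [hq]
    refine (norm_add_le _ _).trans ?_
    rw [norm_smul, hu.1, hp, Real.norm_eq_abs, abs_of_pos (by positivity)]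
    linarith
  have cap := cap_area (norm_nrm qne) (t := 1 - ρ ^ 2 / 8) (by nlinarith) (by nlinarith)
  have le : sg.real {x | 1 - ρ ^ 2 / 8 < ⟪x, nrm q⟫} ≤ sg.real (PolS M0 \ PolS M) := by
    apply real_le_of_ae
    filter_upwards [nrm_sphere_ae] with x hx hxt
    have d1 : ‖x - nrm q‖ ^ 2 < (ρ / 2) ^ 2 := by
      rw [norm_sub_sq_real, hx, norm_nrm qne]
      nlinarith
    have d2 : ‖x - nrm q‖ < ρ / 2 := lt_of_pow_lt_pow_left₀ 2 (by positivity) d1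
    have d3 : ‖‖q‖ • x - q‖ ≤ ρ := by
      nth_rewrite 2 [← norm_smul_nrm q]
      rw [← smul_sub, norm_smul, norm_norm]
      nlinarith [norm_nonneg (x - nrm q)]
    have d4 : ∀ m' ∈ M, |‖q‖ * ⟪m', x⟫ - ⟪m', q⟫| ≤ ρ := by
      intro m' hm'
      rw [← real_inner_smul_right, ← inner_sub_right]
      exact (inner_abs_le (hM m' hm')).trans d3
    refine ⟨⟨hx, fun m' hm' => ?_⟩, fun hh => ?_⟩
    · have := (abs_le.1 (d4 m' (hsub hm'))).1
      have := q0 m' hm'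
      by_contra h0
      push Not at h0
      nlinarith
    · have h1 := (abs_le.1 (d4 m hm)).2
      have h2 := hh.2 m hm
      nlinarith
  have df : sg.real (PolS M0 \ PolS M) = sg.real (PolS M0) - sg.real (PolS M) :=
    measureReal_sdiff (polS_anti hsub) (isClosed_PolS M).measurableSet
  rw [cap, df] at le
  have : 2 * π * (1 - (1 - ρ ^ 2 / 8)) = π * (κ * η) ^ 2 / 16 := by rw [hρ]; ring
  linarith

end PalAux

/-! Part P7c -/

namespace PalAux

lemma core_geo {c γ D k l1 l2 l3 : ℝ} (hc : 0 < c) (hc1 : c < 1) (hγ : 0 < γ) (hD : 0 ≤ D) (hDγ : D ≤ γ)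
    (hDc : D / γ ≤ c / 2) {M : Set (E 2)} (hM : Compl M c) {p m1 m2 m3 y1 y2 y3 : E 2} (h : Ctc p m1 m2 m3 k c l1 l2 l3)
    (M1 : m1 ∈ M) (M2 : m2 ∈ M) (M3 : m3 ∈ M) (hpM : ∀ m ∈ M, k ≤ ⟪p, m⟫) (hk : c + 2 * γ ≤ k)
    (hR : Reg y1 y2 y3 c) (d1 : ‖y1 - m1‖ ≤ D) (d2 : ‖y2 - m2‖ ≤ D) (d3 : ‖y3 - m3‖ ≤ D) :
    (∀ m ∈ M, ∀ u : E 2, (∀ y ∈ Reu y1 y2 y3 c, 0 ≤ ⟪y, u⟫) → 0 ≤ ⟪m, u⟫ + D / γ * ⟪p, u⟫) ∧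
    (∀ y ∈ Reu y1 y2 y3 c, ∀ u : E 2, (∀ m ∈ M, 0 ≤ ⟪m, u⟫) → 0 ≤ ⟪y, u⟫ + D / γ / γ * ⟪p, u⟫) ∧
    (∀ y ∈ Reu y1 y2 y3 c, c / 2 ≤ ⟪y, p⟫) := by
  obtain ⟨η, hη⟩ : ∃ η, η = D / γ := ⟨_, rfl⟩
  have hη0 : 0 ≤ η := by rw [hη]; positivity
  have hηγ : η * γ = D := by rw [hη]; field_simp
  have hp := h.hp
  have k1 : k ≤ 1 := by rw [← h.p1]; exact inner_le1 h.h1 h.hp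
  have step : ∀ yi mi : E 2, mi ∈ M → ‖yi - mi‖ ≤ D → ∀ m ∈ M, c * ‖m + η • p‖ ≤ ⟪yi, m + η • p⟫ := by
    intro yi mi hmi hd m hm
    have n1 : ‖m + η • p‖ ≤ 1 + η := by
      refine (norm_add_le _ _).trans ?_
      rw [norm_smul, hM.unit hm, hp, Real.norm_eq_abs, abs_of_nonneg hη0]; linarith
    have a1 := (abs_le.1 ((inner_abs_le (b := yi - mi) (hM.unit hm)).trans hd)).1
    have a2 := (abs_le.1 ((inner_abs_le (b := yi - mi) hp).trans hd)).1
    rw [inner_sub_right] at a1 a2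
    have a3 := hM.inn hm hmi
    have a4 := hpM mi hmi
    rw [inner_add_right, real_inner_smul_right, real_inner_comm m yi, real_inner_comm p yi]
    have : η * (c + γ) ≤ η * ⟪p, yi⟫ := mul_le_mul_of_nonneg_left (by linarith) hη0
    have := mul_le_mul_of_nonneg_left n1 hc.le
    nlinarith only [a1, a3, this, ‹η * (c + γ) ≤ η * ⟪p, yi⟫›, hηγ]
  have nge : ∀ m ∈ M, 1 ≤ ‖m + η • p‖ := by
    intro m hm
    have a1 := (abs_le.1 (inner_abs_le (b := m + η • p) (hM.unit hm))).2
    rw [inner_add_right, real_inner_smul_right, inner_self_one (hM.unit hm), real_inner_comm] at a1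
    have := mul_nonneg hη0 (show 0 ≤ ⟪p, m⟫ by linarith [hpM m hm])
    linarith
  have memR : ∀ m ∈ M, nrm (m + η • p) ∈ Reu y1 y2 y3 c := by
    intro m hm
    have ne : m + η • p ≠ 0 := norm_pos_iff.1 (by linarith [nge m hm])
    exact ⟨norm_nrm ne, inner_nrm_ge ne (step _ _ M1 d1 m hm), inner_nrm_ge ne (step _ _ M2 d2 m hm),
      inner_nrm_ge ne (step _ _ M3 d3 m hm)⟩
  have dm : ∀ y ∈ Reu y1 y2 y3 c, ∀ m ∈ M, c - η ≤ ⟪y, m⟫ := by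
    intro y hy m hm
    have a1 := reu_diam hc hc1 hR hy (memR m hm)
    have a2 : ⟪y, m + η • p⟫ = ‖m + η • p‖ * ⟪y, nrm (m + η • p)⟫ := by
      rw [← real_inner_smul_right, norm_smul_nrm]
    rw [inner_add_right, real_inner_smul_right] at a2
    have a3 := inner_le1 hp hy.1
    have a4 := mul_le_mul (nge m hm) a1 hc.le (norm_nonneg _)
    have a5 := mul_le_mul_of_nonneg_left a3 hη0
    linarith
  have hC : ∀ y ∈ Reu y1 y2 y3 c, c / 2 ≤ ⟪y, p⟫ := by
    intro y hy
    have e : k * ⟪y, p⟫ = l1 * ⟪y, m1⟫ + l2 * ⟪y, m2⟫ + l3 * ⟪y, m3⟫ := by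
      rw [← real_inner_smul_right, h.eq, inner_add_right, inner_add_right, real_inner_smul_right, real_inner_smul_right,
        real_inner_smul_right]
    have b1 := mul_le_mul_of_nonneg_left (dm y hy m1 M1) h.l1p.le
    have b2 := mul_le_mul_of_nonneg_left (dm y hy m2 M2) h.l2p.le
    have b3 := mul_le_mul_of_nonneg_left (dm y hy m3 M3) h.l3p.le
    have : (l1 + l2 + l3) * (c - η) = c - η := by rw [h.ls, one_mul]
    have b4 : c / 2 ≤ k * ⟪y, p⟫ := by rw [e]; rw [← hη] at hDc; linarith
    have pos : 0 < ⟪y, p⟫ := by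
      by_contra hh
      push Not at hh
      nlinarith only [hh, b4, hc, h.k0]
    nlinarith only [pos, b4, k1]
  refine ⟨?_, ?_, hC⟩
  · intro m hm u hu
    have := polS_cone hu (memR m hm)
    rw [inner_add_left, real_inner_smul_left] at this
    rwa [← hη]
  · intro y hy u hu
    rw [← hη]
    obtain ⟨ζ, hζ⟩ : ∃ ζ, ζ = η / γ := ⟨_, rfl⟩
    have hζ0 : 0 ≤ ζ := by rw [hζ]; positivity
    have hζγ : ζ * γ = η := by rw [hζ]; field_simp
    rw [← hζ]
    have ne : y + ζ • p ≠ 0 := by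
      intro h0
      have : ⟪y, y + ζ • p⟫ = 0 := by rw [h0, inner_zero_right]
      rw [inner_add_right, real_inner_smul_right, inner_self_one hy.1] at this
      have := mul_nonneg hζ0 (show 0 ≤ ⟪y, p⟫ by linarith [hC y hy])
      linarith
    have mem : nrm (y + ζ • p) ∈ M := by
      rw [hM]
      refine ⟨norm_nrm ne, fun m hm => ?_⟩
      rw [real_inner_comm]
      apply inner_nrm_ge ne
      have n1 : ‖y + ζ • p‖ ≤ 1 + ζ := by
        refine (norm_add_le _ _).trans ?_
        rw [norm_smul, hy.1, hp, Real.norm_eq_abs, abs_of_nonneg hζ0]; linarith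
      have a1 := dm y hy m hm
      have a2 := hpM m hm
      rw [inner_add_right, real_inner_smul_right, real_inner_comm y m, real_inner_comm p m]
      have a3 := mul_le_mul_of_nonneg_left n1 hc.le
      have a4 := mul_le_mul_of_nonneg_left (show c + γ ≤ ⟪p, m⟫ by linarith) hζ0
      nlinarith only [a1, a3, a4, hζγ]
    have := polS_cone hu mem
    rwa [inner_add_left, real_inner_smul_left] at this

theorem core {c s : ℝ} (hc : 0 < c) (hc1 : c < 1) (hs : 0 < s) (hcs : c ^ 2 + s ^ 2 = 1) :
    ∃ C > 0, ∃ ε0 > 0, ∀ M0 M : Set (E 2), Compl M c → M.Nonempty → M0 ⊆ M → ∀ ε : ℝ, 0 < ε → ε < ε0 →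
      sg.real (PolS M0) ≤ 2 * π - 3 * Real.arccos (c / (1 + c)) * s + ε →
    ∃ y1 y2 y3 p : E 2, Reg y1 y2 y3 c ∧ ‖p‖ = 1 ∧
      (∀ u ∈ PolS M0, ∀ y ∈ Reu y1 y2 y3 c, 0 ≤ ⟪y, u + (C * √ε) • p⟫) ∧
      (∀ u ∈ PolS (Reu y1 y2 y3 c), ∀ m ∈ M0, 0 ≤ ⟪m, u + (C * √ε) • p⟫) := by
  obtain ⟨C, hC, ε1, hε1, H⟩ := ctc_close hc hc1 hs hcs
  obtain ⟨kJ, hkJ⟩ : ∃ kJ, kJ = √((1 + 2 * c) / 3) := ⟨_, rfl⟩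
  have kJ0 : 0 ≤ kJ := by rw [hkJ]; positivity
  have kJ2 : kJ ^ 2 = (1 + 2 * c) / 3 := by rw [hkJ]; exact Real.sq_sqrt (by positivity)
  have kJc : c < kJ := by
    apply lt_of_pow_lt_pow_left₀ 2 kJ0
    rw [kJ2]; nlinarith
  have kJ1 : kJ ≤ 1 := by
    apply le_of_pow_le_pow_left₀ two_ne_zero zero_le_one
    rw [kJ2]; linarith
  obtain ⟨γ, hγ⟩ : ∃ γ, γ = (kJ - c) / 2 := ⟨_, rfl⟩
  have γ0 : 0 < γ := by rw [hγ]; linarith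
  obtain ⟨κ, hκ⟩ : ∃ κ, κ = c + γ := ⟨_, rfl⟩
  have κ0 : 0 < κ := by rw [hκ]; linarith
  obtain ⟨C1, hC1⟩ : ∃ C1, C1 = 7 * √18 / s ^ 2 * √C := ⟨_, rfl⟩
  have C10 : 0 < C1 := by rw [hC1]; positivity
  obtain ⟨τ, hτ⟩ : ∃ τ, τ = min (γ / C1) (min (γ * c / (2 * C1)) (κ / 2)) := ⟨_, rfl⟩
  have τ0 : 0 < τ := by rw [hτ]; positivity
  refine ⟨4 / κ + 6 * (C1 / γ / γ) / c + C1 / γ / κ, by positivity, min ε1 (min ((1 - c) / 36 / C) (τ ^ 2)), ?_, ?_⟩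
  · have : 0 < 1 - c := by linarith
    positivity
  intro M0 M hM hne hsub ε hε hε0 hA
  obtain ⟨e1, e2⟩ := lt_min_iff.1 hε0
  obtain ⟨e2, e3⟩ := lt_min_iff.1 e2
  obtain ⟨r, hr⟩ : ∃ r, r = √ε := ⟨_, rfl⟩
  have r0 : 0 < r := by rw [hr]; positivity
  have r2 : r ^ 2 = ε := by rw [hr]; exact Real.sq_sqrt hε.le
  have rτ : r ≤ τ := by
    apply le_of_pow_le_pow_left₀ two_ne_zero τ0.le
    rw [r2]; exact e3.le
  have t1 : r ≤ γ / C1 := by rw [hτ] at rτ; exact rτ.trans (min_le_left _ _)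
  have t2 : r ≤ γ * c / (2 * C1) := by
    rw [hτ] at rτ; exact rτ.trans ((min_le_right _ _).trans (min_le_left _ _))
  have t3 : r ≤ κ / 2 := by
    rw [hτ] at rτ; exact rτ.trans ((min_le_right _ _).trans (min_le_right _ _))
  have hle : sg.real (PolS M) ≤ sg.real (PolS M0) := by
    apply real_le_of_ae
    exact Filter.Eventually.of_forall fun x hx => polS_anti hsub hx
  obtain ⟨p, k, hp, hk, hpM, m1, M1, m2, M2, m3, M3, l1, l2, l3, h, hkε⟩ := H M hM hne ε hε e1 (hle.trans hA)
  obtain ⟨y1, y2, y3, hR, d1, d2, d3⟩ := ctc_reg hc hc1 hs hcs h (ε := C * ε) (by positivity)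
    (by rw [lt_div_iff₀ hC] at e2; linarith) hkε
  have eD : 7 * √18 / s ^ 2 * √(C * ε) = C1 * r := by
    rw [Real.sqrt_mul hC.le, hC1, hr]; ring
  rw [eD] at d1 d2 d3
  have D1 : C1 * r ≤ γ := by rw [le_div_iff₀ C10] at t1; linarith
  have D2 : C1 * r / γ ≤ c / 2 := by
    rw [le_div_iff₀ (by positivity)] at t2
    rw [div_le_iff₀ γ0]; linarith
  have hk2 : c + 2 * γ ≤ k := by
    have : kJ ≤ k := by
      apply le_of_pow_le_pow_left₀ two_ne_zero hk.le
      rw [kJ2]; exact h.jung hc1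
    rw [hγ]; linarith
  obtain ⟨A, B, Cc⟩ := core_geo hc hc1 γ0 (by positivity) D1 D2 hM h M1 M2 M3 hpM hk2 hR d1 d2 d3
  have κk : κ ≤ k := by rw [hκ]; linarith
  have κ1 : κ ≤ 1 := by rw [hκ, hγ]; linarith
  have hη : 4 / κ * r ≤ 2 := by
    rw [div_mul_eq_mul_div, div_le_iff₀ κ0]; linarith
  refine ⟨y1, y2, y3, p, hR, hp, ?_, ?_⟩
  · intro u hu y hy
    have w1 := far_area hsub (fun m hm => hM.unit hm) hp κ0 κ1 (fun m hm => κk.trans (hpM m hm)) (η := 4 / κ * r)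
      (by positivity) hη (ε := ε) (by linarith [pol_lower hc hc1 hs hcs hM hne]) (by
        have : κ * (4 / κ * r) = 4 * r := by field_simp
        rw [this, mul_pow, r2]
        nlinarith only [Real.pi_gt_three, hε]) hu
    have b := B y hy _ w1
    have w3 : ‖u + (4 / κ * r) • p‖ ≤ 3 := by
      refine (norm_add_le _ _).trans ?_
      rw [norm_smul, hu.1, hp, Real.norm_eq_abs, abs_of_nonneg (by positivity)]; linarith
    have w4 := (abs_le.1 (inner_abs_le (b := u + (4 / κ * r) • p) hp)).2.trans w3
    have w5 := Cc y hy
    obtain ⟨ζ, hζ⟩ : ∃ ζ, ζ = C1 * r / γ / γ := ⟨_, rfl⟩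
    have ζ0 : 0 ≤ ζ := by rw [hζ]; positivity
    rw [← hζ] at b
    have w6 := mul_le_mul_of_nonneg_left w4 ζ0
    have e : u + ((4 / κ + 6 * (C1 / γ / γ) / c + C1 / γ / κ) * √ε) • p =
        (u + (4 / κ * r) • p) + (6 * ζ / c + C1 * r / γ / κ) • p := by
      rw [add_assoc u, ← add_smul, ← hr, hζ]
      congr 2; ring
    rw [e, inner_add_right, real_inner_smul_right]
    have w7 : 0 ≤ C1 * r / γ / κ := by positivity
    have w8 := mul_le_mul_of_nonneg_left w5 (show 0 ≤ 6 * ζ / c + C1 * r / γ / κ by positivity)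
    have w9 : (6 * ζ / c + C1 * r / γ / κ) * (c / 2) = 3 * ζ + C1 * r / γ / κ * (c / 2) := by field_simp; ring
    have w10 := mul_nonneg w7 (show 0 ≤ c / 2 by positivity)
    linarith
  · intro u hu m hm
    have a := A m (hsub hm) u hu.2
    have a2 := inner_le1 hu.1 hp
    have a3 := hpM m (hsub hm)
    rw [inner_add_right, real_inner_smul_right, real_inner_comm p m]
    have a4 := mul_le_mul_of_nonneg_left a2 (show 0 ≤ C1 * r / γ by positivity)
    have a5 := mul_le_mul_of_nonneg_left (κk.trans a3) (show 0 ≤ (4 / κ + 6 * (C1 / γ / γ) / c + C1 / γ / κ) * √ε by positivity)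
    have a6 : (4 / κ + 6 * (C1 / γ / γ) / c + C1 / γ / κ) * √ε * κ = C1 * r / γ + (4 / κ + 6 * (C1 / γ / γ) / c) * r * κ := by
      rw [← hr]; field_simp; ring
    have a7 : 0 ≤ (4 / κ + 6 * (C1 / γ / γ) / c) * r * κ := by positivity
    linarith

end PalAux

/-! Part P8a -/

namespace PalAux

lemma mem_us {x : E 2} : x ∈ unitSphere 2 ↔ ‖x‖ = 1 := by
  simp [unitSphere]

lemma gdist_angle {x y : E 2} (hx : ‖x‖ = 1) (hy : ‖y‖ = 1) : gdist x y = InnerProductGeometry.angle x y := by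
  rw [gdist, InnerProductGeometry.angle, hx, hy]; simp

lemma seg_mem {x y : E 2} (hx : ‖x‖ = 1) (hy : ‖y‖ = 1) {a b : ℝ} (ha : 0 ≤ a) (hb : 0 ≤ b) (h0 : a • x + b • y ≠ 0) :
    nrm (a • x + b • y) ∈ seg x y := by
  have n := norm_nrm h0
  refine ⟨mem_us.2 n, ?_⟩
  rw [gdist_angle hx n, gdist_angle n hy, gdist_angle hx hy]
  symm
  apply InnerProductGeometry.angle_eq_angle_add_add_angle_add_of_mem_span
  · exact norm_pos_iff.1 (by rw [n]; norm_num)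
  · rw [Submodule.mem_span_pair]
    refine ⟨⟨‖a • x + b • y‖⁻¹ * a, by positivity⟩, ⟨‖a • x + b • y‖⁻¹ * b, by positivity⟩, ?_⟩
    rw [nrm, smul_add, smul_smul, smul_smul]
    rfl

lemma sconvex_cone {K : Set (E 2)} (hK : SConvex K) : Convex ℝ {x : E 2 | ∃ t : ℝ, 0 < t ∧ ∃ k ∈ K, x = t • k} := by
  obtain ⟨h1, ⟨v, hv, h2⟩, h3⟩ := hK
  rintro _ ⟨t, ht, k, hk, rfl⟩ _ ⟨t', ht', k', hk', rfl⟩ a b ha hb hab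
  have p1 := h2 k hk
  have p2 := h2 k' hk'
  obtain ⟨q, hq⟩ : ∃ q, q = (a * t) • k + (b * t') • k' := ⟨_, rfl⟩
  have pos : 0 < ⟪v, q⟫ := by
    rw [hq, inner_add_right, real_inner_smul_right, real_inner_smul_right]
    rcases ha.eq_or_lt with rfl | ha'
    · have : b = 1 := by linarith
      subst this; simp; positivity
    · positivity
  have qne : q ≠ 0 := by rintro h; rw [h, inner_zero_right] at pos; exact lt_irrefl _ pos
  refine ⟨‖q‖, norm_pos_iff.2 qne, nrm q, h3 k hk k' hk' ?_, ?_⟩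
  · rw [hq] at qne ⊢
    exact seg_mem (mem_us.1 (h1 hk)) (mem_us.1 (h1 hk')) (by positivity) (by positivity) qne
  · rw [norm_smul_nrm, hq, smul_smul, smul_smul]

lemma bipolar {K : Set (E 2)} (hK : IsConvexBody K) : PolS (PolS K) = K := by
  obtain ⟨hS, hc, hi⟩ := hK
  have hne : K.Nonempty := hi.mono fun x hx => hx.1
  have cone := sconvex_cone hS
  obtain ⟨h1, ⟨v, hv, h2⟩, h3⟩ := hS
  ext u
  constructor
  · rintro ⟨hu, hu2⟩
    have hull : convexHull ℝ K ⊆ {x : E 2 | ∃ t : ℝ, 0 < t ∧ ∃ k ∈ K, x = t • k} :=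
      convexHull_min (fun k hk => ⟨1, one_pos, k, hk, by simp⟩) cone
    have h0 : (0 : E 2) ∉ convexHull ℝ K := by
      intro h
      obtain ⟨t, ht, k, hk, e⟩ := hull h
      have := h2 k hk
      have k0 : k = 0 := by
        rcases smul_eq_zero.1 e.symm with h | h
        · exact absurd h ht.ne'
        · exact h
      rw [k0, inner_zero_right] at this
      exact lt_irrefl _ this
    obtain ⟨t, ht, x, hx, e1, e2⟩ := moreau (hull_compact hc hne) (convex_convexHull ℝ K) hne.convexHull h0 u
    obtain ⟨q, hq⟩ : ∃ q, q = u - t • x := ⟨_, rfl⟩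
    rw [← hq] at e1 e2
    have q0 : q = 0 := by
      by_contra qne
      have m : nrm (-q) ∈ PolS K := by
        refine ⟨norm_nrm (neg_ne_zero.2 qne), fun k hk => ?_⟩
        rw [nrm, real_inner_smul_right, inner_neg_right, real_inner_comm]
        have := e2 k (subset_convexHull ℝ K hk)
        exact mul_nonneg (by positivity) (by linarith)
      have h := polS_cone hu2 m
      have e : u = q + t • x := by rw [hq]; abel
      rw [inner_neg_left, e, inner_add_right, e1, real_inner_self_eq_norm_sq] at h
      have := norm_pos_iff.2 qne
      nlinarith
    have e : u = t • x := by rw [q0] at hq; exact (sub_eq_zero.1 hq.symm)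
    obtain ⟨r, hr, k, hk, rfl⟩ := hull hx
    have hk1 := mem_us.1 (h1 hk)
    rw [smul_smul] at e
    have : t * r = 1 := by
      have := hu
      rw [e, norm_smul, hk1, mul_one, Real.norm_eq_abs, abs_of_nonneg (by positivity)] at this
      exact this
    rw [this, one_smul] at e
    rw [e]; exact hk
  · intro hu
    exact ⟨mem_us.1 (h1 hu), fun m hm => by rw [real_inner_comm]; exact hm.2 u hu⟩

lemma completion {M0 : Set (E 2)} {c : ℝ} (hc1 : c < 1) (h1 : ∀ m ∈ M0, ‖m‖ = 1) (h2 : ∀ m ∈ M0, ∀ v ∈ M0, c ≤ ⟪m, v⟫) :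
    ∃ M, M0 ⊆ M ∧ Compl M c := by
  obtain ⟨M, hM, hmax⟩ := zorn_subset_nonempty {N : Set (E 2) | (∀ m ∈ N, ‖m‖ = 1) ∧ ∀ m ∈ N, ∀ v ∈ N, c ≤ ⟪m, v⟫} (by
    intro ch hch hchain hne
    refine ⟨⋃₀ ch, ⟨?_, ?_⟩, fun s hs => Set.subset_sUnion_of_mem hs⟩
    · rintro m ⟨N, hN, hm⟩
      exact (hch hN).1 m hm
    · rintro m ⟨N, hN, hm⟩ v ⟨N', hN', hv⟩
      rcases hchain.total hN hN' with h | h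
      · exact (hch hN').2 m (h hm) v hv
      · exact (hch hN).2 m hm v (h hv)) M0 ⟨h1, h2⟩
  refine ⟨M, hM, fun x => ⟨fun hx => ⟨hmax.prop.1 x hx, fun y hy => hmax.prop.2 x hx y hy⟩, ?_⟩⟩
  rintro ⟨hx, hxy⟩
  have ins : insert x M ∈ {N : Set (E 2) | (∀ m ∈ N, ‖m‖ = 1) ∧ ∀ m ∈ N, ∀ v ∈ N, c ≤ ⟪m, v⟫} := by
    refine ⟨?_, ?_⟩
    · rintro m (rfl | hm)
      · exact hx
      · exact hmax.prop.1 m hm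
    · rintro m (rfl | hm) v (rfl | hv)
      · rw [inner_self_one hx]; exact hc1.le
      · exact hxy v hv
      · rw [real_inner_comm]; exact hxy m hm
      · exact hmax.prop.2 m hm v hv
  exact hmax.le_of_ge ins (Set.subset_insert x M) (Set.mem_insert x M)

lemma breadth_eq {u v : E 2} (hu : ‖u‖ = 1) (hv : ‖v‖ = 1) {a : ℝ} (ha : a = ⟪u, v⟫) (h1 : a ^ 2 < 1) :
    breadth u v = Real.arccos (-a) := by
  have n1 : ‖(a • u - v : E 2)‖ ^ 2 = 1 - a ^ 2 := by
    rw [← real_inner_self_eq_norm_sq]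
    simp only [inner_sub_left, inner_sub_right, real_inner_smul_left, real_inner_smul_right, inner_self_one hu, inner_self_one hv,
      real_inner_comm u v, ← ha]
    ring
  have n2 : ‖(a • v - u : E 2)‖ ^ 2 = 1 - a ^ 2 := by
    rw [← real_inner_self_eq_norm_sq]
    simp only [inner_sub_left, inner_sub_right, real_inner_smul_left, real_inner_smul_right, inner_self_one hu, inner_self_one hv,
      real_inner_comm u v, ← ha]
    ring
  have e : ‖(a • u - v : E 2)‖ = ‖(a • v - u : E 2)‖ := by
    rw [← sq_eq_sq₀ (norm_nonneg _) (norm_nonneg _), n1, n2]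
  have i : ⟪(a • u - v : E 2), a • v - u⟫ = - a * (1 - a ^ 2) := by
    simp only [inner_sub_left, inner_sub_right, real_inner_smul_left, real_inner_smul_right, inner_self_one hu, inner_self_one hv,
      real_inner_comm u v, ← ha]
    ring
  rw [breadth, gdist, luneFaceCenter, luneFaceCenter, real_inner_comm u v, ← ha, real_inner_smul_left, real_inner_smul_right, i, e,
    ← n2]
  congr 1
  have : ‖(a • v - u : E 2)‖ ≠ 0 := by
    intro h; rw [h] at n2; nlinarith
  field_simp

lemma tilt {a t N : ℝ} (h1 : -1 < a) (h2 : a < 1) (ht : 0 < t) (n1 : 1 - t * a ≤ N) (n2 : N ≤ 1 + t) : a - t < a * N := by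
  rcases le_or_gt 0 a with h | h
  · nlinarith [mul_le_mul_of_nonneg_left n1 h, mul_pos ht (show 0 < 1 - a by linarith), mul_nonneg (mul_nonneg ht.le h) (show 0 ≤ 1 - a by linarith)]
  · nlinarith [mul_le_mul_of_nonneg_left n2 (show 0 ≤ -a by linarith), mul_pos ht (show 0 < 1 + a by linarith)]

lemma no_antipode {K : Set (E 2)} (hK : IsConvexBody K) {u : E 2} (hu : u ∈ PolS K) : -u ∉ PolS K := by
  intro hnu
  obtain ⟨hS, hc, x, hx, ε, hε, hi⟩ := hK
  have hx1 := mem_us.1 (hS.1 hx)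
  have z : ∀ k ∈ K, ⟪k, u⟫ = 0 := by
    intro k hk
    have h1 := hu.2 k hk
    have h2 := hnu.2 k hk
    rw [inner_neg_right] at h2
    linarith
  obtain ⟨θ, hθ⟩ : ∃ θ, θ = min (ε / 2) 1 := ⟨_, rfl⟩
  have θ0 : 0 < θ := by rw [hθ]; positivity
  have θ1 : θ ≤ 1 := by rw [hθ]; exact min_le_right _ _
  have θε : θ < ε := by rw [hθ]; exact (min_le_left _ _).trans_lt (by linarith)
  obtain ⟨y, hy⟩ : ∃ y, y = Real.cos θ • x + Real.sin θ • u := ⟨_, rfl⟩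
  have hxu := z x hx
  have hy1 : ‖y‖ = 1 := by
    apply norm_one_of_inner
    rw [hy]
    simp only [inner_add_left, inner_add_right, real_inner_smul_left, real_inner_smul_right, inner_self_one hu.1, inner_self_one hx1,
      real_inner_comm x u, hxu]
    nlinarith [Real.sin_sq_add_cos_sq θ]
  have hxy : gdist x y = θ := by
    rw [gdist, hy, inner_add_right, real_inner_smul_right, real_inner_smul_right, hxu, inner_self_one hx1, mul_one, mul_zero, add_zero]
    exact Real.arccos_cos θ0.le (by linarith [Real.pi_gt_three])
  have := z y (hi y (mem_us.2 hy1) (by rw [hxy]; exact θε))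
  rw [hy, inner_add_left, real_inner_smul_left, real_inner_smul_left, hxu, inner_self_one hu.1] at this
  have := Real.sin_pos_of_pos_of_lt_pi θ0 (by linarith [Real.pi_gt_three])
  linarith

end PalAux

/-! Part P8b -/

namespace PalAux

lemma touch {K : Set (E 2)} (hc : IsCompact K) (hne : K.Nonempty) (hK1 : ∀ x ∈ K, ‖x‖ = 1) {u v : E 2} (hu : u ∈ PolS K) (hv : v ∈ PolS K)
    (hmin : ∀ z ∈ PolS K, ⟪u, v⟫ ≤ ⟪z, v⟫) (h1 : -1 < ⟪u, v⟫) (h2 : ⟪u, v⟫ < 1) : ∃ x ∈ K, ⟪x, u⟫ = 0 := by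
  by_contra hno
  push Not at hno
  obtain ⟨x0, hx0, hm⟩ := hc.exists_isMinOn hne (f := fun x => ⟪x, u⟫) (by fun_prop)
  obtain ⟨t, ht⟩ : ∃ t, t = ⟪x0, u⟫ / 2 := ⟨_, rfl⟩
  have t0 : 0 < t := by
    have := (hu.2 x0 hx0).lt_of_ne (hno x0 hx0).symm
    rw [ht]; linarith
  have t1 : t < 1 := by
    have := inner_le1 hu.1 (hK1 x0 hx0)
    rw [ht]; linarith
  have np : 1 - t ≤ ‖u - t • v‖ := by
    have := norm_sub_norm_le u (t • v)
    rwa [norm_smul, hu.1, hv.1, mul_one, Real.norm_eq_abs, abs_of_pos t0] at this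
  have ne : u - t • v ≠ 0 := norm_pos_iff.1 (by linarith)
  have mem : nrm (u - t • v) ∈ PolS K := by
    refine ⟨norm_nrm ne, fun x hx => ?_⟩
    have a1 : ⟪x0, u⟫ ≤ ⟪x, u⟫ := hm hx
    have a2 := inner_le1 hv.1 (hK1 x hx)
    rw [nrm, real_inner_smul_right, inner_sub_right, real_inner_smul_right]
    refine mul_nonneg (by positivity) ?_
    have := mul_le_mul_of_nonneg_left a2 t0.le
    linarith
  have a := hmin _ mem
  have n1 : 1 - t * ⟪u, v⟫ ≤ ‖u - t • v‖ := by
    have := (abs_le.1 (inner_abs_le (b := u - t • v) hu.1)).2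
    rwa [inner_sub_right, real_inner_smul_right, inner_self_one hu.1] at this
  have n2 : ‖u - t • v‖ ≤ 1 + t := by
    have := norm_sub_le u (t • v)
    rwa [norm_smul, hu.1, hv.1, mul_one, Real.norm_eq_abs, abs_of_pos t0] at this
  have b := tilt h1 h2 t0 n1 n2
  have e : ‖u - t • v‖ * ⟪nrm (u - t • v), v⟫ = ⟪u, v⟫ - t := by
    rw [← real_inner_smul_left, norm_smul_nrm, inner_sub_left, real_inner_smul_left, inner_self_one hv.1, mul_one]
  have := mul_le_mul_of_nonneg_left a (norm_nonneg (u - t • v))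
  linarith

lemma pair_ge {K : Set (E 2)} (hK : IsConvexBody K) {w : ℝ} (hw1 : 0 < w) (hw2 : w < π) (hw : width K = w) :
    ∀ u ∈ PolS K, ∀ v ∈ PolS K, Real.cos (π - w) ≤ ⟪u, v⟫ := by
  have hne : K.Nonempty := hK.2.2.mono fun x hx => hx.1
  have hK1 : ∀ x ∈ K, ‖x‖ = 1 := fun x hx => mem_us.1 (hK.1.1 hx)
  have hcp : IsCompact (PolS K) := by
    apply (isCompact_sphere (0 : E 2) 1).of_isClosed_subset (isClosed_PolS K)
    intro u hu
    simpa using hu.1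
  have hPne : (PolS K).Nonempty := by
    obtain ⟨v, hv, h⟩ := hK.1.2.1
    exact ⟨v, mem_us.1 hv, fun k hk => by rw [real_inner_comm]; exact (h k hk).le⟩
  obtain ⟨⟨u, v⟩, ⟨hu, hv⟩, hm⟩ := (hcp.prod hcp).exists_isMinOn (hPne.prod hPne)
    (f := fun q : E 2 × E 2 => ⟪q.1, q.2⟫) (by fun_prop)
  have hmin : ∀ z ∈ PolS K, ∀ y ∈ PolS K, ⟪u, v⟫ ≤ ⟪z, y⟫ := fun z hz y hy => hm (a := (z, y)) ⟨hz, hy⟩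
  simp only at hu hv
  suffices Real.cos (π - w) ≤ ⟪u, v⟫ from fun z hz y hy => this.trans (hmin z hz y hy)
  by_contra hlt
  push Not at hlt
  obtain ⟨a, ha⟩ : ∃ a, a = ⟪u, v⟫ := ⟨_, rfl⟩
  have a1 : a < 1 := by rw [ha]; exact hlt.trans_le (Real.cos_le_one _)
  have a2 : -1 < a := by
    have := (abs_le.1 ((inner_abs_le (b := v) hu.1).trans hv.1.le)).1
    rcases this.eq_or_lt with h | h
    · exfalso
      have : u = -v := by
        have e : ‖u + v‖ ^ 2 = 0 := by
          rw [norm_add_sq_real, hu.1, hv.1, ← h]; norm_num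
        exact eq_neg_of_add_eq_zero_left (norm_eq_zero.1 (by simpa using e))
      exact no_antipode hK hv (by rw [← this]; exact hu)
    · rw [ha]; exact h
  obtain ⟨x, hx, hxu⟩ := touch hK.2.1 hne hK1 hu hv (fun z hz => hmin z hz v hv) (by rw [← ha]; exact a2) (by rw [← ha]; exact a1)
  obtain ⟨y, hy, hyv⟩ := touch hK.2.1 hne hK1 hv hu (fun z hz => by
    rw [real_inner_comm]; exact hmin z hz u hu) (by rw [real_inner_comm, ← ha]; exact a2) (by rw [real_inner_comm, ← ha]; exact a1)
  have sup : IsSupportingLune K (-u) (-v) := by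
    refine ⟨mem_us.2 (by rw [norm_neg]; exact hu.1), mem_us.2 (by rw [norm_neg]; exact hv.1), ?_, ?_, ?_, ?_, ?_⟩
    · intro h
      rw [neg_inj] at h
      rw [ha, h, inner_self_one hv.1] at a1
      exact lt_irrefl _ a1
    · intro h
      rw [neg_inj] at h
      rw [ha, h, inner_neg_left, inner_self_one hv.1] at a2
      exact lt_irrefl _ a2
    · intro k hk
      refine ⟨hK.1.1 hk, ?_, ?_⟩
      · rw [inner_neg_right]; linarith [hu.2 k hk]
      · rw [inner_neg_right]; linarith [hv.2 k hk]
    · refine ⟨x, hx, hK.1.1 hx, ?_, ?_⟩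
      · rw [inner_neg_right, hxu, neg_zero]
      · rw [inner_neg_right]; linarith [hv.2 x hx]
    · refine ⟨y, hy, hK.1.1 hy, ?_, ?_⟩
      · rw [inner_neg_right, hyv, neg_zero]
      · rw [inner_neg_right]; linarith [hu.2 y hy]
  have br := breadth_eq (u := -u) (v := -v) (by rw [norm_neg]; exact hu.1) (by rw [norm_neg]; exact hv.1) (a := a)
    (by rw [inner_neg_left, inner_neg_right, neg_neg]; exact ha) (by nlinarith)
  have le : width K ≤ Real.arccos (-a) := by
    apply csInf_le
    · refine ⟨0, ?_⟩
      rintro _ ⟨p, q, _, rfl⟩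
      exact Real.arccos_nonneg _
    · exact ⟨-u, -v, sup, br.symm⟩
  rw [hw] at le
  rw [Real.arccos_neg] at le
  have : Real.arccos a ≤ π - w := by linarith
  have h3 := Real.cos_le_cos_of_nonneg_of_le_pi (Real.arccos_nonneg a) (by linarith) this
  rw [Real.cos_arccos a2.le a1.le, ha] at h3
  linarith

lemma gball_iff {x y : E 2} (hx : ‖x‖ = 1) (hy : ‖y‖ = 1) {r : ℝ} (h0 : 0 ≤ r) (h1 : r ≤ π) : gdist x y ≤ r ↔ Real.cos r ≤ ⟪x, y⟫ := by
  have a := abs_le.1 ((inner_abs_le (b := y) hx).trans hy.le)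
  rw [gdist]
  constructor
  · intro h
    have := Real.cos_le_cos_of_nonneg_of_le_pi (Real.arccos_nonneg _) h1 h
    rwa [Real.cos_arccos a.1 a.2] at this
  · intro h
    have := Real.arccos_le_arccos h
    rwa [Real.arccos_cos h0 h1] at this

lemma polar_reu {x1 x2 x3 : E 2} {r : ℝ} (h1 : ‖x1‖ = 1) (h2 : ‖x2‖ = 1) (h3 : ‖x3‖ = 1) (r0 : 0 ≤ r) (r1 : r ≤ π) :
    polar (gball x1 r ∩ gball x2 r ∩ gball x3 r) = PolS (Reu (-x1) (-x2) (-x3) (Real.cos r)) := by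
  have key : ∀ y : E 2, y ∈ gball x1 r ∩ gball x2 r ∩ gball x3 r ↔ -y ∈ Reu (-x1) (-x2) (-x3) (Real.cos r) := by
    intro y
    simp only [Reu, gball, Set.mem_inter_iff, Set.mem_ofPred_eq, mem_us, norm_neg, inner_neg_neg]
    constructor
    · rintro ⟨⟨⟨hy, a⟩, _, b⟩, _, d⟩
      exact ⟨hy, (gball_iff h1 hy r0 r1).1 a, (gball_iff h2 hy r0 r1).1 b, (gball_iff h3 hy r0 r1).1 d⟩
    · rintro ⟨hy, a, b, d⟩
      exact ⟨⟨⟨hy, (gball_iff h1 hy r0 r1).2 a⟩, hy, (gball_iff h2 hy r0 r1).2 b⟩, hy, (gball_iff h3 hy r0 r1).2 d⟩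
  ext u
  simp only [polar, PolS, Set.mem_ofPred_eq, mem_us]
  refine and_congr_right fun _ => ⟨fun h m hm => ?_, fun h m hm => ?_⟩
  · have := h (-m) ((key _).2 (by rwa [neg_neg]))
    rw [inner_neg_left] at this; linarith
  · have := h (-m) ((key _).1 hm)
    rw [inner_neg_left] at this; linarith

lemma reg_of_centers {x1 x2 x3 : E 2} {r : ℝ} (h : IsRegularCenters x1 x2 x3 r) : Reg (-x1) (-x2) (-x3) (Real.cos r) := by
  obtain ⟨h1, h2, h3, h12, h23, h13⟩ := h
  rw [mem_us] at h1 h2 h3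
  have key : ∀ x y : E 2, ‖x‖ = 1 → ‖y‖ = 1 → gdist x y = r → ⟪-x, -y⟫ = Real.cos r := by
    intro x y hx hy h
    have a := abs_le.1 ((inner_abs_le (b := y) hx).trans hy.le)
    rw [← h, gdist, Real.cos_arccos a.1 a.2, inner_neg_neg]
  exact ⟨by rwa [norm_neg], by rwa [norm_neg], by rwa [norm_neg], key _ _ h1 h2 h12, key _ _ h1 h3 h13, key _ _ h2 h3 h23⟩

lemma centers_of_reg {y1 y2 y3 : E 2} {r : ℝ} (r0 : 0 ≤ r) (r1 : r ≤ π) (h : Reg y1 y2 y3 (Real.cos r)) :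
    IsRegularCenters (-y1) (-y2) (-y3) r := by
  refine ⟨mem_us.2 (by rw [norm_neg]; exact h.h1), mem_us.2 (by rw [norm_neg]; exact h.h2), mem_us.2 (by rw [norm_neg]; exact h.h3), ?_, ?_, ?_⟩
  · rw [gdist, inner_neg_neg, h.h12, Real.arccos_cos r0 r1]
  · rw [gdist, inner_neg_neg, h.h23, Real.arccos_cos r0 r1]
  · rw [gdist, inner_neg_neg, h.h13, Real.arccos_cos r0 r1]

lemma gdist_near {u p : E 2} {η : ℝ} (hu : ‖u‖ = 1) (hp : ‖p‖ = 1) (h0 : 0 ≤ η) (h1 : η ≤ 1 / 2) :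
    u + η • p ≠ 0 ∧ gdist u (nrm (u + η • p)) ≤ π * η := by
  have np : 1 - η ≤ ‖u + η • p‖ := by
    have := norm_sub_norm_le u (-(η • p))
    rwa [norm_neg, norm_smul, hu, hp, mul_one, Real.norm_eq_abs, abs_of_nonneg h0, sub_neg_eq_add] at this
  have n2 : ‖u + η • p‖ ≤ 1 + η := by
    have := norm_add_le u (η • p)
    rwa [norm_smul, hu, hp, mul_one, Real.norm_eq_abs, abs_of_nonneg h0] at this
  have ne : u + η • p ≠ 0 := norm_pos_iff.1 (by linarith)
  refine ⟨ne, ?_⟩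
  have d : ‖u - nrm (u + η • p)‖ ≤ 2 * η := by
    have e : u - nrm (u + η • p) = (‖u + η • p‖ - 1) • nrm (u + η • p) - η • p := by
      rw [sub_smul, norm_smul_nrm, one_smul]; abel
    rw [e]
    refine (norm_sub_le _ _).trans ?_
    rw [norm_smul, norm_smul, norm_nrm ne, hp, Real.norm_eq_abs, Real.norm_eq_abs, abs_of_nonneg h0]
    have : |‖u + η • p‖ - 1| ≤ η := abs_le.2 ⟨by linarith, by linarith⟩
    linarith
  have d2 := pow_le_pow_left₀ (norm_nonneg _) d 2
  rw [norm_sub_sq_real, hu, norm_nrm ne] at d2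
  obtain ⟨t, ht⟩ : ∃ t, t = ⟪u, nrm (u + η • p)⟫ := ⟨_, rfl⟩
  rw [← ht] at d2
  have a := abs_le.1 ((inner_abs_le (b := nrm (u + η • p)) hu).trans (norm_nrm ne).le)
  rw [← ht] at a
  have q := Real.cos_le_one_sub_mul_cos_sq (x := Real.arccos t) (by
    rw [abs_of_nonneg (Real.arccos_nonneg _)]; exact Real.arccos_le_pi _)
  rw [Real.cos_arccos a.1 a.2] at q
  have q2 : 2 / π ^ 2 * Real.arccos t ^ 2 ≤ 2 * η ^ 2 := by nlinarith only [q, d2]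
  have q3 : Real.arccos t ^ 2 ≤ (π * η) ^ 2 := by
    rw [div_mul_eq_mul_div, div_le_iff₀ (by positivity)] at q2
    nlinarith only [q2]
  rw [gdist, ← ht]
  exact le_of_pow_le_pow_left₀ two_ne_zero (by positivity) q3

lemma sdist_le {x z : E 2} {A : Set (E 2)} (hz : z ∈ A) : sdist x A ≤ gdist x z := by
  apply csInf_le
  · refine ⟨0, ?_⟩
    rintro _ ⟨y, _, rfl⟩
    exact Real.arccos_nonneg _
  · exact ⟨z, hz, rfl⟩

lemma sdist_le_pi (x : E 2) (A : Set (E 2)) : sdist x A ≤ π := by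
  rcases A.eq_empty_or_nonempty with rfl | ⟨z, hz⟩
  · simp [sdist, Real.pi_pos.le]
  · exact (sdist_le hz).trans (Real.arccos_le_pi _)

lemma hausdorff_le {A B : Set (E 2)} {R : ℝ} (hR : 0 ≤ R) (h1 : ∀ x ∈ A, sdist x B ≤ R) (h2 : ∀ x ∈ B, sdist x A ≤ R) :
    hausdorffG A B ≤ R := by
  apply max_le
  · apply Real.sSup_le _ hR
    rintro _ ⟨x, hx, rfl⟩
    exact h1 x hx
  · apply Real.sSup_le _ hR
    rintro _ ⟨x, hx, rfl⟩
    exact h2 x hx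

theorem final (w : ℝ) (hw1 : π / 2 < w) (hw2 : w < π)
    (U₀ : Set (E 2)) (hU₀ : IsReuleaux U₀ (π - w)) :
    ∃ c > 0, ∀ ε > 0, ∀ K : Set (E 2), IsConvexBody K → width K = w →
      area K ≤ area (polar U₀) + ε →
      ∃ U : Set (E 2), IsReuleaux U (π - w) ∧ hausdorffG K (polar U) ≤ c * Real.sqrt ε := by
  have hpi := Real.pi_pos
  obtain ⟨r, hr⟩ : ∃ r, r = π - w := ⟨_, rfl⟩
  obtain ⟨c, hc⟩ : ∃ c, c = Real.cos r := ⟨_, rfl⟩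
  obtain ⟨s, hs⟩ : ∃ s, s = Real.sin r := ⟨_, rfl⟩
  have r0 : 0 < r := by rw [hr]; linarith
  have r1 : r < π / 2 := by rw [hr]; linarith
  have c0 : 0 < c := by rw [hc]; exact Real.cos_pos_of_mem_Ioo ⟨by linarith, r1⟩
  have s0 : 0 < s := by rw [hs]; exact Real.sin_pos_of_pos_of_lt_pi r0 (by linarith)
  have cs : c ^ 2 + s ^ 2 = 1 := by rw [hc, hs]; exact Real.cos_sq_add_sin_sq r
  have c1 : c < 1 := by nlinarith
  obtain ⟨C, hC, ε0, hε0, H⟩ := core c0 c1 s0 cs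
  obtain ⟨A, hA, HA⟩ := area_eq
  have hU := hU₀
  rw [← hr] at hU ⊢
  obtain ⟨x1, x2, x3, hx, hUx⟩ := hU
  have pol0 : polar U₀ = PolS (Reu (-x1) (-x2) (-x3) c) := by
    rw [hUx, hc]
    exact polar_reu (mem_us.1 hx.1) (mem_us.1 hx.2.1) (mem_us.1 hx.2.2.1) r0.le (by linarith)
  have reg0 : Reg (-x1) (-x2) (-x3) c := by rw [hc]; exact reg_of_centers hx
  have ar0 := reg0.pol_area c0 c1 s0 cs
  rw [← pol0] at ar0
  have meas0 : MeasurableSet (polar U₀) := by rw [pol0]; exact (isClosed_PolS _).measurableSet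
  obtain ⟨τ, hτ⟩ : ∃ τ, τ = min (√ε0) (1 / (2 * C)) := ⟨_, rfl⟩
  have τ0 : 0 < τ := by rw [hτ]; positivity
  refine ⟨(π * C + π / τ) / √A, by positivity, fun ε hε K hK hwK hKA => ?_⟩
  obtain ⟨e, he⟩ : ∃ e, e = ε / A := ⟨_, rfl⟩
  have e0 : 0 < e := by rw [he]; positivity
  have se : (π * C + π / τ) / √A * √ε = (π * C + π / τ) * √e := by
    rw [he, Real.sqrt_div hε.le]; ring
  rw [se]
  have sq0 : 0 < √e := Real.sqrt_pos.2 e0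
  rcases lt_or_ge (√e) τ with hlt | hge
  · have k1 : e < ε0 := by
      rw [hτ] at hlt
      exact (Real.sqrt_lt_sqrt_iff e0.le).1 (hlt.trans_le (min_le_left _ _))
    have k2 : C * √e ≤ 1 / 2 := by
      rw [hτ] at hlt
      have := (hlt.trans_le (min_le_right _ _)).le
      rw [le_div_iff₀ (by positivity)] at this
      linarith
    have pg := pair_ge hK (by linarith) hw2 hwK
    rw [← hr, ← hc] at pg
    obtain ⟨M, hsub, hM⟩ := completion c1 (fun m hm => hm.1) pg
    have hPne : (PolS K).Nonempty := by
      obtain ⟨v, hv, h⟩ := hK.1.2.1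
      exact ⟨v, mem_us.1 hv, fun k hk => by rw [real_inner_comm]; exact (h k hk).le⟩
    have bp := bipolar hK
    have aK : sg.real (PolS (PolS K)) ≤ 2 * π - 3 * Real.arccos (c / (1 + c)) * s + e := by
      rw [bp]
      rw [HA K hK.2.1.isClosed.measurableSet hK.1.1, HA _ meas0 (fun u hu => hu.1)] at hKA
      have : A * e = ε := by rw [he]; field_simp
      have : A * sg.real K ≤ A * (sg.real (polar U₀) + e) := by linarith
      have := le_of_mul_le_mul_left this hA
      linarith
    obtain ⟨y1, y2, y3, p, hR, hp, P1, P2⟩ := H (PolS K) M hM (hPne.mono hsub) hsub e e0 k1 aK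
    rw [bp] at P1
    refine ⟨gball (-y1) r ∩ gball (-y2) r ∩ gball (-y3) r, ⟨-y1, -y2, -y3, ?_, rfl⟩, ?_⟩
    · rw [hc] at hR
      exact centers_of_reg r0.le (by linarith) hR
    · rw [polar_reu (by rw [norm_neg]; exact hR.h1) (by rw [norm_neg]; exact hR.h2) (by rw [norm_neg]; exact hR.h3) r0.le (by linarith),
        neg_neg, neg_neg, neg_neg, ← hc]
      have big : π * (C * √e) ≤ (π * C + π / τ) * √e := by
        have : 0 ≤ π / τ * √e := by positivity
        linarith
      apply hausdorff_le (by positivity)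
      · intro u hu
        obtain ⟨g1, g2⟩ := gdist_near (mem_us.1 (hK.1.1 hu)) hp (η := C * √e) (by positivity) k2
        refine (sdist_le (z := nrm (u + (C * √e) • p)) ?_).trans (g2.trans big)
        refine ⟨norm_nrm g1, fun y hy => ?_⟩
        rw [nrm, real_inner_smul_right]
        exact mul_nonneg (by positivity) (P1 u hu y hy)
      · intro u hu
        obtain ⟨g1, g2⟩ := gdist_near hu.1 hp (η := C * √e) (by positivity) k2
        refine (sdist_le (z := nrm (u + (C * √e) • p)) ?_).trans (g2.trans big)
        rw [← bp]
        refine ⟨norm_nrm g1, fun y hy => ?_⟩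
        rw [nrm, real_inner_smul_right]
        exact mul_nonneg (by positivity) (P2 u hu y hy)
  · rw [← hr] at hU₀
    refine ⟨U₀, hU₀, ?_⟩
    have big : π ≤ (π * C + π / τ) * √e := by
      have h1 : 0 ≤ π * C * √e := by positivity
      have h2 : π / τ * τ ≤ π / τ * √e := mul_le_mul_of_nonneg_left hge (by positivity)
      have h3 : π / τ * τ = π := by field_simp
      linarith
    exact hausdorff_le (by positivity) (fun x _ => (sdist_le_pi x _).trans big) (fun x _ => (sdist_le_pi x _).trans big)

end PalAux

/-- stability of the isominwidth inequality for `π/2 < w < π`. -/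
theorem pal_stability_large_width (w : ℝ) (hw1 : π / 2 < w) (hw2 : w < π)
    (U₀ : Set (E 2)) (hU₀ : IsReuleaux U₀ (π - w)) :
    ∃ c > 0, ∀ ε > 0, ∀ K : Set (E 2), IsConvexBody K → width K = w →
      area K ≤ area (polar U₀) + ε →
      ∃ U : Set (E 2), IsReuleaux U (π - w) ∧ hausdorffG K (polar U) ≤ c * Real.sqrt ε := PalAux.final w hw1 hw2 U₀ hU₀
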